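/- Fix integers d ≥ 1, H ≥ 1, q ≥ 1, M ≥ 1, a gradient threshold θ > 0, and a degree bound Δ ≥ 1. Let Π be a set of instances (x, f) with x ∈ ℝ^d and f : ℝ^d → ℝ a Pfaffian function of degree at most Δ over some Pfaffian chain of length at most q and Pfaffian degree at most M, and let ℓ(η, x, f) be the gradient-descent cost. Then for every ε > 0, every δ ∈ (0,1), every P ⊆ ℝ_{≥0}, and every probability distribution D over Π, (ε, δ)-uniform convergence of the class {(x, f) ↦ ℓ(η, x, f) : η ∈ P} holds with m samples, where m = O((H²/ε²)(q²d²H² + qdH·log(Δ + M) + log(1/δ))). -/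

import Mathlib

open MeasureTheory

/-- Gradient-descent iterates: `gdIter f x η i` is the `(i+1)`-st iterate `x_{i+1}`,
so `gdIter f x η 0 = x₁ = x` and `x_{i+1} = x_i - η ∇f(x_i)`. -/
noncomputable def gdIter {d : ℕ} (f : EuclideanSpace ℝ (Fin d) → ℝ)
    (x : EuclideanSpace ℝ (Fin d)) (η : ℝ) : ℕ → EuclideanSpace ℝ (Fin d)
  | 0 => x
  | i + 1 => gdIter f x η i - η • gradient f (gdIter f x η i)

/-- Gradient-descent cost: the smallest `i ∈ {1,…,H}` with `‖∇f(x_i)‖ < θ` if it exists,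
and `H` otherwise. -/
noncomputable def gdCost {d : ℕ} (H : ℕ) (θ : ℝ) (f : EuclideanSpace ℝ (Fin d) → ℝ)
    (x : EuclideanSpace ℝ (Fin d)) (η : ℝ) : ℕ :=
  sInf ({i | 1 ≤ i ∧ i ≤ H ∧ ‖gradient f (gdIter f x η (i - 1))‖ < θ} ∪ {H})

/-- A Pfaffian chain of length `q` and Pfaffian degree at most `M` on `ℝ^d`: continuously
differentiable functions whose partial derivatives are polynomials (of degree ≤ `M`) in the
variables and the previous chain functions (triangularity). -/
def IsPfaffianChain {d q : ℕ} (M : ℕ)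
    (c : Fin q → (EuclideanSpace ℝ (Fin d) → ℝ)) : Prop :=
  (∀ j, ContDiff ℝ 1 (c j)) ∧
  ∃ P : Fin d → Fin q → MvPolynomial (Fin d ⊕ Fin q) ℝ,
    ∀ i j, (P i j).totalDegree ≤ M ∧
      (∀ k : Fin q, Sum.inr k ∈ (P i j).vars → (k : ℕ) ≤ (j : ℕ)) ∧
      ∀ a : EuclideanSpace ℝ (Fin d),
        fderiv ℝ (c j) a (EuclideanSpace.single i 1) =
          MvPolynomial.eval (Sum.elim (fun i' => a i') (fun k => c k a)) (P i j)

/-- A Pfaffian function of degree at most `Δ` over some Pfaffian chain of length at most `q`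
and Pfaffian degree at most `M`. -/
def IsPfaffian {d : ℕ} (q M Δ : ℕ) (f : EuclideanSpace ℝ (Fin d) → ℝ) : Prop :=
  ∃ c : Fin q → (EuclideanSpace ℝ (Fin d) → ℝ), IsPfaffianChain M c ∧
    ∃ Q : MvPolynomial (Fin d ⊕ Fin q) ℝ, Q.totalDegree ≤ Δ ∧
      ∀ a : EuclideanSpace ℝ (Fin d),
        f a = MvPolynomial.eval (Sum.elim (fun i => a i) (fun k => c k a)) Q

section

open Set Filter Topology

theorem kh_global_flow {E : Type*} [NormedAddCommGroup E] [NormedSpace ℝ E] [CompleteSpace E]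
    (v : E → E) (K B : NNReal) (hK : LipschitzWith K v) (hB : ∀ x, ‖v x‖ ≤ B) (x : E) :
    ∃ γ : ℝ → E, γ 0 = x ∧ ∀ t, HasDerivAt γ (v (γ t)) t := by
  have h1 : ∀ a : ℝ, 0 < a → ∃ γ : ℝ → E, γ 0 = x ∧ ∀ t ∈ Ioo (-a) a, HasDerivAt γ (v (γ t)) t := by
    intro a ha
    have h0 : (0:ℝ) ∈ Icc (-a) a := ⟨by linarith, ha.le⟩
    have hpl : IsPicardLindelof (fun _ => v) (⟨0, h0⟩ : Icc (-a) a) x (B * a.toNNReal) 0 B K := by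
      apply IsPicardLindelof.of_time_independent
      · intro y _; exact hB y
      · exact hK.lipschitzOnWith
      · simp [ha.le]
    obtain ⟨γ, hγ0, hγ⟩ := hpl.exists_eq_forall_mem_Icc_hasDerivWithinAt₀
    refine ⟨γ, hγ0, fun t ht => ?_⟩
    exact (hγ t ⟨ht.1.le, ht.2.le⟩).hasDerivAt (Icc_mem_nhds ht.1 ht.2)
  choose! γ hγ0 hγ using h1
  have key : ∀ a b : ℝ, 0 < a → a ≤ b → EqOn (γ a) (γ b) (Ioo (-a) a) := by
    intro a b ha hab
    apply ODE_solution_unique_of_mem_Ioo (v := fun _ => v) (s := fun _ => univ) (K := K) (t₀ := 0)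
    · intro t _; exact hK.lipschitzOnWith
    · exact ⟨by linarith, ha⟩
    · intro t ht; exact ⟨hγ a ha t ht, mem_univ _⟩
    · intro t ht; exact ⟨hγ b (by linarith) t ⟨by linarith [ht.1], by linarith [ht.2]⟩, mem_univ _⟩
    · rw [hγ0 a ha, hγ0 b (by linarith)]
  refine ⟨fun t => γ (|t| + 1) t, ?_, fun t => ?_⟩
  · exact hγ0 _ (by positivity)
  · have ht : t ∈ Ioo (-(|t|+1)) (|t|+1) := by
      rw [mem_Ioo, ← abs_lt]; linarith
    have hpos : 0 < |t| + 1 := by positivity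
    have := hγ (|t|+1) hpos t ht
    refine HasDerivAt.congr_of_eventuallyEq this ?_
    filter_upwards [Ioo_mem_nhds ht.1 ht.2] with s hs
    have hs' : s ∈ Ioo (-(|s|+1)) (|s|+1) := by
      rw [mem_Ioo, ← abs_lt]; linarith
    rcases le_total (|s|+1) (|t|+1) with h | h
    · exact key _ _ (by positivity) h hs'
    · exact (key _ _ (by positivity) h hs).symm

theorem kh_flow_unique {E : Type*} [NormedAddCommGroup E] [NormedSpace ℝ E]
    (v : E → E) (K : NNReal) (hK : LipschitzWith K v) (γ γ' : ℝ → E)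
    (h : ∀ t, HasDerivAt γ (v (γ t)) t) (h' : ∀ t, HasDerivAt γ' (v (γ' t)) t) (a b : ℝ)
    (hab : γ a = γ' b) (t : ℝ) : γ (a + t) = γ' (b + t) := by
  have : (fun t => γ (a + t)) = (fun t => γ' (b + t)) := by
    apply ODE_solution_unique_univ (v := fun _ => v) (s := fun _ => univ) (K := K) (t₀ := 0)
    · intro t; exact hK.lipschitzOnWith
    · intro t; exact ⟨(h (a + t)).comp_const_add a t, mem_univ _⟩
    · intro t; exact ⟨(h' (b + t)).comp_const_add b t, mem_univ _⟩
    · simpa using hab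
  exact congrFun this t

/-- An orbit which stays in a compact set of regular points is periodic. -/
theorem kh_recur {E : Type*} [NormedAddCommGroup E] [NormedSpace ℝ E]
    (v : E → E) (K B : NNReal) (hK : LipschitzWith K v) (hB : ∀ x, ‖v x‖ ≤ B)
    (A : Set E) (hA : IsCompact A) (G : Set E)
    (loc : ∀ p ∈ A, ∃ u : E →L[ℝ] ℝ, ∃ U ∈ 𝓝 p, InjOn u (G ∩ U) ∧ 0 < u (v p))
    (γ : ℝ → E) (hγ : ∀ t, HasDerivAt γ (v (γ t)) t) (hG : ∀ t, γ t ∈ G)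
    (hγA : ∀ t, 0 ≤ t → γ t ∈ A) : ∃ a b : ℝ, a < b ∧ γ a = γ b := by
  obtain ⟨p, hpA, φ, hφ, hlim⟩ := hA.tendsto_subseq (x := fun n : ℕ => γ n)
    (fun n => hγA n (by positivity))
  obtain ⟨u, U, hU, hinj, hup⟩ := loc p hpA
  -- a ball where u ∘ v is bounded below
  have hc : ∀ᶠ x in 𝓝 p, u (v p) / 2 < u (v x) := by
    have : Continuous fun x => u (v x) := u.continuous.comp hK.continuous
    exact this.continuousAt.eventually_const_lt (by linarith)
  obtain ⟨r, hr, hball⟩ := Metric.eventually_nhds_iff_ball.1 (hc.and hU)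
  set c := u (v p) / 2 with hcdef
  have hc0 : 0 < c := by positivity
  -- time step
  obtain ⟨τ, hτ0, hτ1, hτ⟩ : ∃ τ : ℝ, 0 < τ ∧ τ < 1/2 ∧ B * τ < r / 2 := by
    refine ⟨min (1/4) (r / (4 * (B + 1))), by positivity, ?_, ?_⟩
    · exact lt_of_le_of_lt (min_le_left _ _) (by norm_num)
    · have : (B:ℝ) * min (1/4) (r / (4 * (B + 1))) ≤ (B + 1) * (r / (4 * (B + 1))) := by
        apply mul_le_mul (by linarith) (min_le_right _ _) (by positivity) (by positivity)
      have h2 : ((B:ℝ) + 1) * (r / (4 * (B + 1))) = r / 4 := by field_simp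
      linarith
  have hlip : LipschitzWith B γ := by
    apply lipschitzWith_of_nnnorm_deriv_le (fun t => (hγ t).differentiableAt)
    intro t
    rw [(hγ t).deriv]
    exact hB _
  have hucont : ContinuousAt u p := u.continuous.continuousAt
  have hev : ∀ᶠ x in 𝓝 p, dist x p < r / 2 ∧ |u x - u p| < c * τ := by
    refine Filter.Eventually.and (Metric.ball_mem_nhds p (half_pos hr)) ?_
    have := hucont.sub_const (u p)
    have h2 : Tendsto (fun x => |u x - u p|) (𝓝 p) (𝓝 0) := by
      have := this.abs
      simpa [ContinuousAt] using this
    exact h2.eventually_lt_const (by positivity)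
  have hev2 := hlim.eventually hev
  obtain ⟨N, hN⟩ := eventually_atTop.1 hev2
  have hit : ∀ n : ℝ, dist (γ n) p < r / 2 → |u (γ n) - u p| < c * τ →
      ∃ a, |a - n| ≤ τ ∧ γ a ∈ G ∩ U ∧ u (γ a) = u p := by
    intro n h1 h2
    have hin : ∀ a ∈ Icc (n - τ) (n + τ), γ a ∈ Metric.ball p r := by
      intro a ha
      have : dist (γ a) (γ n) ≤ B * dist a n := hlip.dist_le_mul a n
      have h3 : dist a n ≤ τ := by
        rw [Real.dist_eq, abs_le]; constructor <;> linarith [ha.1, ha.2]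
      have h4 : (B:ℝ) * dist a n ≤ B * τ := by gcongr
      rw [Metric.mem_ball]
      linarith [dist_triangle (γ a) (γ n) p]
    have hd : ∀ a, HasDerivAt (fun a => u (γ a)) (u (v (γ a))) a := fun a =>
      u.hasFDerivAt.comp_hasDerivAt a (hγ a)
    have hcont : Continuous (fun a => u (γ a)) := continuous_iff_continuousAt.2 fun a => (hd a).continuousAt
    have grow : ∀ x ∈ Icc (n - τ) (n + τ), ∀ y ∈ Icc (n - τ) (n + τ), x ≤ y →
        c * (y - x) ≤ u (γ y) - u (γ x) := by
      apply Convex.mul_sub_le_image_sub_of_le_deriv (convex_Icc _ _) hcont.continuousOn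
      · exact fun a _ => (hd a).differentiableAt.differentiableWithinAt
      · intro a ha
        rw [(hd a).deriv]
        exact ((hball _ (hin a (interior_subset ha))).1).le
    have e1 := grow n ⟨by linarith, by linarith⟩ (n + τ) ⟨by linarith, by linarith⟩ (by linarith)
    have e2 := grow (n - τ) ⟨by linarith, by linarith⟩ n ⟨by linarith, by linarith⟩ (by linarith)
    rw [abs_lt] at h2
    have hmem : u p ∈ Icc (u (γ (n - τ))) (u (γ (n + τ))) := by
      constructor <;> nlinarith
    obtain ⟨a, ha, hau⟩ := intermediate_value_Icc (by linarith) hcont.continuousOn hmem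
    refine ⟨a, by rw [abs_le]; constructor <;> linarith [ha.1, ha.2], ⟨hG a, (hball _ (hin a ha)).2⟩, hau⟩
  obtain ⟨a, ha, haG, hau⟩ := hit (φ N) (hN N le_rfl).1 (hN N le_rfl).2
  obtain ⟨b, hb, hbG, hbu⟩ := hit (φ (N+1)) (hN (N+1) (by omega)).1 (hN (N+1) (by omega)).2
  refine ⟨a, b, ?_, hinj haG hbG (by rw [hau, hbu])⟩
  have : (φ N : ℝ) + 1 ≤ φ (N+1) := by exact_mod_cast hφ (Nat.lt_succ_self N)
  rw [abs_le] at ha hb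
  linarith [ha.2, hb.1]

/-- Along the flow, each zero of `h` with `J > ε` leads to its own point with `J = ε`. -/
theorem kh_flow_exit {E : Type*} [NormedAddCommGroup E] [NormedSpace ℝ E] [CompleteSpace E]
    (v : E → E) (K B : NNReal) (hK : LipschitzWith K v) (hB : ∀ x, ‖v x‖ ≤ B)
    (G : Set E) (hGc : IsCompact G) (J h : E → ℝ) (hJ : Continuous J) (hh : Continuous h)
    (inv : ∀ γ : ℝ → E, (∀ t, HasDerivAt γ (v (γ t)) t) → γ 0 ∈ G → ∀ t, γ t ∈ G)
    (hder : ∀ γ : ℝ → E, (∀ t, HasDerivAt γ (v (γ t)) t) → ∀ t, γ t ∈ G → h (γ t) = 0 →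
      HasDerivAt (fun s => h (γ s)) (J (γ t)) t)
    (loc : ∀ p ∈ G, 0 < J p → ∃ u : E →L[ℝ] ℝ, ∃ U ∈ 𝓝 p, InjOn u (G ∩ U) ∧ 0 < u (v p))
    (ε : ℝ) (hε : 0 < ε) :
    ∃ Q : E → E, (∀ z ∈ G, h z = 0 → ε < J z → Q z ∈ G ∧ J (Q z) = ε) ∧
      InjOn Q {z | z ∈ G ∧ h z = 0 ∧ ε < J z} := by
  have hpos : ∀ γ : ℝ → E, (∀ t, HasDerivAt γ (v (γ t)) t) → ∀ t, γ t ∈ G → h (γ t) = 0 →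
      0 < J (γ t) → (∀ᶠ s in 𝓝[>] t, 0 < h (γ s)) ∧ (∀ᶠ s in 𝓝[<] t, h (γ s) < 0) := by
    intro γ hγ t ht h0 hJt
    have hd := hder γ hγ t ht h0
    have hs := (hasDerivAt_iff_tendsto_slope.1 hd).eventually (eventually_gt_nhds hJt)
    constructor
    · have : ∀ᶠ s in 𝓝[>] t, 0 < slope (fun s => h (γ s)) t s :=
        hs.filter_mono (nhdsWithin_mono _ (fun s hs => ne_of_gt hs))
      filter_upwards [this, self_mem_nhdsWithin] with s h1 h2
      rw [slope_def_field, h0, sub_zero] at h1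
      have h3 : 0 < s - t := sub_pos.2 h2
      rwa [div_pos_iff_of_pos_right h3] at h1
    · have : ∀ᶠ s in 𝓝[<] t, 0 < slope (fun s => h (γ s)) t s :=
        hs.filter_mono (nhdsWithin_mono _ (fun s hs => ne_of_lt hs))
      filter_upwards [this, self_mem_nhdsWithin] with s h1 h2
      rw [slope_def_field, h0, sub_zero] at h1
      have h3 : s - t < 0 := sub_neg.2 h2
      by_contra hcon
      exact absurd h1 (not_lt.2 (div_nonpos_of_nonneg_of_nonpos (not_lt.1 hcon) h3.le))
  have main : ∀ z, (z ∈ G ∧ h z = 0 ∧ ε < J z) → ∃ γ : ℝ → E, ∃ T : ℝ, γ 0 = z ∧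
      (∀ t, HasDerivAt γ (v (γ t)) t) ∧ 0 < T ∧ (∀ s, 0 < s → s ≤ T → h (γ s) ≠ 0) ∧
      γ T ∈ G ∧ J (γ T) = ε := by
    rintro z ⟨hzG, hz0, hzJ⟩
    obtain ⟨γ, hγ0, hγ⟩ := kh_global_flow v K B hK hB z
    have hγG := inv γ hγ (by rw [hγ0]; exact hzG)
    have hγc : Continuous γ := continuous_iff_continuousAt.2 fun t => (hγ t).continuousAt
    have hJc : Continuous fun t => J (γ t) := hJ.comp hγc
    have hhc : Continuous fun t => h (γ t) := hh.comp hγc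
    -- claim: if J ≥ ε on [0,T] then h>0 on (0,T]
    have claim : ∀ T, 0 < T → (∀ t, 0 ≤ t → t ≤ T → ε ≤ J (γ t)) → ∀ s, 0 < s → s ≤ T → 0 < h (γ s) := by
      intro T hT hJT s hs0 hsT
      by_contra hneg
      push Not at hneg
      have h1 := (hpos γ hγ 0 (hγG 0) (by rw [hγ0]; exact hz0) (by rw [hγ0]; linarith)).1
      obtain ⟨s0, ⟨hs0pos, hs0s⟩, hs0h⟩ : ∃ s0, (0 < s0 ∧ s0 < s) ∧ 0 < h (γ s0) := by
        have := (h1.and (Ioo_mem_nhdsGT hs0)).exists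
        obtain ⟨s0, ha, hb⟩ := this
        exact ⟨s0, hb, ha⟩
      -- first zero after s0
      let Z : Set ℝ := Icc s0 s ∩ {t | h (γ t) ≤ 0}
      have hZc : IsCompact Z := isCompact_Icc.inter_right (isClosed_le hhc continuous_const)
      have hZne : Z.Nonempty := ⟨s, ⟨hs0s.le, le_rfl⟩, hneg⟩
      obtain ⟨t1, ht1, hmin⟩ := hZc.exists_isLeast hZne
      have ht1pos : s0 < t1 := by
        rcases lt_or_eq_of_le ht1.1.1 with h | h
        · exact h
        · exfalso; have := ht1.2; simp only [mem_ofPred_eq, ← h] at this; linarith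
      have hbefore : ∀ t, s0 ≤ t → t < t1 → 0 < h (γ t) := by
        intro t hta htb
        by_contra hcon
        have : t ∈ Z := ⟨⟨hta, by linarith [ht1.1.2]⟩, not_lt.1 hcon⟩
        linarith [hmin this]
      have hev : ∀ᶠ t in 𝓝[<] t1, 0 < h (γ t) := by
        filter_upwards [Ioo_mem_nhdsLT ht1pos] with t ht
        exact hbefore t ht.1.le ht.2
      have hge : 0 ≤ h (γ t1) := by
        have : Tendsto (fun t => h (γ t)) (𝓝[<] t1) (𝓝 (h (γ t1))) :=
          hhc.continuousAt.tendsto.mono_left nhdsWithin_le_nhds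
        exact ge_of_tendsto this (hev.mono fun t ht => ht.le)
      have hz1 : h (γ t1) = 0 := le_antisymm ht1.2 hge
      have hJ1 : 0 < J (γ t1) := by
        linarith [hJT t1 (by linarith) (by linarith [ht1.1.2])]
      have h2 := (hpos γ hγ t1 (hγG t1) hz1 hJ1).2
      obtain ⟨t, ha, hb⟩ := (h2.and hev).exists
      linarith
    -- J must reach ε
    have hreach : ∃ t, 0 ≤ t ∧ J (γ t) ≤ ε := by
      by_contra hcon
      push Not at hcon
      obtain ⟨a, b, hab, heq⟩ := kh_recur v K B hK hB (G ∩ {x | ε ≤ J x})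
        (hGc.inter_right (isClosed_le continuous_const hJ)) G
        (fun p hp => loc p hp.1 (lt_of_lt_of_le hε hp.2)) γ hγ hγG
        (fun t ht => ⟨hγG t, (hcon t ht).le⟩)
      have h1 := kh_flow_unique v K hK γ γ hγ hγ a b heq (-a)
      rw [add_neg_cancel, hγ0] at h1
      have h2 := claim (b - a) (by linarith) (fun t ht _ => (hcon t ht).le) (b - a) (by linarith) le_rfl
      rw [← sub_eq_add_neg] at h1
      rw [← h1] at h2
      linarith
    obtain ⟨t, ht0, htJ⟩ := hreach
    let Z : Set ℝ := Icc 0 t ∩ {t | J (γ t) ≤ ε}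
    have hZc : IsCompact Z := isCompact_Icc.inter_right (isClosed_le hJc continuous_const)
    obtain ⟨T, hT, hmin⟩ := hZc.exists_isLeast ⟨t, ⟨ht0, le_rfl⟩, htJ⟩
    have hTpos : 0 < T := by
      rcases lt_or_eq_of_le hT.1.1 with h | h
      · exact h
      · exfalso; have := hT.2; simp only [mem_ofPred_eq, ← h, hγ0] at this; linarith
    have hbefore : ∀ s, 0 ≤ s → s < T → ε < J (γ s) := by
      intro s hsa hsb
      by_contra hcon
      have : s ∈ Z := ⟨⟨hsa, by linarith [hT.1.2]⟩, not_lt.1 hcon⟩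
      linarith [hmin this]
    have hge : ε ≤ J (γ T) := by
      have : Tendsto (fun t => J (γ t)) (𝓝[<] T) (𝓝 (J (γ T))) :=
        hJc.continuousAt.tendsto.mono_left nhdsWithin_le_nhds
      refine ge_of_tendsto this ?_
      filter_upwards [Ioo_mem_nhdsLT hTpos] with s hs
      exact (hbefore s hs.1.le hs.2).le
    have hJT : J (γ T) = ε := le_antisymm hT.2 hge
    refine ⟨γ, T, hγ0, hγ, hTpos, ?_, hγG T, hJT⟩
    intro s hs hsT
    refine (claim T hTpos ?_ s hs hsT).ne'
    intro r hr hrT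
    rcases lt_or_eq_of_le hrT with h | h
    · exact (hbefore r hr h).le
    · rw [h]; exact hge
  choose! γ T h0 hγ hT hne hTG hTJ using main
  refine ⟨fun z => γ z (T z), fun z h1 h2 h3 => ⟨hTG z ⟨h1, h2, h3⟩, hTJ z ⟨h1, h2, h3⟩⟩, ?_⟩
  have key : ∀ z, (z ∈ G ∧ h z = 0 ∧ ε < J z) → ∀ z', (z' ∈ G ∧ h z' = 0 ∧ ε < J z') →
      γ z (T z) = γ z' (T z') → T z' ≤ T z → z = z' := by
    intro z hz z' hz' heq hle
    have h1 := kh_flow_unique v K hK (γ z) (γ z') (hγ z hz) (hγ z' hz') (T z) (T z') heq (-T z')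
    rw [add_neg_cancel, h0 z' hz'] at h1
    rcases lt_or_eq_of_le hle with hlt | he
    · exfalso
      apply hne z hz (T z + -T z') (by linarith) (by linarith [hT z' hz'])
      rw [h1]; exact hz'.2.1
    · rw [he, add_neg_cancel, h0 z hz] at h1
      exact h1
  intro z hz z' hz' heq
  rcases le_total (T z') (T z) with h | h
  · exact key z hz z' hz' heq h
  · exact (key z' hz' z hz heq.symm h).symm

end

section

open MeasureTheory

/-- Strict derivative of a polynomial map. -/
theorem kh_eval_strict {σ : Type*} [Fintype σ] [DecidableEq σ] (F : MvPolynomial σ ℝ) (x : σ → ℝ) :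
    HasStrictFDerivAt (fun y : σ → ℝ => MvPolynomial.eval y F)
      (∑ l, MvPolynomial.eval x (MvPolynomial.pderiv l F) •
        (ContinuousLinearMap.proj l : (σ → ℝ) →L[ℝ] ℝ)) x := by
  induction F using MvPolynomial.induction_on with
  | C a =>
    simp only [MvPolynomial.eval_C, MvPolynomial.pderiv_C, map_zero, zero_smul,
      Finset.sum_const_zero]
    exact hasStrictFDerivAt_const _ _
  | add p q hp hq =>
    have := hp.add hq
    simp only [map_add, add_smul, Finset.sum_add_distrib]
    exact this
  | mul_X p n hp =>
    have h1 : HasStrictFDerivAt (fun y : σ → ℝ => y n)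
        (ContinuousLinearMap.proj n : (σ → ℝ) →L[ℝ] ℝ) x :=
      (ContinuousLinearMap.proj n : (σ → ℝ) →L[ℝ] ℝ).hasStrictFDerivAt
    have := hp.mul h1
    simp only [map_mul, MvPolynomial.eval_X]
    refine this.congr_fderiv ?_
    ext v
    simp only [Derivation.leibniz, MvPolynomial.pderiv_X, map_add, smul_eq_mul, map_mul,
      MvPolynomial.eval_X, add_smul, Finset.sum_add_distrib, Finset.smul_sum, smul_smul]
    congr 1
    symm
    rw [Finset.sum_eq_single n]
    · simp
    · intro b _ hb
      simp [Pi.single_apply, hb.symm]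
    · simp

theorem kh_eval_continuous {σ : Type*} [Fintype σ] (F : MvPolynomial σ ℝ) :
    Continuous (fun y : σ → ℝ => MvPolynomial.eval y F) := MvPolynomial.continuous_eval F

theorem kh_strict_pi {σ : Type*} [Fintype σ] [DecidableEq σ] {Φ : (σ → ℝ) → σ → ℝ}
    {A : Matrix σ σ ℝ} {p : σ → ℝ}
    (h : ∀ i, HasStrictFDerivAt (fun x => Φ x i)
      (∑ l, A i l • (ContinuousLinearMap.proj l : (σ → ℝ) →L[ℝ] ℝ)) p) :
    HasStrictFDerivAt Φ (LinearMap.toContinuousLinearMap (Matrix.toLin' A)) p := by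
  rw [hasStrictFDerivAt_pi']
  intro i
  refine (h i).congr_fderiv ?_
  ext v
  simp [Matrix.mulVec, dotProduct]

theorem kh_persist {σ : Type*} [Fintype σ] [DecidableEq σ] {Φ : (σ → ℝ) → σ → ℝ}
    {A : Matrix σ σ ℝ} {p : σ → ℝ}
    (h : ∀ i, HasStrictFDerivAt (fun x => Φ x i)
      (∑ l, A i l • (ContinuousLinearMap.proj l : (σ → ℝ) →L[ℝ] ℝ)) p)
    (hA : A.det ≠ 0) {U : Set (σ → ℝ)} (hU : U ∈ nhds p) :
    ∀ᶠ w in nhds (Φ p), ∃ x ∈ U, Φ x = w := by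
  have h1 := kh_strict_pi h
  have hs : (LinearMap.toContinuousLinearMap (Matrix.toLin' A)).range = ⊤ := by
    rw [LinearMap.range_eq_top]
    have : Function.Surjective A.mulVec := by
      rw [Matrix.mulVec_surjective_iff_isUnit, Matrix.isUnit_iff_isUnit_det]
      exact isUnit_iff_ne_zero.2 hA
    intro y
    obtain ⟨x, hx⟩ := this y
    exact ⟨x, by simpa using hx⟩
  have h2 := h1.map_nhds_eq_of_surj hs
  rw [← h2, Filter.eventually_map]
  filter_upwards [hU] with x hx
  exact ⟨x, hx, rfl⟩

theorem kh_bezout {σ : Type*} [Fintype σ] [DecidableEq σ] (F : σ → MvPolynomial σ ℝ) (D : σ → ℕ)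
    (hD : ∀ i, (F i).totalDegree ≤ D i) (hD1 : ∀ i, 1 ≤ D i) (S : Finset (σ → ℝ))
    (hS : ∀ p ∈ S, (∀ i, MvPolynomial.eval p (F i) = 0) ∧
      (Matrix.of fun i l => MvPolynomial.eval p (MvPolynomial.pderiv l (F i))).det ≠ 0) :
    S.card ≤ (Fintype.card σ + 2) ^ Fintype.card σ * ∏ i, D i := by
  classical
  set n := Fintype.card σ with hn
  set N := ∏ i, D i with hN
  set T := (n + 2) ^ n with hT
  set J := T * N with hJ
  set R := (n + 1) * J with hR
  have hN1 : 1 ≤ N := Finset.one_le_prod' (fun i _ => hD1 i)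
  have hT1 : 1 ≤ T := Nat.one_le_pow _ _ (by omega)
  let b : σ → ℕ := fun i => T * ∏ j ∈ Finset.univ.erase i, D j
  have hbD : ∀ i, b i * D i = J := by
    intro i
    simp only [b, hJ, hN]
    rw [mul_assoc, Finset.prod_erase_mul _ _ (Finset.mem_univ i)]
  -- separating linear form
  obtain ⟨u, hu⟩ : ∃ u : (σ → ℝ) →ₗ[ℝ] ℝ, ∀ p ∈ S, ∀ q ∈ S, p ≠ q → u p ≠ u q := by
    obtain ⟨u, hu⟩ := Module.exists_dual_forall_apply_ne_zero (K := ℝ)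
      (fun z : {z : (S × S) // z.1 ≠ z.2} => ((z.1.1 : σ → ℝ) - (z.1.2 : σ → ℝ)))
      (fun z => sub_ne_zero.2 (fun h => z.2 (Subtype.ext h)))
    refine ⟨u, fun p hp q hq hpq he => ?_⟩
    have := hu ⟨(⟨p, hp⟩, ⟨q, hq⟩), fun h => hpq (congrArg Subtype.val h)⟩
    apply this
    simp [he]
  let U : MvPolynomial σ ℝ := ∑ l, MvPolynomial.C (u (Pi.single l 1)) * MvPolynomial.X l
  have hUe : ∀ x, MvPolynomial.eval x U = u x := by
    intro x
    simp only [U, map_sum, map_mul, MvPolynomial.eval_C, MvPolynomial.eval_X]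
    conv_rhs => rw [LinearMap.pi_apply_eq_sum_univ u x]
    refine Finset.sum_congr rfl fun i _ => ?_
    rw [smul_eq_mul, mul_comm]
    congr 2
    ext j
    simp [Pi.single_apply, eq_comm]
  have hUd : U.totalDegree ≤ 1 := by
    refine MvPolynomial.totalDegree_finsetSum_le fun l _ => ?_
    refine (MvPolynomial.totalDegree_mul _ _).trans ?_
    simp [MvPolynomial.totalDegree_X]
  let I := (Π i, Fin (b i + 1)) × Fin (J + 1)
  let Mon : I → MvPolynomial σ ℝ := fun a => (∏ i, F i ^ (a.1 i : ℕ)) * U ^ (a.2 : ℕ)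
  have hMon : ∀ a, (Mon a).totalDegree ≤ R := by
    intro a
    refine (MvPolynomial.totalDegree_mul _ _).trans ?_
    have h1 : (∏ i, F i ^ (a.1 i : ℕ)).totalDegree ≤ n * J := by
      refine (MvPolynomial.totalDegree_finsetProd _ _).trans ?_
      refine (Finset.sum_le_card_nsmul _ _ J fun i _ => ?_).trans ?_
      · refine (MvPolynomial.totalDegree_pow _ _).trans ?_
        refine le_trans ?_ (hbD i).le
        exact Nat.mul_le_mul (Nat.lt_succ_iff.1 (a.1 i).2) (hD i)
      · simp [hn]
    have h2 : (U ^ (a.2 : ℕ)).totalDegree ≤ J := by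
      refine (MvPolynomial.totalDegree_pow _ _).trans ?_
      calc (a.2 : ℕ) * U.totalDegree ≤ J * 1 :=
            Nat.mul_le_mul (Nat.lt_succ_iff.1 (a.2).2) hUd
        _ = J := mul_one _
    calc _ ≤ n * J + J := add_le_add h1 h2
      _ = R := by rw [hR]; ring
  let Ψ : (I → ℝ) →ₗ[ℝ] ((σ → Fin (R + 1)) → ℝ) :=
    { toFun := fun c e => ∑ a, c a * MvPolynomial.coeff
        (Finsupp.equivFunOnFinite.symm fun i => (e i : ℕ)) (Mon a)
      map_add' := by
        intro c c'
        ext e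
        simp [add_mul, Finset.sum_add_distrib]
      map_smul' := by
        intro r c
        ext e
        simp [mul_assoc, Finset.mul_sum] }
  have hcard : Module.finrank ℝ ((σ → Fin (R + 1)) → ℝ) < Module.finrank ℝ (I → ℝ) := by
    rw [Module.finrank_fintype_fun_eq_card, Module.finrank_fintype_fun_eq_card]
    simp only [I, Fintype.card_prod, Fintype.card_pi, Fintype.card_fin, Finset.prod_const]
    rw [Finset.card_univ, ← hn]
    have h3 : (∏ i, b i) * N = J ^ n := by
      rw [hN, ← Finset.prod_mul_distrib, Finset.prod_congr rfl (fun i _ => hbD i)]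
      simp [hn]
    have h4 : (∏ i, b i) ≤ ∏ i, (b i + 1) := Finset.prod_le_prod' fun i _ => Nat.le_succ _
    have h5 : 0 < ∏ i, (b i + 1) := Finset.prod_pos fun i _ => Nat.succ_pos _
    have hJ1 : 1 ≤ J := by rw [hJ]; exact Nat.mul_pos hT1 hN1
    calc (R + 1) ^ n ≤ ((n + 2) * J) ^ n := by
          refine Nat.pow_le_pow_left ?_ _
          rw [hR]; nlinarith
      _ = T * J ^ n := by rw [mul_pow]
      _ = (∏ i, b i) * J := by rw [← h3, hJ]; ring
      _ ≤ (∏ i, (b i + 1)) * J := Nat.mul_le_mul_right _ h4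
      _ < (∏ i, (b i + 1)) * (J + 1) := Nat.mul_lt_mul_of_pos_left (Nat.lt_succ_self _) h5
  obtain ⟨c, hc0, hcne⟩ := (Submodule.ne_bot_iff _).1 (LinearMap.ker_ne_bot_of_finrank_lt hcard (f := Ψ))
  have hrel : ∑ a, MvPolynomial.C (c a) * Mon a = 0 := by
    ext m
    simp only [MvPolynomial.coeff_sum, MvPolynomial.coeff_C_mul, MvPolynomial.coeff_zero]
    by_cases hm : ∀ i, m i < R + 1
    · have := congrFun (LinearMap.mem_ker.1 hc0) (fun i => ⟨m i, hm i⟩)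
      simp only [Ψ, LinearMap.coe_mk, AddHom.coe_mk, Pi.zero_apply] at this
      convert this using 4
      all_goals (ext i; simp)
    · push Not at hm
      obtain ⟨i, hi⟩ := hm
      refine Finset.sum_eq_zero fun a _ => ?_
      rw [MvPolynomial.coeff_eq_zero_of_totalDegree_lt, mul_zero]
      refine (hMon a).trans_lt (Nat.lt_of_succ_le (hi.trans ?_))
      by_cases him : i ∈ m.support
      · exact Finset.single_le_sum (f := fun i => m i) (fun _ _ => Nat.zero_le _) him
      · rw [Finsupp.notMem_support_iff.1 him]; exact Nat.zero_le _
  obtain ⟨⟨a0, j0⟩, ha0⟩ : ∃ a, c a ≠ 0 := by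
    by_contra h
    push Not at h
    exact hcne (funext h)
  let Gp : Fin (J + 1) → MvPolynomial σ ℝ := fun j => ∑ a : (Π i, Fin (b i + 1)),
    MvPolynomial.monomial (Finsupp.equivFunOnFinite.symm fun i => (a i : ℕ)) (c (a, j))
  have hG0 : Gp j0 ≠ 0 := by
    intro h
    have h2 := congrArg (MvPolynomial.coeff (Finsupp.equivFunOnFinite.symm fun i => (a0 i : ℕ))) h
    simp only [Gp, MvPolynomial.coeff_sum, MvPolynomial.coeff_monomial, MvPolynomial.coeff_zero] at h2
    rw [Finset.sum_eq_single a0] at h2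
    · simp at h2; exact ha0 h2
    · intro a _ ha
      rw [if_neg]
      intro h3
      apply ha
      ext i
      have := DFunLike.congr_fun h3 i
      simpa using this
    · simp
  have hGe : ∀ j w, MvPolynomial.eval w (Gp j) = ∑ a : (Π i, Fin (b i + 1)),
      c (a, j) * ∏ i, w i ^ (a i : ℕ) := by
    intro j w
    simp only [Gp, map_sum, MvPolynomial.eval_monomial]
    refine Finset.sum_congr rfl fun a _ => ?_
    rw [Finsupp.prod_fintype _ _ (by simp)]
    simp
  have hrel2 : ∀ x, ∑ j : Fin (J + 1), MvPolynomial.eval (fun i => MvPolynomial.eval x (F i)) (Gp j)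
      * (u x) ^ (j : ℕ) = 0 := by
    intro x
    have := congrArg (MvPolynomial.eval x) hrel
    simp only [map_sum, map_mul, MvPolynomial.eval_C, Mon, map_prod, map_pow, hUe, map_zero] at this
    rw [← this, Fintype.sum_prod_type_right]
    refine Finset.sum_congr rfl fun j _ => ?_
    rw [hGe, Finset.sum_mul]
    refine Finset.sum_congr rfl fun a _ => ?_
    ring
  -- separated neighbourhoods
  have huc : Continuous u := u.continuous_of_finiteDimensional
  obtain ⟨ρ, hρ, hsep⟩ : ∃ ρ > 0, ∀ p ∈ S, ∀ q ∈ S, p ≠ q → 2 * ρ ≤ |u p - u q| := by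
    have : ∀ z ∈ (S ×ˢ S).filter (fun z => z.1 ≠ z.2), 0 < |u z.1 - u z.2| := by
      intro z hz
      simp only [Finset.mem_filter, Finset.mem_product] at hz
      exact abs_pos.2 (sub_ne_zero.2 (hu _ hz.1.1 _ hz.1.2 hz.2))
    by_cases hne : ((S ×ˢ S).filter (fun z => z.1 ≠ z.2)).Nonempty
    · obtain ⟨z, hz, hmin⟩ := Finset.exists_min_image _ (fun z => |u z.1 - u z.2|) hne
      refine ⟨|u z.1 - u z.2| / 2, half_pos (this z hz), fun p hp q hq hpq => ?_⟩
      have := hmin (p, q) (by simp [hp, hq, hpq])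
      simp only at this
      linarith
    · refine ⟨1, one_pos, fun p hp q hq hpq => ?_⟩
      exact absurd ⟨(p, q), by simp [hp, hq, hpq]⟩ hne
  have hev : ∀ᶠ w in nhds (0 : σ → ℝ), ∀ p ∈ S, ∃ x, |u x - u p| < ρ ∧
      (fun i => MvPolynomial.eval x (F i)) = w := by
    rw [Filter.eventually_all_finset]
    intro p hp
    have h1 := kh_persist (Φ := fun x i => MvPolynomial.eval x (F i))
      (A := Matrix.of fun i l => MvPolynomial.eval p (MvPolynomial.pderiv l (F i))) (p := p)
      (fun i => kh_eval_strict (F i) p) (hS p hp).2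
      (U := {x | |u x - u p| < ρ}) (by
        apply IsOpen.mem_nhds
        · exact isOpen_lt ((huc.sub continuous_const).abs) continuous_const
        · simpa using hρ)
    have h0 : (fun i => MvPolynomial.eval p (F i)) = (0 : σ → ℝ) := funext (hS p hp).1
    rw [h0] at h1
    exact h1
  obtain ⟨w, hw, hwG⟩ : ∃ w : σ → ℝ, (∀ p ∈ S, ∃ x, |u x - u p| < ρ ∧
      (fun i => MvPolynomial.eval x (F i)) = w) ∧ MvPolynomial.eval w (Gp j0) ≠ 0 := by
    by_contra hcon
    push Not at hcon
    apply hG0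
    obtain ⟨r, hr, hball⟩ := Metric.eventually_nhds_iff.1 hev
    refine MvPolynomial.funext_set (fun _ : σ => Set.Ioo (-(r/2)) (r/2))
      (fun _ => Set.Ioo_infinite (by linarith)) ?_
    intro w hw
    rw [map_zero]
    apply hcon w
    apply hball
    rw [dist_zero_right]
    have : ‖w‖ ≤ r / 2 := by
      rw [pi_norm_le_iff_of_nonneg (by linarith)]
      intro i
      have := hw i (Set.mem_univ i)
      rw [Real.norm_eq_abs, abs_le]
      exact ⟨this.1.le, this.2.le⟩
    linarith
  choose! x hx using hw
  let q : Polynomial ℝ := ∑ j : Fin (J + 1), Polynomial.monomial (j : ℕ) (MvPolynomial.eval w (Gp j))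
  have hq0 : q ≠ 0 := by
    intro h
    have := congrArg (fun p => Polynomial.coeff p (j0 : ℕ)) h
    simp only [q, Polynomial.finsetSum_coeff, Polynomial.coeff_monomial, Polynomial.coeff_zero] at this
    rw [Finset.sum_eq_single j0] at this
    · simp at this; exact hwG this
    · intro j _ hj
      rw [if_neg]
      intro h; exact hj (Fin.ext h)
    · simp
  have hqd : q.natDegree ≤ J := by
    refine Polynomial.natDegree_sum_le_of_forall_le _ _ fun j _ => ?_
    exact (Polynomial.natDegree_monomial_le _).trans (Nat.lt_succ_iff.1 j.2)
  have hroot : ∀ p ∈ S, u (x p) ∈ q.roots.toFinset := by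
    intro p hp
    rw [Multiset.mem_toFinset, Polynomial.mem_roots hq0]
    have := hrel2 (x p)
    rw [(hx p hp).2] at this
    rw [Polynomial.IsRoot.def]
    simpa [q, Polynomial.eval_finsetSum, Polynomial.eval_monomial] using this
  have hinj : Set.InjOn (fun p => u (x p)) S := by
    intro p hp p' hp' he
    by_contra hne
    have h1 := hsep p hp p' hp' hne
    have h2 := (hx p hp).1
    have h3 := (hx p' hp').1
    simp only at he
    rw [he] at h2
    rw [abs_lt] at h2 h3
    have : |u p - u p'| < 2 * ρ := by rw [abs_lt]; constructor <;> linarith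
    linarith
  calc S.card ≤ q.roots.toFinset.card := Finset.card_le_card_of_injOn _ hroot hinj
    _ ≤ Multiset.card q.roots := Multiset.toFinset_card_le _
    _ ≤ q.natDegree := Polynomial.card_roots' _
    _ ≤ J := hqd

end

section

open MeasureTheory

theorem kh_equiv {σ : Type*} [Fintype σ] (A : (σ → ℝ) →L[ℝ] (σ → ℝ))
    (hA : ∀ v, A v = 0 → v = 0) : ∃ e : (σ → ℝ) ≃L[ℝ] (σ → ℝ), (e : (σ → ℝ) →L[ℝ] (σ → ℝ)) = A := by
  have hinj : Function.Injective (A : (σ → ℝ) →ₗ[ℝ] (σ → ℝ)) := by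
    rw [← LinearMap.ker_eq_bot, LinearMap.ker_eq_bot']
    exact hA
  refine ⟨(LinearEquiv.ofInjectiveEndo _ hinj).toContinuousLinearEquiv, ?_⟩
  ext v i
  rfl

theorem kh_persist2 {σ : Type*} [Fintype σ] {Φ : (σ → ℝ) → σ → ℝ}
    {A : (σ → ℝ) →L[ℝ] (σ → ℝ)} {p : σ → ℝ} (h : HasStrictFDerivAt Φ A p)
    (hA : ∀ v, A v = 0 → v = 0) {U : Set (σ → ℝ)} (hU : U ∈ nhds p) :
    ∀ᶠ w in nhds (Φ p), ∃ x ∈ U, Φ x = w := by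
  obtain ⟨e, rfl⟩ := kh_equiv A hA
  rw [← h.map_nhds_eq_of_equiv, Filter.eventually_map]
  filter_upwards [hU] with x hx
  exact ⟨x, hx, rfl⟩

theorem kh_locinj {σ : Type*} [Fintype σ] {Φ : (σ → ℝ) → σ → ℝ}
    {A : (σ → ℝ) →L[ℝ] (σ → ℝ)} {p : σ → ℝ} (h : HasStrictFDerivAt Φ A p)
    (hA : ∀ v, A v = 0 → v = 0) : ∃ U ∈ nhds p, Set.InjOn Φ U := by
  obtain ⟨e, rfl⟩ := kh_equiv A hA
  refine ⟨{x | h.localInverse Φ e p (Φ x) = x}, h.eventually_left_inverse, ?_⟩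
  intro x hx y hy hxy
  have hx' : h.localInverse Φ e p (Φ x) = x := hx
  have hy' : h.localInverse Φ e p (Φ y) = y := hy
  rw [← hx', ← hy', hxy]

def khT (L : ℕ) : Fin (L + 2) := ⟨L, by omega⟩
def khS (L : ℕ) : Fin (L + 2) := ⟨L + 1, by omega⟩

/-- Replace the first `k` coordinates by the values of the chain functions. -/
noncomputable def khRho {L : ℕ} (g : ℕ → ℝ → ℝ) (k : ℕ) (x : Fin (L + 2) → ℝ) : Fin (L + 2) → ℝ :=
  fun i => if (i : ℕ) < k then g i (x (khT L)) else x i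

noncomputable def khMat {L : ℕ} (P : ℕ → MvPolynomial (Fin (L + 2)) ℝ) (k : ℕ)
    (F : Fin (L + 2) → MvPolynomial (Fin (L + 2)) ℝ) :
    Matrix (Fin (L + 2)) (Fin (L + 2)) (MvPolynomial (Fin (L + 2)) ℝ) :=
  fun i l => if (i : ℕ) < k then
    (if l = i then 1 else 0) - (if l = khT L then P i else 0)
    else MvPolynomial.pderiv l (F i)

def khChain (L : ℕ) (g : ℕ → ℝ → ℝ) (P : ℕ → MvPolynomial (Fin (L + 2)) ℝ) : Prop :=
  ∀ j < L, ∀ p : Fin (L + 2) → ℝ, (∀ i : Fin (L + 2), (i : ℕ) ≤ j → p i = g i (p (khT L))) →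
    HasDerivAt (g j) (MvPolynomial.eval p (P j)) (p (khT L))

noncomputable def khGrad {L : ℕ} (F : MvPolynomial (Fin (L + 2)) ℝ) (p : Fin (L + 2) → ℝ) :
    (Fin (L + 2) → ℝ) →L[ℝ] ℝ :=
  ∑ l, MvPolynomial.eval p (MvPolynomial.pderiv l F) •
        (ContinuousLinearMap.proj l : (Fin (L + 2) → ℝ) →L[ℝ] ℝ)

noncomputable def khTau {L : ℕ} (P : ℕ → MvPolynomial (Fin (L + 2)) ℝ) (k : ℕ)
    (p : Fin (L + 2) → ℝ) : (Fin (L + 2) → ℝ) →L[ℝ] (Fin (L + 2) → ℝ) :=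
  ContinuousLinearMap.pi fun l => if (l : ℕ) < k then
    MvPolynomial.eval p (P l) • (ContinuousLinearMap.proj (khT L) : (Fin (L + 2) → ℝ) →L[ℝ] ℝ)
    else (ContinuousLinearMap.proj l : (Fin (L + 2) → ℝ) →L[ℝ] ℝ)

section
variable {L : ℕ} {g : ℕ → ℝ → ℝ} {P : ℕ → MvPolynomial (Fin (L + 2)) ℝ}

theorem khTau_apply (k : ℕ) (p v : Fin (L + 2) → ℝ) (l : Fin (L + 2)) :
    khTau P k p v l = if (l : ℕ) < k then MvPolynomial.eval p (P l) * v (khT L) else v l := by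
  unfold khTau
  rw [ContinuousLinearMap.pi_apply]
  split_ifs <;> simp

theorem khTau_t {k : ℕ} (hk : k ≤ L) (p v : Fin (L + 2) → ℝ) :
    khTau P k p v (khT L) = v (khT L) := by
  rw [khTau_apply, if_neg]
  simp [khT]; omega

theorem khRho_t {k : ℕ} (hk : k ≤ L) (x : Fin (L + 2) → ℝ) :
    khRho g k x (khT L) = x (khT L) := by
  unfold khRho
  rw [if_neg]
  simp [khT]; omega

theorem khRho_lt {k : ℕ} (x : Fin (L + 2) → ℝ) {i : Fin (L + 2)} (hi : (i : ℕ) < k) :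
    khRho g k x i = g i (x (khT L)) := by
  unfold khRho; rw [if_pos hi]

theorem khRho_ge {k : ℕ} (x : Fin (L + 2) → ℝ) {i : Fin (L + 2)} (hi : ¬ (i : ℕ) < k) :
    khRho g k x i = x i := by
  unfold khRho; rw [if_neg hi]

theorem khMat_mulVec (k : ℕ) (F : Fin (L + 2) → MvPolynomial (Fin (L + 2)) ℝ)
    (p v : Fin (L + 2) → ℝ) (i : Fin (L + 2)) :
    ((khMat P k F).map (MvPolynomial.eval p)).mulVec v i =
      if (i : ℕ) < k then v i - MvPolynomial.eval p (P i) * v (khT L) else khGrad (F i) p v := by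
  simp only [Matrix.mulVec, dotProduct, Matrix.map_apply, khMat, khGrad]
  split_ifs with h
  · simp only [map_sub, apply_ite (MvPolynomial.eval p), map_one, map_zero, sub_mul, ite_mul, one_mul,
      zero_mul, Finset.sum_sub_distrib, Finset.sum_ite_eq', Finset.mem_univ, if_true]
  · simp

theorem khChain.hasDerivAt (hc : khChain L g P) {k : ℕ} (hk : k ≤ L) (x : Fin (L + 2) → ℝ)
    {j : ℕ} (hj : j < k) :
    HasDerivAt (g j) (MvPolynomial.eval (khRho g k x) (P j)) (x (khT L)) := by
  have := hc j (by omega) (khRho g k x) (by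
    intro i hi
    rw [khRho_lt _ (by omega), khRho_t hk])
  rwa [khRho_t hk] at this

theorem khChain.contDiff (hc : khChain L g P) {j : ℕ} (hj : j < L) : ContDiff ℝ 1 (g j) := by
  have hder : ∀ j < L, ∀ t, HasDerivAt (g j) (MvPolynomial.eval
      (khRho (L := L) g L (fun _ => t)) (P j)) t := fun j hj t =>
    hc.hasDerivAt le_rfl (fun _ => t) hj
  have hcont : ∀ j < L, Continuous (g j) := fun j hj =>
    continuous_iff_continuousAt.2 fun t => (hder j hj t).continuousAt
  rw [contDiff_one_iff_deriv]
  refine ⟨fun t => (hder j hj t).differentiableAt, ?_⟩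
  have : deriv (g j) = fun t => MvPolynomial.eval (khRho (L := L) g L (fun _ => t)) (P j) :=
    funext fun t => (hder j hj t).deriv
  rw [this]
  refine (MvPolynomial.continuous_eval (P j)).comp ?_
  refine continuous_pi fun i => ?_
  unfold khRho
  by_cases h : (i : ℕ) < L
  · simp only [h, if_true]
    exact hcont _ h
  · simp only [h, if_false]
    exact continuous_id

theorem khChain.strict (hc : khChain L g P) {k : ℕ} (hk : k ≤ L) (x : Fin (L + 2) → ℝ)
    {j : ℕ} (hj : j < k) :
    HasStrictFDerivAt (fun y : Fin (L + 2) → ℝ => g j (y (khT L)))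
      (MvPolynomial.eval (khRho g k x) (P j) •
        (ContinuousLinearMap.proj (khT L) : (Fin (L + 2) → ℝ) →L[ℝ] ℝ)) x := by
  have h1 : HasStrictDerivAt (g j) (MvPolynomial.eval (khRho g k x) (P j)) (x (khT L)) := by
    have h2 := (hc.contDiff (j := j) (by omega)).contDiffAt (x := x (khT L))
    have h3 := h2.hasStrictDerivAt (by simp)
    rwa [(hc.hasDerivAt hk x hj).deriv] at h3
  exact h1.comp_hasStrictFDerivAt x
    (ContinuousLinearMap.proj (khT L) : (Fin (L + 2) → ℝ) →L[ℝ] ℝ).hasStrictFDerivAt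

theorem khRho_strict (hc : khChain L g P) {k : ℕ} (hk : k ≤ L) (x : Fin (L + 2) → ℝ) :
    HasStrictFDerivAt (khRho g k) (khTau P k (khRho g k x)) x := by
  unfold khTau
  rw [hasStrictFDerivAt_pi]
  intro i
  by_cases h : (i : ℕ) < k
  · simp only [h, if_true, khRho]
    exact hc.strict hk x h
  · simp only [h, if_false, khRho]
    exact (ContinuousLinearMap.proj i : (Fin (L + 2) → ℝ) →L[ℝ] ℝ).hasStrictFDerivAt

theorem khRho_contDiff (hc : khChain L g P) {k : ℕ} (hk : k ≤ L) :
    ContDiff ℝ 1 (khRho (L := L) g k) := by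
  rw [contDiff_pi]
  intro i
  by_cases h : (i : ℕ) < k
  · simp only [h, if_true, khRho]
    exact (hc.contDiff (by omega)).comp
      (ContinuousLinearMap.proj (khT L) : (Fin (L + 2) → ℝ) →L[ℝ] ℝ).contDiff
  · simp only [h, if_false, khRho]
    exact (ContinuousLinearMap.proj i : (Fin (L + 2) → ℝ) →L[ℝ] ℝ).contDiff

theorem khF_strict (hc : khChain L g P) {k : ℕ} (hk : k ≤ L) (F : MvPolynomial (Fin (L + 2)) ℝ)
    (x : Fin (L + 2) → ℝ) :
    HasStrictFDerivAt (fun y => MvPolynomial.eval (khRho g k y) F)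
      ((khGrad F (khRho g k x)).comp (khTau P k (khRho g k x))) x :=
  HasStrictFDerivAt.comp x (kh_eval_strict F (khRho g k x)) (khRho_strict hc hk x)

theorem kh_eval_contDiff (F : MvPolynomial (Fin (L + 2)) ℝ) :
    ContDiff ℝ 1 (fun y : Fin (L + 2) → ℝ => MvPolynomial.eval y F) := by
  induction F using MvPolynomial.induction_on with
  | C a => simpa using contDiff_const
  | add p q hp hq => simpa using hp.add hq
  | mul_X p n hp =>
    simpa using hp.mul (ContinuousLinearMap.proj n : (Fin (L + 2) → ℝ) →L[ℝ] ℝ).contDiff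

/-- Adjugate vector. -/
theorem kh_adj (k : ℕ) (F : Fin (L + 2) → MvPolynomial (Fin (L + 2)) ℝ) (p : Fin (L + 2) → ℝ)
    (i0 : Fin (L + 2)) :
    ((khMat P k F).map (MvPolynomial.eval p)).mulVec
      (fun l => MvPolynomial.eval p ((khMat P k F).adjugate l i0)) =
      Pi.single i0 (MvPolynomial.eval p (khMat P k F).det) := by
  have h := congrArg (fun M : Matrix (Fin (L + 2)) (Fin (L + 2)) (MvPolynomial (Fin (L + 2)) ℝ) =>
    M.map (MvPolynomial.eval p)) (Matrix.mul_adjugate (khMat P k F))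
  simp only [Matrix.map_mul] at h
  ext i
  have h2 := congrFun (congrFun h i) i0
  rw [Matrix.mul_apply] at h2
  simp only [Matrix.mulVec, dotProduct]
  simp only [Matrix.map_apply] at h2 ⊢
  rw [h2]
  simp only [Matrix.smul_apply, Matrix.one_apply, smul_eq_mul, mul_ite, mul_one, mul_zero,
    Pi.single_apply]
  split_ifs <;> simp

theorem kh_det_eval (k : ℕ) (F : Fin (L + 2) → MvPolynomial (Fin (L + 2)) ℝ)
    (p : Fin (L + 2) → ℝ) :
    ((khMat P k F).map (MvPolynomial.eval p)).det = MvPolynomial.eval p (khMat P k F).det := by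
  rw [RingHom.map_det]; rfl

end

end

section

open MeasureTheory

section
variable {L : ℕ} {g : ℕ → ℝ → ℝ} {P : ℕ → MvPolynomial (Fin (L + 2)) ℝ}

noncomputable def khNext (P : ℕ → MvPolynomial (Fin (L + 2)) ℝ) (k : ℕ)
    (F : Fin (L + 2) → MvPolynomial (Fin (L + 2)) ℝ) (c : Fin (L + 2) → ℝ) (ε : ℝ) :
    Fin (L + 2) → MvPolynomial (Fin (L + 2)) ℝ :=
  fun i => if (i : ℕ) = k then (khMat P (k + 1) F).det - MvPolynomial.C ε
    else F i - MvPolynomial.C (c i)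

theorem khGrad_sub_C (F : MvPolynomial (Fin (L + 2)) ℝ) (a : ℝ) (p : Fin (L + 2) → ℝ) :
    khGrad (F - MvPolynomial.C a) p = khGrad F p := by
  unfold khGrad
  simp

/-- zero the first `k` coordinates -/
def khZero (k : ℕ) (x : Fin (L + 2) → ℝ) : Fin (L + 2) → ℝ :=
  fun i => if (i : ℕ) < k then 0 else x i

theorem khRho_khZero {k : ℕ} (hk : k ≤ L) (x : Fin (L + 2) → ℝ) :
    khRho g k (khZero k x) = khRho g k x := by
  have ht : khZero k x (khT L) = x (khT L) := by
    unfold khZero; rw [if_neg]; simp [khT]; omega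
  ext i
  unfold khRho
  rw [ht]
  split_ifs with h
  · rfl
  · simp [khZero, h]

/-- Sard's lemma step: regular values. -/
theorem kh_sard (hc : khChain L g P) {k : ℕ} (hk : k < L)
    (F : Fin (L + 2) → MvPolynomial (Fin (L + 2)) ℝ) (ρ : ℝ) (hρ : 0 < ρ) :
    ∃ w : Fin (L + 2) → ℝ, ‖w‖ < ρ ∧ 0 < w ⟨k, by omega⟩ ∧
      ∀ p : Fin (L + 2) → ℝ, khRho g k p = p →
        (∀ i : Fin (L + 2), k < (i : ℕ) → MvPolynomial.eval p (F i) = w i) →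
        MvPolynomial.eval p (khMat P (k + 1) F).det = w ⟨k, by omega⟩ →
        MvPolynomial.eval p (khMat P k (khNext P k F w (w ⟨k, by omega⟩))).det ≠ 0 := by
  set kI : Fin (L + 2) := ⟨k, by omega⟩ with hkI
  set Jp := (khMat P (k + 1) F).det with hJp
  let Φ : (Fin (L + 2) → ℝ) → Fin (L + 2) → ℝ := fun x i =>
    if (i : ℕ) < k then x i else MvPolynomial.eval (khRho g k x) (if (i : ℕ) = k then Jp else F i)
  let Φ' : (Fin (L + 2) → ℝ) → (Fin (L + 2) → ℝ) →L[ℝ] (Fin (L + 2) → ℝ) := fun x =>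
    ContinuousLinearMap.pi fun i => if (i : ℕ) < k then
      (ContinuousLinearMap.proj i : (Fin (L + 2) → ℝ) →L[ℝ] ℝ) else
      (khGrad (if (i : ℕ) = k then Jp else F i) (khRho g k x)).comp (khTau P k (khRho g k x))
  have hΦ : ∀ x, HasStrictFDerivAt Φ (Φ' x) x := by
    intro x
    simp only [Φ']
    rw [hasStrictFDerivAt_pi]
    intro i
    by_cases h : (i : ℕ) < k
    · simp only [h, if_true, Φ]
      exact (ContinuousLinearMap.proj i : (Fin (L + 2) → ℝ) →L[ℝ] ℝ).hasStrictFDerivAt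
    · simp only [h, if_false, Φ]
      exact khF_strict hc hk.le _ x
  let K : Set (Fin (L + 2) → ℝ) := {x | (Φ' x).det = 0}
  have hK : volume (Φ '' K) = 0 :=
    addHaar_image_eq_zero_of_det_fderivWithin_eq_zero volume
      (fun x _ => (hΦ x).hasFDerivAt.hasFDerivWithinAt) (fun x hx => hx)
  let W : Set (Fin (L + 2) → ℝ) := {w | ‖w‖ < ρ ∧ 0 < w kI}
  have hWo : IsOpen W := (isOpen_lt continuous_norm continuous_const).inter
    (isOpen_lt continuous_const (continuous_apply kI))
  have hWne : W.Nonempty := by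
    refine ⟨fun _ => ρ / 2, ?_, ?_⟩
    · have : ‖(fun _ => ρ / 2 : Fin (L + 2) → ℝ)‖ ≤ ρ / 2 := by
        rw [pi_norm_le_iff_of_nonneg (by linarith)]
        intro i
        rw [Real.norm_eq_abs, abs_of_pos (by linarith)]
      linarith
    · show 0 < ρ / 2
      linarith
  obtain ⟨w, hwW, hwK⟩ : ∃ w ∈ W, w ∉ Φ '' K := by
    by_contra hcon
    push Not at hcon
    have h1 : volume W ≤ volume (Φ '' K) := measure_mono hcon
    have h2 := hWo.measure_pos volume hWne
    rw [hK] at h1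
    exact absurd h1 (not_le.2 h2)
  refine ⟨w, hwW.1, hwW.2, ?_⟩
  intro p hp hpF hpJ hdet
  apply hwK
  rw [← kh_det_eval] at hdet
  obtain ⟨v, hv0, hv⟩ := Matrix.exists_mulVec_eq_zero_iff.2 hdet
  have hvi := fun i => congrFun hv i
  simp only [khMat_mulVec, Pi.zero_apply] at hvi
  have hp' : ∀ i : Fin (L + 2), (i : ℕ) < k → p i = g i (p (khT L)) := by
    intro i hi
    rw [← khRho_lt (g := g) (k := k) p hi, hp]
  have htk : ¬ ((khT L : Fin (L + 2)) : ℕ) < k := by simp [khT]; omega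
  let x : Fin (L + 2) → ℝ := fun i => if (i : ℕ) < k then w i else p i
  have hxt : x (khT L) = p (khT L) := by simp only [x]; rw [if_neg htk]
  have hρx : khRho g k x = p := by
    ext i
    by_cases hi : (i : ℕ) < k
    · rw [khRho_lt _ hi, hxt, hp' i hi]
    · rw [khRho_ge _ hi]; simp only [x]; rw [if_neg hi]
  have hτ : khTau P k p (khZero k v) = v := by
    ext l
    rw [khTau_apply]
    have h0 : khZero k v (khT L) = v (khT L) := by unfold khZero; rw [if_neg htk]
    split_ifs with h
    · have := hvi l
      rw [if_pos h] at this
      rw [h0]; linarith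
    · simp [khZero, h]
  refine ⟨x, ?_, ?_⟩
  · show (Φ' x).det = 0
    by_contra hne
    have hz : Φ' x (khZero k v) = 0 := by
      ext i
      simp only [Φ', ContinuousLinearMap.pi_apply, hρx, Pi.zero_apply]
      by_cases h : (i : ℕ) < k
      · simp [h, khZero]
      · simp only [h, if_false, ContinuousLinearMap.comp_apply]
        rw [hτ]
        have h2 := hvi i
        rw [if_neg h] at h2
        unfold khNext at h2
        split_ifs at h2 ⊢ with h3
        · rw [khGrad_sub_C] at h2; exact h2
        · rw [khGrad_sub_C] at h2; exact h2
    have hunit : IsUnit (LinearMap.det ((Φ' x : (Fin (L + 2) → ℝ) →L[ℝ] (Fin (L + 2) → ℝ)) :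
        (Fin (L + 2) → ℝ) →ₗ[ℝ] (Fin (L + 2) → ℝ))) := isUnit_iff_ne_zero.2 hne
    have hker := LinearMap.ker_eq_bot'.1 (LinearMap.isUnit_iff_ker_eq_bot _ |>.1
      (LinearMap.isUnit_iff_isUnit_det _ |>.2 hunit)) (khZero k v) hz
    apply hv0
    rw [← hτ, hker, map_zero]
  · ext i
    simp only [Φ]
    by_cases h : (i : ℕ) < k
    · simp [h, x]
    · simp only [h, if_false, hρx]
      split_ifs with h3
      · rw [hpJ]
        congr 1
        exact Fin.ext h3.symm
      · exact hpF i (by omega)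
end

end

section

open MeasureTheory

section
variable {L : ℕ} {g : ℕ → ℝ → ℝ} {P : ℕ → MvPolynomial (Fin (L + 2)) ℝ}

theorem kh_flow_step (hc : khChain L g P) {k : ℕ} (hk : k < L)
    (F : Fin (L + 2) → MvPolynomial (Fin (L + 2)) ℝ) (r : ℝ)
    (hF : ∀ p, MvPolynomial.eval p (F (khS L)) = ∑ l, p l ^ 2 - r)
    (c : Fin (L + 2) → ℝ) (ε : ℝ) (hε : 0 < ε) :
    ∃ Q : (Fin (L + 2) → ℝ) → (Fin (L + 2) → ℝ),
      (∀ p, khRho g (k + 1) p = p →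
        (∀ i : Fin (L + 2), k < (i : ℕ) → MvPolynomial.eval p (F i) = c i) →
        ε < MvPolynomial.eval p (khMat P (k + 1) F).det →
        khRho g k (Q p) = Q p ∧
        (∀ i : Fin (L + 2), k < (i : ℕ) → MvPolynomial.eval (Q p) (F i) = c i) ∧
        MvPolynomial.eval (Q p) (khMat P (k + 1) F).det = ε) ∧
      Set.InjOn Q {p | khRho g (k + 1) p = p ∧
        (∀ i : Fin (L + 2), k < (i : ℕ) → MvPolynomial.eval p (F i) = c i) ∧
        ε < MvPolynomial.eval p (khMat P (k + 1) F).det} := by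
  set kI : Fin (L + 2) := ⟨k, by omega⟩ with hkI
  set Jp := (khMat P (k + 1) F).det with hJp
  have htk : ¬ ((khT L : Fin (L + 2)) : ℕ) < k := by simp [khT]; omega
  have hkk : ¬ ((kI : Fin (L + 2)) : ℕ) < k := by simp [hkI]
  have hρc : ContDiff ℝ 1 (khRho (L := L) g k) := khRho_contDiff hc hk.le
  let V : (Fin (L + 2) → ℝ) → (Fin (L + 2) → ℝ) :=
    fun p l => MvPolynomial.eval p ((khMat P (k + 1) F).adjugate l kI)
  have hV : ∀ p, ((khMat P (k + 1) F).map (MvPolynomial.eval p)).mulVec (V p) =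
      Pi.single kI (MvPolynomial.eval p Jp) := fun p => kh_adj (k + 1) F p kI
  have hVlt : ∀ p, ∀ i : Fin (L + 2), (i : ℕ) < k →
      V p i = MvPolynomial.eval p (P i) * V p (khT L) := by
    intro p i hi
    have := congrFun (hV p) i
    rw [khMat_mulVec, if_pos (by omega), Pi.single_eq_of_ne] at this
    · linarith
    · intro h; rw [h] at hi; exact hkk hi
  have hVk : ∀ p, V p kI - MvPolynomial.eval p (P k) * V p (khT L) = MvPolynomial.eval p Jp := by
    intro p
    have := congrFun (hV p) kI
    rw [khMat_mulVec, if_pos (by simp [hkI]), Pi.single_eq_same] at this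
    exact this
  have hVgt : ∀ p, ∀ i : Fin (L + 2), k < (i : ℕ) → khGrad (F i) p (V p) = 0 := by
    intro p i hi
    have := congrFun (hV p) i
    rw [khMat_mulVec, if_neg (by omega), Pi.single_eq_of_ne] at this
    · exact this
    · intro h; rw [h] at hi; simp [hkI] at hi
  have hτV : ∀ p, khTau P k p (khZero k (V p)) = V p := by
    intro p
    ext l
    rw [khTau_apply]
    have h0 : khZero k (V p) (khT L) = V p (khT L) := by unfold khZero; rw [if_neg htk]
    split_ifs with h
    · rw [h0, hVlt p l h]
    · simp [khZero, h]
  -- the compact curve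
  let G : Set (Fin (L + 2) → ℝ) := {x | (∀ j : Fin (L + 2), (j : ℕ) < k → x j = 0) ∧
    ∀ i : Fin (L + 2), k < (i : ℕ) → MvPolynomial.eval (khRho g k x) (F i) = c i}
  have hGcl : IsClosed G := by
    have h1 : IsClosed {x : Fin (L + 2) → ℝ | ∀ j : Fin (L + 2), (j : ℕ) < k → x j = 0} := by
      simp only [Set.ofPred_forall]
      exact isClosed_iInter fun j => isClosed_iInter fun _ =>
        isClosed_eq (continuous_apply j) continuous_const
    have h2 : IsClosed {x : Fin (L + 2) → ℝ | ∀ i : Fin (L + 2), k < (i : ℕ) →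
        MvPolynomial.eval (khRho g k x) (F i) = c i} := by
      simp only [Set.ofPred_forall]
      exact isClosed_iInter fun j => isClosed_iInter fun _ =>
        isClosed_eq ((MvPolynomial.continuous_eval _).comp hρc.continuous) continuous_const
    exact h1.inter h2
  set R : ℝ := Real.sqrt (c (khS L) + r) with hR
  have hGb : ∀ x ∈ G, ‖x‖ ≤ R := by
    intro x hx
    rw [pi_norm_le_iff_of_nonneg (Real.sqrt_nonneg _)]
    intro i
    by_cases hi : (i : ℕ) < k
    · rw [hx.1 i hi, norm_zero]; exact Real.sqrt_nonneg _
    · have h1 := hx.2 (khS L) (by simp [khS]; omega)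
      rw [hF] at h1
      have h2 : (khRho g k x i) ^ 2 ≤ ∑ l, khRho g k x l ^ 2 :=
        Finset.single_le_sum (f := fun l => khRho g k x l ^ 2) (fun _ _ => sq_nonneg _)
          (Finset.mem_univ i)
      rw [khRho_ge _ hi] at h2
      rw [Real.norm_eq_abs]
      exact Real.abs_le_sqrt (by linarith)
  have hGc : IsCompact G := by
    refine Metric.isCompact_of_isClosed_isBounded hGcl ?_
    refine (Metric.isBounded_closedBall (x := (0 : Fin (L + 2) → ℝ)) (r := R)).subset ?_
    intro x hx
    rw [mem_closedBall_zero_iff]; exact hGb x hx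
  -- bump
  have hR0 : 0 ≤ R := Real.sqrt_nonneg _
  let χ : ContDiffBump (0 : Fin (L + 2) → ℝ) := ⟨R + 1, R + 2, by linarith, by linarith⟩
  have hχ : ∀ x ∈ G, χ x = 1 := by
    intro x hx
    apply χ.one_of_mem_closedBall
    rw [mem_closedBall_zero_iff]
    have := hGb x hx
    show ‖x‖ ≤ R + 1
    linarith
  let v : (Fin (L + 2) → ℝ) → (Fin (L + 2) → ℝ) := fun x => χ x • khZero k (V (khRho g k x))
  have hvc : ContDiff ℝ 1 v := by
    refine ContDiff.smul χ.contDiff ?_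
    rw [contDiff_pi]
    intro i
    unfold khZero
    by_cases hi : (i : ℕ) < k
    · simp only [hi, if_true]; exact contDiff_const
    · simp only [hi, if_false, V]
      exact (kh_eval_contDiff _).comp hρc
  have hvs : HasCompactSupport v := χ.hasCompactSupport.smul_right
  obtain ⟨K, hK⟩ := ContDiff.lipschitzWith_of_hasCompactSupport hvs hvc (by simp)
  obtain ⟨B0, hB0⟩ := hvc.continuous.bounded_above_of_compact_support hvs
  have hB : ∀ x, ‖v x‖ ≤ (Real.toNNReal B0 : NNReal) := fun x =>
    (hB0 x).trans (Real.le_coe_toNNReal _)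
  have hτv : ∀ x, khTau P k (khRho g k x) (v x) = χ x • V (khRho g k x) := by
    intro x
    simp only [v]
    rw [map_smul, hτV]
  have hvt : ∀ x, v x (khT L) = χ x * V (khRho g k x) (khT L) := by
    intro x
    simp only [v, Pi.smul_apply, smul_eq_mul, khZero]
    rw [if_neg htk]
  have hvk : ∀ x, v x kI = χ x * V (khRho g k x) kI := by
    intro x
    simp only [v, Pi.smul_apply, smul_eq_mul, khZero]
    rw [if_neg hkk]
  let h : (Fin (L + 2) → ℝ) → ℝ := fun x => x kI - g k (x (khT L))
  have hgk : ContDiff ℝ 1 (g k) := hc.contDiff hk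
  have hh : Continuous h :=
    (continuous_apply _).sub (hgk.continuous.comp (continuous_apply _))
  let J : (Fin (L + 2) → ℝ) → ℝ := fun x => MvPolynomial.eval (khRho g k x) Jp
  have hJ : Continuous J := (MvPolynomial.continuous_eval _).comp hρc.continuous
  have inv : ∀ γ : ℝ → (Fin (L + 2) → ℝ), (∀ t, HasDerivAt γ (v (γ t)) t) → γ 0 ∈ G →
      ∀ t, γ t ∈ G := by
    intro γ hγ h0 t
    constructor
    · intro j hj
      have hd : ∀ s, HasDerivAt (fun s => γ s j) 0 s := by
        intro s
        have := (hasDerivAt_pi.1 (hγ s)) j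
        simpa [v, khZero, hj] using this
      have := is_const_of_deriv_eq_zero (fun s => (hd s).differentiableAt) (fun s => (hd s).deriv) t 0
      rw [this]; exact h0.1 j hj
    · intro i hi
      have hd : ∀ s, HasDerivAt (fun s => MvPolynomial.eval (khRho g k (γ s)) (F i)) 0 s := by
        intro s
        have h1 := (khF_strict hc hk.le (F i) (γ s)).hasFDerivAt.comp_hasDerivAt s (hγ s)
        refine h1.congr_deriv ?_
        rw [ContinuousLinearMap.comp_apply, hτv, map_smul, hVgt _ i hi, smul_zero]
      have := is_const_of_deriv_eq_zero (fun s => (hd s).differentiableAt) (fun s => (hd s).deriv) t 0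
      rw [this]; exact h0.2 i hi
  have hder : ∀ γ : ℝ → (Fin (L + 2) → ℝ), (∀ t, HasDerivAt γ (v (γ t)) t) → ∀ t, γ t ∈ G →
      h (γ t) = 0 → HasDerivAt (fun s => h (γ s)) (J (γ t)) t := by
    intro γ hγ t ht h0
    have h1 := (hasDerivAt_pi.1 (hγ t)) kI
    have h2 := (hasDerivAt_pi.1 (hγ t)) (khT L)
    have h3 : HasDerivAt (g k) (MvPolynomial.eval (khRho g k (γ t)) (P k)) (γ t (khT L)) := by
      have := hc k hk (khRho g k (γ t)) (by
        intro i hi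
        rw [khRho_t hk.le]
        rcases Nat.lt_or_ge (i : ℕ) k with h5 | h5
        · rw [khRho_lt _ h5]
        · have h6 : i = kI := Fin.ext (by simp [hkI]; omega)
          rw [khRho_ge _ (by omega), h6]
          have : γ t kI - g k (γ t (khT L)) = 0 := h0
          linarith)
      rwa [khRho_t hk.le] at this
    have h4 := h1.sub (HasDerivAt.comp t h3 h2)
    refine h4.congr_deriv ?_
    rw [hvk, hvt, hχ _ ht, one_mul, one_mul]
    exact hVk _
  have loc : ∀ p ∈ G, 0 < J p → ∃ u : (Fin (L + 2) → ℝ) →L[ℝ] ℝ, ∃ U ∈ nhds p,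
      Set.InjOn u (G ∩ U) ∧ 0 < u (v p) := by
    intro p hp hJp0
    let u : (Fin (L + 2) → ℝ) →L[ℝ] ℝ :=
      (ContinuousLinearMap.proj kI : (Fin (L + 2) → ℝ) →L[ℝ] ℝ) -
        (MvPolynomial.eval (khRho g k p) (P k)) •
          (ContinuousLinearMap.proj (khT L) : (Fin (L + 2) → ℝ) →L[ℝ] ℝ)
    have hu : ∀ x, u x = x kI - MvPolynomial.eval (khRho g k p) (P k) * x (khT L) := by
      intro x; simp [u]
    let Φ : (Fin (L + 2) → ℝ) → Fin (L + 2) → ℝ := fun x i =>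
      if (i : ℕ) < k then x i else if (i : ℕ) = k then u x else
        MvPolynomial.eval (khRho g k x) (F i)
    let A : (Fin (L + 2) → ℝ) →L[ℝ] (Fin (L + 2) → ℝ) :=
      ContinuousLinearMap.pi fun i => if (i : ℕ) < k then
        (ContinuousLinearMap.proj i : (Fin (L + 2) → ℝ) →L[ℝ] ℝ) else if (i : ℕ) = k then u else
        (khGrad (F i) (khRho g k p)).comp (khTau P k (khRho g k p))
    have hΦ : HasStrictFDerivAt Φ A p := by
      simp only [A]
      rw [hasStrictFDerivAt_pi]
      intro i
      by_cases h1 : (i : ℕ) < k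
      · simp only [h1, if_true]
        exact (ContinuousLinearMap.proj i : (Fin (L + 2) → ℝ) →L[ℝ] ℝ).hasStrictFDerivAt
      · by_cases h2 : (i : ℕ) = k
        · simp only [h2, lt_irrefl, if_false, if_true]
          exact u.hasStrictFDerivAt
        · simp only [h1, h2, if_false]
          exact khF_strict hc hk.le _ p
    have hA : ∀ y, A y = 0 → y = 0 := by
      intro y hy
      have hyi := fun i => congrFun hy i
      simp only [A, ContinuousLinearMap.pi_apply, Pi.zero_apply] at hyi
      have hylt : ∀ i : Fin (L + 2), (i : ℕ) < k → y i = 0 := by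
        intro i hi
        have := hyi i
        rw [if_pos hi] at this
        simpa using this
      have hm : ((khMat P (k + 1) F).map (MvPolynomial.eval (khRho g k p))).mulVec
          (khTau P k (khRho g k p) y) = 0 := by
        ext i
        rw [khMat_mulVec, khTau_t hk.le, Pi.zero_apply]
        by_cases h1 : (i : ℕ) < k
        · rw [if_pos (by omega), khTau_apply, if_pos h1, sub_self]
        · by_cases h2 : (i : ℕ) = k
          · rw [if_pos (by omega), khTau_apply, if_neg h1]
            have := hyi i
            rw [if_neg h1, if_pos h2, hu] at this
            have h6 : i = kI := Fin.ext h2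
            rw [h6]
            exact this
          · rw [if_neg (by omega)]
            have := hyi i
            rw [if_neg h1, if_neg h2, ContinuousLinearMap.comp_apply] at this
            exact this
      have hdet : ((khMat P (k + 1) F).map (MvPolynomial.eval (khRho g k p))).det ≠ 0 := by
        rw [kh_det_eval]; exact hJp0.ne'
      have h0 := Matrix.eq_zero_of_mulVec_eq_zero hdet hm
      ext i
      by_cases h1 : (i : ℕ) < k
      · exact hylt i h1
      · have := congrFun h0 i
        rwa [khTau_apply, if_neg h1] at this
    obtain ⟨U, hU, hinj⟩ := kh_locinj hΦ hA
    refine ⟨u, U, hU, ?_, ?_⟩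
    · intro x hx y hy hxy
      apply hinj hx.2 hy.2
      ext i
      simp only [Φ]
      by_cases h1 : (i : ℕ) < k
      · rw [if_pos h1, if_pos h1, hx.1.1 i h1, hy.1.1 i h1]
      · by_cases h2 : (i : ℕ) = k
        · rw [if_neg h1, if_neg h1, if_pos h2, if_pos h2, hxy]
        · rw [if_neg h1, if_neg h1, if_neg h2, if_neg h2, hx.1.2 i (by omega), hy.1.2 i (by omega)]
    · rw [hu, hvk, hvt, hχ p hp, one_mul, one_mul, hVk]
      exact hJp0
  obtain ⟨Q, hQ, hQi⟩ := kh_flow_exit v K _ hK hB G hGc J h hJ hh inv hder loc ε hε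
  have hz : ∀ p, khRho g (k + 1) p = p →
        (∀ i : Fin (L + 2), k < (i : ℕ) → MvPolynomial.eval p (F i) = c i) →
        ε < MvPolynomial.eval p Jp → khRho g k (khZero k p) = p ∧ khZero k p ∈ G ∧
          h (khZero k p) = 0 ∧ ε < J (khZero k p) := by
    intro p h1 h2 h3
    have hpi : ∀ i : Fin (L + 2), (i : ℕ) < k + 1 → p i = g i (p (khT L)) := by
      intro i hi
      rw [← khRho_lt (g := g) (k := k + 1) p hi, h1]
    have h4 : khRho g k (khZero k p) = p := by
      rw [khRho_khZero hk.le]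
      ext i
      by_cases hi : (i : ℕ) < k
      · rw [khRho_lt _ hi, ← hpi i (by omega)]
      · rw [khRho_ge _ hi]
    refine ⟨h4, ⟨?_, ?_⟩, ?_, ?_⟩
    · intro j hj; simp [khZero, hj]
    · intro i hi; rw [h4]; exact h2 i hi
    · show khZero k p kI - g k (khZero k p (khT L)) = 0
      unfold khZero
      rw [if_neg hkk, if_neg htk, hpi kI (by simp [hkI])]
      simp [hkI]
    · show ε < MvPolynomial.eval (khRho g k (khZero k p)) Jp
      rw [h4]; exact h3
  have hρinj : ∀ x ∈ G, ∀ y ∈ G, khRho g k x = khRho g k y → x = y := by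
    intro x hx y hy hxy
    ext i
    by_cases hi : (i : ℕ) < k
    · rw [hx.1 i hi, hy.1 i hi]
    · rw [← khRho_ge (g := g) (k := k) x hi, hxy, khRho_ge _ hi]
  have hρρ : ∀ x, khRho (L := L) g k (khRho g k x) = khRho g k x := by
    intro x
    ext i
    by_cases hi : (i : ℕ) < k
    · rw [khRho_lt _ hi, khRho_t hk.le, khRho_lt _ hi]
    · rw [khRho_ge _ hi]
  refine ⟨fun p => khRho g k (Q (khZero k p)), ?_, ?_⟩
  · intro p h1 h2 h3
    obtain ⟨_, h5, h6, h7⟩ := hz p h1 h2 h3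
    obtain ⟨h8, h9⟩ := hQ _ h5 h6 h7
    exact ⟨hρρ _, fun i hi => h8.2 i hi, h9⟩
  · intro p hp q hq hpq
    obtain ⟨h4, h5, h6, h7⟩ := hz p hp.1 hp.2.1 hp.2.2
    obtain ⟨h4', h5', h6', h7'⟩ := hz q hq.1 hq.2.1 hq.2.2
    have h8 := (hQ _ h5 h6 h7).1
    have h8' := (hQ _ h5' h6' h7').1
    have h9 := hQi ⟨h5, h6, h7⟩ ⟨h5', h6', h7'⟩ (hρinj _ h8 _ h8' hpq)
    rw [← h4, ← h4', h9]

theorem kh_step (hc : khChain L g P) {k : ℕ} (hk : k < L)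
    (F : Fin (L + 2) → MvPolynomial (Fin (L + 2)) ℝ) (r : ℝ)
    (hF : ∀ p, MvPolynomial.eval p (F (khS L)) = ∑ l, p l ^ 2 - r) (B : ℕ)
    (hB : ∀ (c : Fin (L + 2) → ℝ) (ε : ℝ) (S' : Finset (Fin (L + 2) → ℝ)),
      (∀ p ∈ S', khRho g k p = p ∧
        (∀ i : Fin (L + 2), k ≤ (i : ℕ) → MvPolynomial.eval p (khNext P k F c ε i) = 0) ∧
        MvPolynomial.eval p (khMat P k (khNext P k F c ε)).det ≠ 0) → S'.card ≤ B)
    (S : Finset (Fin (L + 2) → ℝ))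
    (hS : ∀ p ∈ S, khRho g (k + 1) p = p ∧
      (∀ i : Fin (L + 2), k + 1 ≤ (i : ℕ) → MvPolynomial.eval p (F i) = 0) ∧
      0 < MvPolynomial.eval p (khMat P (k + 1) F).det) : S.card ≤ B := by
  classical
  rcases S.eq_empty_or_nonempty with rfl | hSne
  · simp
  set kI : Fin (L + 2) := ⟨k, by omega⟩ with hkI
  set Jp := (khMat P (k + 1) F).det with hJp
  obtain ⟨p0, hp0, hmin⟩ := Finset.exists_min_image S (fun p => MvPolynomial.eval p Jp) hSne
  set ε0 := MvPolynomial.eval p0 Jp / 2 with hε0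
  have hεzp : 0 < ε0 := half_pos (hS p0 hp0).2.2
  obtain ⟨U, hU, hUd⟩ := S.finite_toSet.t2_separation
  let Φ : (Fin (L + 2) → ℝ) → Fin (L + 2) → ℝ := fun x i =>
    if (i : ℕ) < k + 1 then x i - g i (x (khT L)) else MvPolynomial.eval x (F i)
  have hev : ∀ᶠ w in nhds (0 : Fin (L + 2) → ℝ), ∀ p ∈ S, ∃ x ∈ U p ∩ {x | ε0 < MvPolynomial.eval x Jp},
      Φ x = w := by
    rw [Filter.eventually_all_finset]
    intro p hp
    obtain ⟨h1, h2, h3⟩ := hS p hp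
    have hpi : ∀ i : Fin (L + 2), (i : ℕ) < k + 1 → p i = g i (p (khT L)) := by
      intro i hi
      rw [← khRho_lt (g := g) (k := k + 1) p hi, h1]
    let A : (Fin (L + 2) → ℝ) →L[ℝ] (Fin (L + 2) → ℝ) :=
      ContinuousLinearMap.pi fun i => if (i : ℕ) < k + 1 then
        (ContinuousLinearMap.proj i : (Fin (L + 2) → ℝ) →L[ℝ] ℝ) -
          MvPolynomial.eval p (P i) •
            (ContinuousLinearMap.proj (khT L) : (Fin (L + 2) → ℝ) →L[ℝ] ℝ)
        else khGrad (F i) p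
    have hΦ : HasStrictFDerivAt Φ A p := by
      simp only [A]
      rw [hasStrictFDerivAt_pi]
      intro i
      by_cases hi : (i : ℕ) < k + 1
      · simp only [hi, if_true]
        have h5 := hc.strict (k := k + 1) hk p hi
        rw [h1] at h5
        exact (ContinuousLinearMap.proj i : (Fin (L + 2) → ℝ) →L[ℝ] ℝ).hasStrictFDerivAt.sub h5
      · simp only [hi, if_false]
        exact kh_eval_strict (F i) p
    have hA : ∀ y, A y = 0 → y = 0 := by
      intro y hy
      have hdet : ((khMat P (k + 1) F).map (MvPolynomial.eval p)).det ≠ 0 := by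
        rw [kh_det_eval]; exact h3.ne'
      apply Matrix.eq_zero_of_mulVec_eq_zero hdet
      ext i
      rw [khMat_mulVec]
      have := congrFun hy i
      simp only [A, ContinuousLinearMap.pi_apply] at this
      split_ifs at this ⊢ with hi
      · simpa using this
      · exact this
    have h0 : Φ p = 0 := by
      ext i
      simp only [Φ, Pi.zero_apply]
      split_ifs with hi
      · rw [← hpi i hi, sub_self]
      · exact h2 i (by omega)
    have hnb : U p ∩ {x | ε0 < MvPolynomial.eval x Jp} ∈ nhds p := by
      refine Filter.inter_mem ((hU p).2.mem_nhds (hU p).1) ?_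
      refine (isOpen_lt continuous_const (MvPolynomial.continuous_eval Jp)).mem_nhds ?_
      have := hmin p hp
      show ε0 < MvPolynomial.eval p Jp
      linarith [(hS p0 hp0).2.2]
    have := kh_persist2 hΦ hA hnb
    rwa [h0] at this
  obtain ⟨ρ, hρ, hball⟩ := Metric.eventually_nhds_iff.1 hev
  obtain ⟨w, hwn, hwk, hreg⟩ := kh_sard hc hk F (min ρ ε0) (lt_min hρ hεzp)
  set ε := w kI with hε
  have hεlt : ε < ε0 := by
    have h1 := norm_le_pi_norm w kI
    have h2 := le_abs_self (w kI)
    rw [Real.norm_eq_abs] at h1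
    linarith [min_le_right ρ ε0]
  let w' : Fin (L + 2) → ℝ := fun i => if (i : ℕ) < k + 1 then 0 else w i
  have hw' : ‖w'‖ < ρ := by
    have : ‖w'‖ ≤ ‖w‖ := by
      rw [pi_norm_le_iff_of_nonneg (norm_nonneg _)]
      intro i
      simp only [w']
      split_ifs
      · simp
      · exact norm_le_pi_norm w i
    linarith [min_le_left ρ ε0]
  have hx := hball (y := w') (by rwa [dist_zero_right])
  choose! x hxU hxw using hx
  have hxprop : ∀ p ∈ S, khRho g (k + 1) (x p) = x p ∧
      (∀ i : Fin (L + 2), k < (i : ℕ) → MvPolynomial.eval (x p) (F i) = w i) ∧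
      ε < MvPolynomial.eval (x p) Jp := by
    intro p hp
    have h1 := fun i => congrFun (hxw p hp) i
    simp only [Φ, w'] at h1
    refine ⟨?_, ?_, ?_⟩
    · ext i
      by_cases hi : (i : ℕ) < k + 1
      · rw [khRho_lt _ hi]
        have := h1 i
        rw [if_pos hi, if_pos hi] at this
        linarith
      · rw [khRho_ge _ hi]
    · intro i hi
      have := h1 i
      rwa [if_neg (by omega), if_neg (by omega)] at this
    · exact hεlt.trans (hxU p hp).2
  have hxinj : Set.InjOn x S := by
    intro p hp q hq hpq
    by_contra hne
    have := hUd hp hq hne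
    rw [Function.onFun, Set.disjoint_left] at this
    apply this (hxU p hp).1
    rw [hpq]
    exact (hxU q hq).1
  obtain ⟨Q, hQ, hQi⟩ := kh_flow_step hc hk F r hF w ε hwk
  have hinj2 : Set.InjOn (fun p => Q (x p)) S := by
    intro p hp q hq hpq
    exact hxinj hp hq (hQi (hxprop p hp) (hxprop q hq) hpq)
  rw [← Finset.card_image_of_injOn hinj2]
  apply hB w ε
  intro p hp
  rw [Finset.mem_image] at hp
  obtain ⟨q, hq, rfl⟩ := hp
  obtain ⟨h1, h2, h3⟩ := hQ (x q) (hxprop q hq).1 (hxprop q hq).2.1 (hxprop q hq).2.2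
  refine ⟨h1, ?_, ?_⟩
  · intro i hi
    unfold khNext
    split_ifs with h
    · rw [map_sub, h3, MvPolynomial.eval_C, sub_self]
    · rw [map_sub, h2 i (by omega), MvPolynomial.eval_C, sub_self]
  · exact hreg _ h1 h2 h3
end

end

section

open MeasureTheory

theorem kh_pderiv_deg {σ : Type*} (i : σ) (F : MvPolynomial σ ℝ) :
    (MvPolynomial.pderiv i F).totalDegree ≤ F.totalDegree := by
  classical
  conv_lhs => rw [MvPolynomial.as_sum F]
  rw [map_sum]
  refine MvPolynomial.totalDegree_finsetSum_le fun m hm => ?_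
  rw [MvPolynomial.pderiv_monomial]
  refine (MvPolynomial.totalDegree_monomial_le _ _).trans ?_
  refine le_trans ?_ (MvPolynomial.le_totalDegree hm)
  have h1 : m - Finsupp.single i 1 ≤ m := tsub_le_self
  have := Finsupp.degree_mono h1
  exact this

theorem kh_det_deg {σ n : Type*} [Fintype n] [DecidableEq n] (A : Matrix n n (MvPolynomial σ ℝ))
    (d : n → ℕ) (h : ∀ i j, (A i j).totalDegree ≤ d i) : A.det.totalDegree ≤ ∑ i, d i := by
  rw [← Matrix.det_transpose, Matrix.det_apply']
  refine MvPolynomial.totalDegree_finsetSum_le fun s _ => ?_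
  refine (MvPolynomial.totalDegree_mul _ _).trans ?_
  have h1 : (((Equiv.Perm.sign s : ℤ) : MvPolynomial σ ℝ)).totalDegree = 0 := by
    have : (((Equiv.Perm.sign s : ℤ) : MvPolynomial σ ℝ)) = MvPolynomial.C ((Equiv.Perm.sign s : ℤ) : ℝ) := by
      simp
    rw [this, MvPolynomial.totalDegree_C]
  rw [h1, zero_add]
  refine (MvPolynomial.totalDegree_finsetProd _ _).trans ?_
  exact Finset.sum_le_sum fun i _ => h i _

section
variable {L : ℕ} {g : ℕ → ℝ → ℝ} {P : ℕ → MvPolynomial (Fin (L + 2)) ℝ}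

/-- total budget -/
noncomputable def khBud (k : ℕ) (F : Fin (L + 2) → MvPolynomial (Fin (L + 2)) ℝ) : ℕ :=
  ∑ i : Fin (L + 2), if k ≤ (i : ℕ) then (F i).totalDegree + 1 else 0

theorem khBud_next {k M : ℕ} (hk : k < L) (hP : ∀ j < L, (P j).totalDegree ≤ M)
    (F : Fin (L + 2) → MvPolynomial (Fin (L + 2)) ℝ) (c : Fin (L + 2) → ℝ) (ε : ℝ) :
    khBud k (khNext P k F c ε) + L * M ≤ 2 * (khBud (k + 1) F + L * M) := by
  set kI : Fin (L + 2) := ⟨k, by omega⟩ with hkI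
  have hdet : (khMat P (k + 1) F).det.totalDegree + 1 ≤ L * M + khBud (k + 1) F := by
    have h1 := kh_det_deg (khMat P (k + 1) F)
      (fun i => if (i : ℕ) < k + 1 then M else (F i).totalDegree) (by
        intro i j
        unfold khMat
        split_ifs with h0 h1 h2 h2
        · refine (MvPolynomial.totalDegree_sub _ _).trans ?_
          simpa using hP i (by omega)
        · simp
        · refine (MvPolynomial.totalDegree_sub _ _).trans ?_
          simpa using hP i (by omega)
        · simp
        · exact kh_pderiv_deg _ _)
    have h2 : ∑ i : Fin (L + 2), (if (i : ℕ) < k + 1 then M else (F i).totalDegree) ≤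
        (∑ i : Fin (L + 2), (if (i : ℕ) < k + 1 then M else 0)) +
        ∑ i : Fin (L + 2), (if k + 1 ≤ (i : ℕ) then (F i).totalDegree else 0) := by
      rw [← Finset.sum_add_distrib]
      refine Finset.sum_le_sum fun i _ => ?_
      split_ifs <;> omega
    have h3 : ∑ i : Fin (L + 2), (if (i : ℕ) < k + 1 then M else 0) ≤ L * M := by
      rw [← Finset.sum_filter, Finset.sum_const, smul_eq_mul]
      refine Nat.mul_le_mul_right _ ?_
      calc (Finset.univ.filter (fun i : Fin (L + 2) => (i : ℕ) < k + 1)).card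
          ≤ (Finset.range (k + 1)).card := Finset.card_le_card_of_injOn (fun i => (i : ℕ))
            (by intro i hi; simpa using hi) (fun i _ j _ h => Fin.ext h)
        _ ≤ L := by simp; omega
    have h4 : (∑ i : Fin (L + 2), (if k + 1 ≤ (i : ℕ) then (F i).totalDegree else 0)) + 1 ≤
        khBud (k + 1) F := by
      unfold khBud
      have : ∀ i : Fin (L + 2), (if k + 1 ≤ (i : ℕ) then (F i).totalDegree + 1 else 0) =
        (if k + 1 ≤ (i : ℕ) then (F i).totalDegree else 0) + (if k + 1 ≤ (i : ℕ) then 1 else 0) := by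
        intro i; split_ifs <;> rfl
      simp only [this]
      rw [Finset.sum_add_distrib]
      refine Nat.add_le_add_left ?_ _
      refine le_trans ?_ (Finset.single_le_sum (fun _ _ => Nat.zero_le _) (Finset.mem_univ (khS L)))
      rw [if_pos]
      simp [khS]; omega
    omega
  have hsum : khBud k (khNext P k F c ε) ≤ (khMat P (k + 1) F).det.totalDegree + 1 + khBud (k + 1) F := by
    unfold khBud
    have : ∀ i : Fin (L + 2), (if k ≤ (i : ℕ) then (khNext P k F c ε i).totalDegree + 1 else 0) ≤
        (if i = kI then (khMat P (k + 1) F).det.totalDegree + 1 else 0) +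
        (if k + 1 ≤ (i : ℕ) then (F i).totalDegree + 1 else 0) := by
      intro i
      have hi : i = kI ↔ (i : ℕ) = k := by rw [Fin.ext_iff]
      unfold khNext
      by_cases h1 : (i : ℕ) = k
      · rw [if_pos h1.ge, if_pos h1, if_pos (hi.2 h1)]
        have := MvPolynomial.totalDegree_sub_C_le (khMat P (k + 1) F).det ε
        omega
      · rw [if_neg h1, if_neg (fun h => h1 (hi.1 h))]
        have := MvPolynomial.totalDegree_sub_C_le (F i) (c i)
        split_ifs <;> omega
    refine (Finset.sum_le_sum fun i _ => this i).trans ?_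
    rw [Finset.sum_add_distrib]
    simp
  omega

theorem kh_neg_det {k : ℕ} (hk : k < L) (F : Fin (L + 2) → MvPolynomial (Fin (L + 2)) ℝ) :
    (khMat P (k + 1) (Function.update F (khT L) (-F (khT L)))).det = - (khMat P (k + 1) F).det := by
  have : khMat P (k + 1) (Function.update F (khT L) (-F (khT L))) =
      (khMat P (k + 1) F).updateRow (khT L) ((-1 : MvPolynomial (Fin (L + 2)) ℝ) •
        (khMat P (k + 1) F) (khT L)) := by
    ext1 i l
    by_cases hi : i = khT L
    · subst hi
      have h2 : ¬ ((khT L : Fin (L + 2)) : ℕ) < k + 1 := by simp [khT]; omega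
      simp [khMat, h2]
    · simp [khMat, Matrix.updateRow_ne hi, Function.update_of_ne hi]
  rw [this, Matrix.det_updateRow_smul, Matrix.updateRow_eq_self]
  simp

theorem kh_main (hc : khChain L g P) {M : ℕ} (hP : ∀ j < L, (P j).totalDegree ≤ M) :
    ∀ k ≤ L, ∀ (F : Fin (L + 2) → MvPolynomial (Fin (L + 2)) ℝ) (r : ℝ),
    (∀ p, MvPolynomial.eval p (F (khS L)) = ∑ l, p l ^ 2 - r) →
    ∀ a : ℕ, khBud k F + L * M ≤ a →
    ∀ S : Finset (Fin (L + 2) → ℝ),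
    (∀ p ∈ S, khRho g k p = p ∧
      (∀ i : Fin (L + 2), k ≤ (i : ℕ) → MvPolynomial.eval p (F i) = 0) ∧
      MvPolynomial.eval p (khMat P k F).det ≠ 0) →
    S.card ≤ 2 ^ k * ((L + 4) ^ (L + 2) * (2 ^ k * a) ^ (L + 2)) := by
  intro k
  induction k with
  | zero =>
    intro _ F r hF a ha S hS
    have h1 := kh_bezout F (fun i => (F i).totalDegree + 1) (fun i => Nat.le_succ _)
      (fun i => Nat.succ_le_succ (Nat.zero_le _)) S (by
        intro p hp
        obtain ⟨_, h2, h3⟩ := hS p hp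
        refine ⟨fun i => h2 i (Nat.zero_le _), ?_⟩
        rw [← kh_det_eval] at h3
        convert h3 using 2
        ext i l
        simp [khMat])
    simp only [Fintype.card_fin] at h1
    have h2 : ∏ i : Fin (L + 2), ((F i).totalDegree + 1) ≤ a ^ (L + 2) := by
      have h3 : ∀ i : Fin (L + 2), (F i).totalDegree + 1 ≤ a := by
        intro i
        have : (F i).totalDegree + 1 ≤ khBud 0 F := by
          unfold khBud
          simp only [Nat.zero_le, if_true]
          exact Finset.single_le_sum (f := fun i => (F i).totalDegree + 1)
            (fun _ _ => Nat.zero_le _) (Finset.mem_univ i)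
        omega
      refine (Finset.prod_le_prod' fun i _ => h3 i).trans ?_
      simp
    rw [pow_zero, one_mul, one_mul]
    exact h1.trans (Nat.mul_le_mul_left _ h2)
  | succ k ih =>
    intro hk F r hF a ha S hS
    classical
    have hpos : ∀ (F : Fin (L + 2) → MvPolynomial (Fin (L + 2)) ℝ),
        (∀ p, MvPolynomial.eval p (F (khS L)) = ∑ l, p l ^ 2 - r) →
        khBud (k + 1) F + L * M ≤ a → ∀ S : Finset (Fin (L + 2) → ℝ),
        (∀ p ∈ S, khRho g (k + 1) p = p ∧
          (∀ i : Fin (L + 2), k + 1 ≤ (i : ℕ) → MvPolynomial.eval p (F i) = 0) ∧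
          0 < MvPolynomial.eval p (khMat P (k + 1) F).det) →
        S.card ≤ 2 ^ k * ((L + 4) ^ (L + 2) * (2 ^ k * (2 * a)) ^ (L + 2)) := by
      intro F hF ha S hS
      refine kh_step hc (k := k) (by omega) F r hF _ ?_ S hS
      intro c ε S' hS'
      refine ih (by omega) (khNext P k F c ε) (r + c (khS L)) ?_ (2 * a) ?_ S' hS'
      · intro p
        unfold khNext
        rw [if_neg (by simp [khS]; omega), map_sub, hF, MvPolynomial.eval_C]
        ring
      · have := khBud_next (k := k) (by omega) hP F c ε
        omega
    have h1 := hpos F hF ha (S.filter fun p => 0 < MvPolynomial.eval p (khMat P (k + 1) F).det) (by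
      intro p hp
      rw [Finset.mem_filter] at hp
      exact ⟨(hS p hp.1).1, (hS p hp.1).2.1, hp.2⟩)
    have hts : khS L ≠ khT L := by simp [khS, khT]
    have h2 := hpos (Function.update F (khT L) (-F (khT L)))
      (by rw [Function.update_of_ne hts]; exact hF)
      (by
        have : khBud (k + 1) (Function.update F (khT L) (-F (khT L))) = khBud (k + 1) F := by
          unfold khBud
          refine Finset.sum_congr rfl fun i _ => ?_
          by_cases hi : i = khT L
          · subst hi; simp
          · rw [Function.update_of_ne hi]
        rw [this]; exact ha)
      (S.filter fun p => ¬ 0 < MvPolynomial.eval p (khMat P (k + 1) F).det) (by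
      intro p hp
      rw [Finset.mem_filter] at hp
      refine ⟨(hS p hp.1).1, ?_, ?_⟩
      · intro i hi
        by_cases hit : i = khT L
        · subst hit; simp [(hS p hp.1).2.1 _ hi]
        · rw [Function.update_of_ne hit]; exact (hS p hp.1).2.1 i hi
      · rw [kh_neg_det (by omega), map_neg]
        have h3 := (hS p hp.1).2.2
        have h4 := lt_of_le_of_ne (not_lt.1 hp.2) h3
        linarith)
    rw [← Finset.card_filter_add_card_filter_not (s := S)
      (fun p => 0 < MvPolynomial.eval p (khMat P (k + 1) F).det)]
    have e1 : 2 ^ k * (2 * a) = 2 ^ (k + 1) * a := by rw [pow_succ]; ring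
    rw [e1] at h1 h2
    rw [pow_succ 2 k]
    have e2 : 2 ^ k * 2 * a = 2 ^ (k + 1) * a := by rw [pow_succ]
    rw [e2]
    nlinarith
end

end

section

open MeasureTheory

theorem kh_eval_congr {σ : Type*} (Q : MvPolynomial σ ℝ) (p q : σ → ℝ)
    (h : ∀ i ∈ Q.vars, p i = q i) : MvPolynomial.eval p Q = MvPolynomial.eval q Q := by
  refine MvPolynomial.eval₂Hom_congr' rfl ?_ rfl
  intro i hi _
  exact h i hi

/-- the root-count bound -/
def khBound (L M D : ℕ) : ℕ := 2 ^ L * ((L + 4) ^ (L + 2) * (2 ^ L * (D + 4 + L * M)) ^ (L + 2))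

section
variable {L : ℕ} {g : ℕ → ℝ → ℝ} {P : ℕ → MvPolynomial (Fin (L + 2)) ℝ}

theorem kh_zeros (hc : khChain L g P) {M : ℕ} (hP : ∀ j < L, (P j).totalDegree ≤ M)
    (Q : MvPolynomial (Fin (L + 2)) ℝ) (D : ℕ) (hQ : Q.totalDegree ≤ D) (hQS : khS L ∉ Q.vars)
    (Z : Finset ℝ)
    (hZ : ∀ t ∈ Z, MvPolynomial.eval (khRho (L := L) g L (fun _ => t)) Q = 0 ∧
      ∃ a, a ≠ 0 ∧ HasDerivAt (fun t => MvPolynomial.eval (khRho (L := L) g L (fun _ => t)) Q) a t) :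
    Z.card ≤ khBound L M D := by
  classical
  let e : ℝ → Fin (L + 2) → ℝ := fun t => khRho g L (Function.update (fun _ => t) (khS L) 0)
  have hst : khS L ≠ khT L := by simp [khS, khT]
  obtain ⟨r, hr⟩ : ∃ r : ℝ, ∀ t ∈ Z, ∑ l, e t l ^ 2 < r := by
    refine ⟨∑ t ∈ Z, (∑ l, e t l ^ 2) + 1, fun t ht => ?_⟩
    have := Finset.single_le_sum (f := fun t => ∑ l, e t l ^ 2)
      (fun t _ => Finset.sum_nonneg fun l _ => sq_nonneg (e t l)) ht
    linarith
  let s : ℝ → ℝ := fun t => Real.sqrt (r - ∑ l, e t l ^ 2)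
  let F : Fin (L + 2) → MvPolynomial (Fin (L + 2)) ℝ := fun i => if i = khS L then
    ∑ l, MvPolynomial.X l ^ 2 - MvPolynomial.C r else Q
  have hFS : F (khS L) = ∑ l, MvPolynomial.X l ^ 2 - MvPolynomial.C r := by simp [F]
  have hFT : F (khT L) = Q := by simp [F, hst.symm]
  have hF : ∀ p, MvPolynomial.eval p (F (khS L)) = ∑ l, p l ^ 2 - r := by
    intro p; rw [hFS]; simp
  let y : ℝ → ℝ → Fin (L + 2) → ℝ := fun s t => Function.update (fun _ => t) (khS L) s
  have hyt : ∀ s t, y s t (khT L) = t := by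
    intro s t; simp only [y]; rw [Function.update_of_ne hst.symm]
  let pt : ℝ → Fin (L + 2) → ℝ := fun t => khRho g L (y (s t) t)
  have hnS : ¬ ((khS L : Fin (L + 2)) : ℕ) < L := by simp [khS]
  have hptS : ∀ t, pt t (khS L) = s t := by
    intro t
    simp only [pt]
    rw [khRho_ge _ hnS]; simp [y]
  have hpt0 : ∀ s t l, l ≠ khS L → khRho g L (y s t) l = khRho (L := L) g L (fun _ => t) l := by
    intro s t l hl
    unfold khRho
    rw [hyt]
    split_ifs
    · rfl
    · simp only [y]; rw [Function.update_of_ne hl]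
  have hevQ : ∀ s t, MvPolynomial.eval (khRho g L (y s t)) Q =
      MvPolynomial.eval (khRho (L := L) g L (fun _ => t)) Q := by
    intro s t
    apply kh_eval_congr
    intro i hi
    apply hpt0
    rintro rfl; exact hQS hi
  have hptT : ∀ t, pt t (khT L) = t := by
    intro t; simp only [pt]; rw [khRho_t le_rfl, hyt]
  have hinj : Set.InjOn pt Z := by
    intro t _ t' _ h
    rw [← hptT t, h, hptT]
  rw [← Finset.card_image_of_injOn hinj]
  refine kh_main hc hP L le_rfl F r hF (D + 4 + L * M) ?_ _ ?_
  · have : khBud L F ≤ D + 4 := by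
      unfold khBud
      have h1 : ∀ i : Fin (L + 2), (if L ≤ (i : ℕ) then (F i).totalDegree + 1 else 0) ≤
          (if i = khT L then D + 1 else 0) + (if i = khS L then 3 else 0) := by
        intro i
        by_cases hi : i = khS L
        · subst hi
          rw [if_neg hst, if_pos rfl, hFS]
          have h5 : (∑ l : Fin (L + 2), (MvPolynomial.X l : MvPolynomial (Fin (L + 2)) ℝ) ^ 2).totalDegree ≤ 2 :=
            MvPolynomial.totalDegree_finsetSum_le fun l _ => by
              rw [MvPolynomial.totalDegree_X_pow]
          have h6 := MvPolynomial.totalDegree_sub_C_le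
            (∑ l : Fin (L + 2), (MvPolynomial.X l : MvPolynomial (Fin (L + 2)) ℝ) ^ 2) r
          split_ifs <;> omega
        · by_cases ht : i = khT L
          · subst ht
            rw [hFT]
            simp only [if_true]
            split_ifs <;> omega
          · rw [if_neg]
            · omega
            · intro h
              rcases i with ⟨i, h7⟩
              simp only [khS, khT, Fin.mk.injEq] at hi ht h
              omega
      refine (Finset.sum_le_sum fun i _ => h1 i).trans ?_
      rw [Finset.sum_add_distrib]
      simp
    omega
  · intro p hp
    rw [Finset.mem_image] at hp
    obtain ⟨t, ht, rfl⟩ := hp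
    obtain ⟨hz, a, ha, hda⟩ := hZ t ht
    have hρρ : khRho g L (pt t) = pt t := by
      ext i
      by_cases hi : (i : ℕ) < L
      · rw [khRho_lt _ hi, hptT]
        simp only [pt]
        rw [khRho_lt _ hi, hyt]
      · rw [khRho_ge _ hi]
    have hs2 : (s t) ^ 2 = r - ∑ l, e t l ^ 2 := Real.sq_sqrt (by linarith [hr t ht])
    have hspos : 0 < s t := Real.sqrt_pos.2 (by linarith [hr t ht])
    refine ⟨hρρ, ?_, ?_⟩
    · intro i hi
      by_cases hiS : i = khS L
      · subst hiS
        rw [hF, ← Finset.add_sum_erase _ _ (Finset.mem_univ (khS L)), hptS, hs2,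
          ← Finset.add_sum_erase _ (fun l => e t l ^ 2) (Finset.mem_univ (khS L))]
        have h1 : e t (khS L) = 0 := by
          simp only [e]; rw [khRho_ge _ hnS]; simp
        have h2 : ∑ l ∈ Finset.univ.erase (khS L), pt t l ^ 2 =
            ∑ l ∈ Finset.univ.erase (khS L), e t l ^ 2 := by
          refine Finset.sum_congr rfl fun l hl => ?_
          have hl' := (Finset.mem_erase.1 hl).1
          show khRho g L (y (s t) t) l ^ 2 = khRho g L (y 0 t) l ^ 2
          rw [hpt0 _ _ _ hl', hpt0 _ _ _ hl']
        rw [h1, h2]; ring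
      · have : F i = Q := by simp [F, hiS]
        rw [this]
        show MvPolynomial.eval (khRho g L (y (s t) t)) Q = 0
        rw [hevQ, hz]
    · rw [← kh_det_eval]
      intro hdet
      obtain ⟨v, hv0, hv⟩ := Matrix.exists_mulVec_eq_zero_iff.2 hdet
      have hvi := fun i => congrFun hv i
      simp only [khMat_mulVec, Pi.zero_apply] at hvi
      -- derivative of φ
      let y' : Fin (L + 2) → ℝ := Function.update (fun _ => 1) (khS L) 0
      have hy't : y' (khT L) = 1 := by simp only [y']; rw [Function.update_of_ne hst.symm]
      have hyd : HasDerivAt (y (s t)) y' t := by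
        rw [hasDerivAt_pi]
        intro i
        by_cases hi : i = khS L
        · subst hi
          simp only [y, y', Function.update_self]
          exact hasDerivAt_const _ _
        · simp only [y, y', Function.update_of_ne hi]
          exact hasDerivAt_id _
      have h1 := (khF_strict hc le_rfl Q (y (s t) t)).hasFDerivAt.comp_hasDerivAt t hyd
      have h2 : (fun t' => MvPolynomial.eval (khRho g L (y (s t) t')) Q) =
          fun t' => MvPolynomial.eval (khRho (L := L) g L (fun _ => t')) Q := funext fun t' => hevQ _ _
      have h3 : a = khGrad Q (pt t) (khTau P L (pt t) y') := by
        have h1' : HasDerivAt (fun t' => MvPolynomial.eval (khRho g L (y (s t) t')) Q)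
          (khGrad Q (pt t) (khTau P L (pt t) y')) t := h1
        rw [h2] at h1'
        exact hda.unique h1'
      have hgS : khGrad Q (pt t) (Pi.single (khS L) 1) = 0 := by
        unfold khGrad
        simp only [sum_apply, smul_apply,
          ContinuousLinearMap.proj_apply, smul_eq_mul]
        refine Finset.sum_eq_zero fun l _ => ?_
        by_cases hl : l = khS L
        · subst hl
          rw [MvPolynomial.pderiv_eq_zero_of_notMem_vars hQS]; simp
        · simp [hl]
      have hvdec : v = v (khT L) • khTau P L (pt t) y' + v (khS L) • Pi.single (khS L) 1 := by
        ext l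
        simp only [Pi.add_apply, Pi.smul_apply, smul_eq_mul]
        rw [khTau_apply, hy't]
        by_cases hl : (l : ℕ) < L
        · have h4 := hvi l
          rw [if_pos hl] at h4
          have h5 : l ≠ khS L := by rintro rfl; exact hnS hl
          rw [if_pos hl, Pi.single_eq_of_ne h5]; linarith
        · rw [if_neg hl]
          by_cases hlS : l = khS L
          · subst hlS; simp [y']
          · have hlT : l = khT L := by
              rcases l with ⟨l, h7⟩
              simp only [khS, khT, Fin.mk.injEq] at hlS hl ⊢
              omega
            subst hlT
            rw [hy't, Pi.single_eq_of_ne hst.symm]; ring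
      have hvT : v (khT L) = 0 := by
        have h4 := hvi (khT L)
        rw [if_neg (by simp [khT]), hFT, hvdec, map_add, map_smul, map_smul, hgS, ← h3] at h4
        simp only [smul_eq_mul, mul_zero, add_zero] at h4
        rcases mul_eq_zero.1 h4 with h | h
        · exact h
        · exact absurd h ha
      have hvS : v (khS L) = 0 := by
        have h4 := hvi (khS L)
        rw [if_neg hnS, hvdec, hvT, zero_smul, zero_add, map_smul, smul_eq_mul, hFS] at h4
        rcases mul_eq_zero.1 h4 with h | h
        · exact h
        · exfalso
          unfold khGrad at h
          simp only [sum_apply, smul_apply,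
            ContinuousLinearMap.proj_apply, smul_eq_mul] at h
          rw [Finset.sum_eq_single (khS L)] at h
          · simp only [map_sub, map_sum, MvPolynomial.pderiv_C, Derivation.leibniz_pow,
              MvPolynomial.pderiv_X, Pi.single_eq_same, mul_one, sub_zero] at h
            rw [Finset.sum_eq_single (khS L)] at h
            · simp [hptS] at h
              linarith
            · intro b _ hb; simp [Pi.single_apply, hb]
            · simp
          · intro b _ hb; simp [hb]
          · simp
      apply hv0
      rw [hvdec, hvT, hvS]; simp

end

end

section

open MeasureTheory

section
variable {L : ℕ} {g : ℕ → ℝ → ℝ} {P : ℕ → MvPolynomial (Fin (L + 2)) ℝ}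

theorem kh_alt (hc : khChain L g P) {M : ℕ} (hP : ∀ j < L, (P j).totalDegree ≤ M)
    (Q : MvPolynomial (Fin (L + 2)) ℝ) (D : ℕ) (hQ : Q.totalDegree ≤ D) (hQS : khS L ∉ Q.vars)
    (φ : ℝ → ℝ) (hφ : ∀ t, φ t = MvPolynomial.eval (khRho (L := L) g L (fun _ => t)) Q)
    (u : ℕ → ℝ) (hu : Monotone u) (r : ℕ) :
    ((Finset.range r).filter (fun i => ¬ (φ (u i) < 0 ↔ φ (u (i + 1)) < 0))).card
      ≤ khBound L M D := by
  classical
  have hdiff : ∀ t, ∃ a, HasDerivAt φ a t := by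
    intro t
    have hyd : HasDerivAt (fun t : ℝ => (fun _ : Fin (L + 2) => t)) (fun _ => 1) t := by
      rw [hasDerivAt_pi]; intro i; exact hasDerivAt_id _
    have h1 := (khF_strict hc le_rfl Q (fun _ => t)).hasFDerivAt.comp_hasDerivAt t hyd
    rw [show φ = fun t => MvPolynomial.eval (khRho (L := L) g L (fun _ => t)) Q from funext hφ]
    exact ⟨_, h1⟩
  choose φ' hφ' using hdiff
  have hcont : Continuous φ := continuous_iff_continuousAt.2 fun t => (hφ' t).continuousAt
  -- margin
  obtain ⟨c0, hc0, hmar⟩ : ∃ c0 > 0, ∀ i ∈ Finset.range (r + 1), φ (u i) < 0 → c0 ≤ - φ (u i) := by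
    by_cases hne : ((Finset.range (r + 1)).filter (fun i => φ (u i) < 0)).Nonempty
    · obtain ⟨i, hi, hmin⟩ := Finset.exists_min_image _ (fun i => - φ (u i)) hne
      refine ⟨-φ (u i), by linarith [(Finset.mem_filter.1 hi).2], fun j hj hj' => ?_⟩
      exact hmin j (Finset.mem_filter.2 ⟨hj, hj'⟩)
    · refine ⟨1, one_pos, fun j hj hj' => ?_⟩
      exact absurd ⟨j, Finset.mem_filter.2 ⟨hj, hj'⟩⟩ hne
  -- Sard
  have hsard : volume (φ '' {t | φ' t = 0}) = 0 := by
    refine addHaar_image_eq_zero_of_det_fderivWithin_eq_zero volume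
      (f' := fun t => ContinuousLinearMap.toSpanSingleton ℝ (φ' t))
      (fun t _ => (hφ' t).hasFDerivAt.hasFDerivWithinAt) (fun t ht => ?_)
    have : φ' t = 0 := ht
    simp only [this]
    rw [ContinuousLinearMap.det]
    simp
  obtain ⟨c, hcpos, hclt, hcreg⟩ : ∃ c > 0, c < c0 ∧ -c ∉ φ '' {t | φ' t = 0} := by
    by_contra hcon
    push Not at hcon
    have h1 : Set.Ioo (-c0) 0 ⊆ φ '' {t | φ' t = 0} := by
      intro x hx
      have := hcon (-x) (by linarith [hx.2]) (by linarith [hx.1])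
      rwa [neg_neg] at this
    have h2 := measure_mono (μ := volume) h1
    rw [hsard, Real.volume_Ioo] at h2
    simp at h2
    linarith
  set A := (Finset.range r).filter (fun i => ¬ (φ (u i) < 0 ↔ φ (u (i + 1)) < 0)) with hA
  have hroot : ∀ i ∈ A, ∃ z, u i < z ∧ z < u (i + 1) ∧ φ z + c = 0 := by
    intro i hi
    rw [hA, Finset.mem_filter, Finset.mem_range] at hi
    have hle : u i ≤ u (i + 1) := hu (Nat.le_succ i)
    have hψ : ContinuousOn (fun t => φ t + c) (Set.Icc (u i) (u (i + 1))) :=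
      (hcont.add continuous_const).continuousOn
    have hm1 := hmar i (Finset.mem_range.2 (by omega))
    have hm2 := hmar (i + 1) (Finset.mem_range.2 (by omega))
    by_cases h1 : φ (u i) < 0
    · have h2 : ¬ φ (u (i + 1)) < 0 := by tauto
      have h3 := hm1 h1
      obtain ⟨z, hz, hz0⟩ := intermediate_value_Ioo hle hψ
        (show (0 : ℝ) ∈ Set.Ioo (φ (u i) + c) (φ (u (i + 1)) + c) from
          ⟨by linarith, by linarith [not_lt.1 h2]⟩)
      exact ⟨z, hz.1, hz.2, hz0⟩
    · have h2 : φ (u (i + 1)) < 0 := by tauto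
      have h3 := hm2 h2
      obtain ⟨z, hz, hz0⟩ := intermediate_value_Ioo' hle hψ
        (show (0 : ℝ) ∈ Set.Ioo (φ (u (i + 1)) + c) (φ (u i) + c) from
          ⟨by linarith, by linarith [not_lt.1 h1]⟩)
      exact ⟨z, hz.1, hz.2, hz0⟩
  choose! z hz1 hz2 hz3 using hroot
  have hinj : Set.InjOn z A := by
    have key : ∀ i ∈ A, ∀ j ∈ A, i < j → z i < z j := by
      intro i hi j hj hij
      have := hu (show i + 1 ≤ j from hij)
      linarith [hz2 i hi, hz1 j hj]
    intro i hi j hj hij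
    rcases lt_trichotomy i j with h | h | h
    · exact absurd hij (key i hi j hj h).ne
    · exact h
    · exact absurd hij (key j hj i hi h).ne'
  rw [← Finset.card_image_of_injOn hinj]
  refine kh_zeros hc hP (Q + MvPolynomial.C c) D ?_ ?_ _ ?_
  · refine (MvPolynomial.totalDegree_add _ _).trans ?_
    simpa using hQ
  · intro h
    have := MvPolynomial.vars_add_subset _ _ h
    rw [MvPolynomial.vars_C, Finset.union_empty] at this
    exact hQS this
  · intro t ht
    rw [Finset.mem_image] at ht
    obtain ⟨i, hi, rfl⟩ := ht
    have h0 := hz3 i hi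
    simp only [map_add, MvPolynomial.eval_C, ← hφ]
    refine ⟨h0, φ' (z i), ?_, (hφ' _).add_const _⟩
    intro h
    exact hcreg ⟨z i, h, by linarith⟩
end

/-- User-facing alternation bound. -/
theorem kh_alternation {ι : Type*} [Fintype ι] {L : ℕ} (e : ι ≃ Fin L) (g : ι → ℝ → ℝ)
    (P : ι → MvPolynomial (Option ι) ℝ) (M : ℕ) (hP : ∀ j, (P j).totalDegree ≤ M)
    (hvars : ∀ i j, some i ∈ (P j).vars → e i ≤ e j)
    (hder : ∀ j t, HasDerivAt (g j)
      (MvPolynomial.eval (fun o : Option ι => o.elim t (fun i => g i t)) (P j)) t)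
    (Q : MvPolynomial (Option ι) ℝ) (D : ℕ) (hQ : Q.totalDegree ≤ D)
    (u : ℕ → ℝ) (hu : Monotone u) (r : ℕ) :
    ((Finset.range r).filter (fun i => ¬
      (MvPolynomial.eval (fun o : Option ι => o.elim (u i) (fun k => g k (u i))) Q < 0 ↔
      MvPolynomial.eval (fun o : Option ι => o.elim (u (i + 1)) (fun k => g k (u (i + 1)))) Q < 0))).card
      ≤ khBound L M D := by
  classical
  let f : Option ι → Fin (L + 2) := fun o => o.elim (khT L) (fun i => ⟨e i, by have := (e i).2; omega⟩)
  let g' : ℕ → ℝ → ℝ := fun n => if h : n < L then g (e.symm ⟨n, h⟩) else 0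
  let P' : ℕ → MvPolynomial (Fin (L + 2)) ℝ := fun n =>
    if h : n < L then MvPolynomial.rename f (P (e.symm ⟨n, h⟩)) else 0
  have hg' : ∀ i, g' (e i) = g i := by
    intro i
    simp [g']
  have hchain : khChain L g' P' := by
    intro j hj p hp
    simp only [P', hj, dif_pos]
    rw [MvPolynomial.eval_rename]
    have : g' j = g (e.symm ⟨j, hj⟩) := by simp only [g', hj, dif_pos]
    rw [this]
    convert hder (e.symm ⟨j, hj⟩) (p (khT L)) using 1
    apply kh_eval_congr
    intro o ho
    cases o with
    | none => rfl
    | some i =>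
      have h1 := hvars _ _ ho
      rw [Equiv.apply_symm_apply] at h1
      have h2 := hp ⟨e i, by have := (e i).2; omega⟩ h1
      simp only [hg'] at h2
      simpa [f] using h2
  have hP' : ∀ j < L, (P' j).totalDegree ≤ M := by
    intro j hj
    simp only [P', hj, dif_pos]
    exact (MvPolynomial.totalDegree_rename_le _ _).trans (hP _)
  have hS : khS L ∉ (MvPolynomial.rename f Q).vars := by
    intro h
    have := MvPolynomial.vars_rename _ _ h
    rw [Finset.mem_image] at this
    obtain ⟨o, _, ho⟩ := this
    cases o with
    | none => simp [f, khS, khT] at ho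
    | some i =>
      have := (e i).2
      simp [f, khS] at ho
      omega
  have hφ : ∀ t, MvPolynomial.eval (fun o : Option ι => o.elim t (fun k => g k t)) Q =
      MvPolynomial.eval (khRho (L := L) g' L (fun _ => t)) (MvPolynomial.rename f Q) := by
    intro t
    rw [MvPolynomial.eval_rename]
    congr 2
    ext o
    cases o with
    | none => simp [f, khRho, khT]
    | some i => simp [f, khRho, hg']
  exact kh_alt hchain hP' (MvPolynomial.rename f Q) D
    ((MvPolynomial.totalDegree_rename_le _ _).trans hQ) hS
    (fun t => MvPolynomial.eval (fun o : Option ι => o.elim t (fun k => g k t)) Q) hφ u hu r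

end

section

open MeasureTheory

section GD
variable {d q : ℕ}

/-- The evaluation point `(a, c(a))`. -/
noncomputable def gdR (c : Fin q → (EuclideanSpace ℝ (Fin d) → ℝ)) (a : EuclideanSpace ℝ (Fin d)) :
    Fin d ⊕ Fin q → ℝ := Sum.elim (fun i => a i) (fun k => c k a)

/-- The total derivative operator. -/
noncomputable def gdD (P : Fin d → Fin q → MvPolynomial (Fin d ⊕ Fin q) ℝ) (l : Fin d)
    (F : MvPolynomial (Fin d ⊕ Fin q) ℝ) : MvPolynomial (Fin d ⊕ Fin q) ℝ :=
  MvPolynomial.pderiv (Sum.inl l) F + ∑ k, P l k * MvPolynomial.pderiv (Sum.inr k) F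

theorem gdD_deg (P : Fin d → Fin q → MvPolynomial (Fin d ⊕ Fin q) ℝ) {M : ℕ}
    (hP : ∀ l k, (P l k).totalDegree ≤ M) (l : Fin d) (F : MvPolynomial (Fin d ⊕ Fin q) ℝ) :
    (gdD P l F).totalDegree ≤ F.totalDegree + M := by
  unfold gdD
  refine (MvPolynomial.totalDegree_add _ _).trans (max_le ?_ ?_)
  · exact (kh_pderiv_deg _ _).trans (Nat.le_add_right _ _)
  · refine MvPolynomial.totalDegree_finsetSum_le fun k _ => ?_
    refine (MvPolynomial.totalDegree_mul _ _).trans ?_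
    have := hP l k
    have := kh_pderiv_deg (Sum.inr k) F
    omega

theorem gd_chain_c {c : Fin q → (EuclideanSpace ℝ (Fin d) → ℝ)}
    (hc : ∀ j, Differentiable ℝ (c j)) {P : Fin d → Fin q → MvPolynomial (Fin d ⊕ Fin q) ℝ}
    (hP : ∀ i j a, fderiv ℝ (c j) a (EuclideanSpace.single i 1) = MvPolynomial.eval (gdR c a) (P i j))
    (y : ℝ → EuclideanSpace ℝ (Fin d)) (v : Fin d → ℝ) (t : ℝ)
    (hy : ∀ l, HasDerivAt (fun s => y s l) (v l) t) (k : Fin q) :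
    HasDerivAt (fun s => c k (y s)) (∑ l, MvPolynomial.eval (gdR c (y t)) (P l k) * v l) t := by
  have hy' : HasDerivAt y (WithLp.toLp 2 v) t := by
    have h1 : HasDerivAt (fun s => (fun l => y s l)) v t := hasDerivAt_pi.2 hy
    have h2 := (PiLp.continuousLinearEquiv 2 ℝ (fun _ : Fin d => ℝ)).symm.hasFDerivAt.comp_hasDerivAt t h1
    exact h2
  have h := ((hc k) (y t)).hasFDerivAt.comp_hasDerivAt t hy'
  refine HasDerivAt.congr_deriv h ?_
  have hv : (WithLp.toLp 2 v : EuclideanSpace ℝ (Fin d)) = ∑ l, v l • EuclideanSpace.single l (1:ℝ) := by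
    ext i
    simp [Finset.sum_apply, Pi.single_apply]
  symm
  rw [hv, map_sum]
  refine Finset.sum_congr rfl fun l _ => ?_
  rw [map_smul, hP, smul_eq_mul, mul_comm]

theorem gd_chain {c : Fin q → (EuclideanSpace ℝ (Fin d) → ℝ)}
    (hc : ∀ j, Differentiable ℝ (c j)) {P : Fin d → Fin q → MvPolynomial (Fin d ⊕ Fin q) ℝ}
    (hP : ∀ i j a, fderiv ℝ (c j) a (EuclideanSpace.single i 1) = MvPolynomial.eval (gdR c a) (P i j))
    (F : MvPolynomial (Fin d ⊕ Fin q) ℝ)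
    (y : ℝ → EuclideanSpace ℝ (Fin d)) (v : Fin d → ℝ) (t : ℝ)
    (hy : ∀ l, HasDerivAt (fun s => y s l) (v l) t) :
    HasDerivAt (fun s => MvPolynomial.eval (gdR c (y s)) F)
      (∑ l, MvPolynomial.eval (gdR c (y t)) (gdD P l F) * v l) t := by
  have h1 : HasDerivAt (fun s => gdR c (y s)) (Sum.elim v
      (fun k => ∑ l, MvPolynomial.eval (gdR c (y t)) (P l k) * v l)) t := by
    rw [hasDerivAt_pi]
    rintro (l | k)
    · exact hy l
    · exact gd_chain_c hc hP y v t hy k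
  have h := (kh_eval_strict F (gdR c (y t))).hasFDerivAt.comp_hasDerivAt t h1
  have hs : ∀ (x w : Fin d ⊕ Fin q → ℝ), (∑ l, MvPolynomial.eval x (MvPolynomial.pderiv l F) •
      (ContinuousLinearMap.proj l : (Fin d ⊕ Fin q → ℝ) →L[ℝ] ℝ)) w =
      ∑ l, MvPolynomial.eval x (MvPolynomial.pderiv l F) * w l := by
    intro x w; simp [_root_.sum_apply]
  refine HasDerivAt.congr_deriv h ((hs _ _).trans ?_)
  symm
  simp only [gdD, map_add, map_sum, map_mul, add_mul, Finset.sum_add_distrib, Finset.sum_mul,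
       Fintype.sum_sum_type, Sum.elim_inl, Sum.elim_inr, Finset.mul_sum]
  congr 1
  rw [Finset.sum_comm]
  refine Finset.sum_congr rfl fun k _ => Finset.sum_congr rfl fun l _ => ?_
  ring

theorem gd_grad {c : Fin q → (EuclideanSpace ℝ (Fin d) → ℝ)}
    (hc : ∀ j, Differentiable ℝ (c j)) {P : Fin d → Fin q → MvPolynomial (Fin d ⊕ Fin q) ℝ}
    (hP : ∀ i j a, fderiv ℝ (c j) a (EuclideanSpace.single i 1) = MvPolynomial.eval (gdR c a) (P i j))
    (Q : MvPolynomial (Fin d ⊕ Fin q) ℝ) (f : EuclideanSpace ℝ (Fin d) → ℝ)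
    (hf : ∀ a, f a = MvPolynomial.eval (gdR c a) Q) (a : EuclideanSpace ℝ (Fin d)) (l : Fin d) :
    gradient f a l = MvPolynomial.eval (gdR c a) (gdD P l Q) := by
  have hd : DifferentiableAt ℝ f a := by
    rw [show f = fun a => MvPolynomial.eval (gdR c a) Q from funext hf]
    refine (kh_eval_strict Q (gdR c a)).hasFDerivAt.differentiableAt.comp a ?_
    rw [differentiableAt_pi]
    rintro (l | k)
    · simp only [gdR, Sum.elim_inl]; fun_prop
    · exact (hc k) a
  have h1 : gradient f a l = fderiv ℝ f a (EuclideanSpace.single l 1) := by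
    have := InnerProductSpace.toDual_symm_apply (𝕜 := ℝ) (x := EuclideanSpace.single l (1:ℝ)) (y := fderiv ℝ f a)
    rw [← this, EuclideanSpace.inner_single_right]
    simp [gradient]
  rw [h1]
  have hline : ∀ l', HasDerivAt (fun s : ℝ => (a + s • EuclideanSpace.single l (1:ℝ)) l')
      ((EuclideanSpace.single l (1:ℝ) : EuclideanSpace ℝ (Fin d)) l') 0 := by
    intro l'
    have := ((hasDerivAt_id (0:ℝ)).mul_const ((EuclideanSpace.single l (1:ℝ) : EuclideanSpace ℝ (Fin d)) l')).const_add (a l')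
    simpa using this
  have h2 := gd_chain hc hP Q (fun s : ℝ => a + s • EuclideanSpace.single l (1:ℝ)) _ 0 hline
  have h3 : HasDerivAt (fun s : ℝ => f (a + s • EuclideanSpace.single l (1:ℝ)))
      (fderiv ℝ f a (EuclideanSpace.single l 1)) 0 := by
    have hl : HasDerivAt (fun s : ℝ => a + s • EuclideanSpace.single l (1:ℝ)) (EuclideanSpace.single l (1:ℝ)) 0 := by
      simpa using ((hasDerivAt_id (0:ℝ)).smul_const (EuclideanSpace.single l (1:ℝ))).const_add a
    have hd' : HasFDerivAt f (fderiv ℝ f a) (a + (0:ℝ) • EuclideanSpace.single l (1:ℝ)) := by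
      simpa using hd.hasFDerivAt
    exact hd'.comp_hasDerivAt (0:ℝ) hl
  have e : (fun s : ℝ => f (a + s • EuclideanSpace.single l (1:ℝ))) =
      fun s : ℝ => MvPolynomial.eval (gdR c (a + s • EuclideanSpace.single l (1:ℝ))) Q := funext fun s => hf _
  rw [e] at h3
  have := h3.unique h2
  rw [this]
  simp

/-- embedding of the variables of the `i`-th iterate. -/
def gdEmb (H' i : ℕ) (s : Fin d ⊕ Fin q) : Option (Fin (H' + 1) × (Fin d ⊕ Fin q)) :=
  some (Fin.ofNat (H' + 1) i, s)

/-- derivative polynomials of the iterates. -/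
noncomputable def gdA (H' : ℕ) (P : Fin d → Fin q → MvPolynomial (Fin d ⊕ Fin q) ℝ)
    (Q : MvPolynomial (Fin d ⊕ Fin q) ℝ) :
    ℕ → Fin d → MvPolynomial (Option (Fin (H' + 1) × (Fin d ⊕ Fin q))) ℝ
  | 0 => fun _ => 0
  | i + 1 => fun l => gdA H' P Q i l + (MvPolynomial.C (-1) * MvPolynomial.rename (gdEmb H' i) (gdD P l Q)
      + MvPolynomial.C (-1) * (MvPolynomial.X none * ∑ l', MvPolynomial.rename (gdEmb H' i) (gdD P l' (gdD P l Q))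
          * gdA H' P Q i l'))

theorem gdA_deg (H' : ℕ) (P : Fin d → Fin q → MvPolynomial (Fin d ⊕ Fin q) ℝ)
    (Q : MvPolynomial (Fin d ⊕ Fin q) ℝ) {M Δ : ℕ} (hP : ∀ l k, (P l k).totalDegree ≤ M)
    (hQ : Q.totalDegree ≤ Δ) (i : ℕ) (l : Fin d) :
    (gdA H' P Q i l).totalDegree ≤ i * (Δ + 2 * M + 1) := by
  induction i generalizing l with
  | zero => simp [gdA]
  | succ i ih =>
    simp only [gdA]
    have hG : ∀ l, (gdD P l Q).totalDegree ≤ Δ + M := fun l => (gdD_deg P hP l Q).trans (by omega)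
    have hGG : ∀ l l', (gdD P l' (gdD P l Q)).totalDegree ≤ Δ + 2 * M :=
      fun l l' => (gdD_deg P hP l' _).trans (by have := hG l; omega)
    have e : (i + 1) * (Δ + 2 * M + 1) = i * (Δ + 2 * M + 1) + (Δ + 2 * M + 1) := by ring
    rw [e]
    refine (MvPolynomial.totalDegree_add _ _).trans (max_le ((ih l).trans (by omega)) ?_)
    refine (MvPolynomial.totalDegree_add _ _).trans (max_le ?_ ?_)
    · refine (MvPolynomial.totalDegree_mul _ _).trans ?_
      have := (MvPolynomial.totalDegree_rename_le (gdEmb H' i) (gdD P l Q)).trans (hG l)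
      rw [MvPolynomial.totalDegree_C]; omega
    · refine (MvPolynomial.totalDegree_mul _ _).trans ?_
      rw [MvPolynomial.totalDegree_C, zero_add]
      refine (MvPolynomial.totalDegree_mul _ _).trans ?_
      rw [MvPolynomial.totalDegree_X]
      have : (∑ l', MvPolynomial.rename (gdEmb H' i) (gdD P l' (gdD P l Q))
          * gdA H' P Q i l').totalDegree ≤ i * (Δ + 2 * M + 1) + (Δ + 2 * M) := by
        refine MvPolynomial.totalDegree_finsetSum_le fun l' _ => ?_
        refine (MvPolynomial.totalDegree_mul _ _).trans ?_
        have := (MvPolynomial.totalDegree_rename_le (gdEmb H' i) (gdD P l' (gdD P l Q))).trans (hGG l l')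
        have := ih l'
        omega
      omega

theorem gdA_vars (H' : ℕ) (P : Fin d → Fin q → MvPolynomial (Fin d ⊕ Fin q) ℝ)
    (Q : MvPolynomial (Fin d ⊕ Fin q) ℝ) (i : ℕ) (hi : i ≤ H' + 1) (l : Fin d)
    (p : Fin (H' + 1) × (Fin d ⊕ Fin q)) (hp : some p ∈ (gdA H' P Q i l).vars) : (p.1 : ℕ) < i := by
  classical
  induction i generalizing l with
  | zero => simp [gdA] at hp
  | succ i ih =>
    have ih := ih (by omega)
    have hren : ∀ F : MvPolynomial (Fin d ⊕ Fin q) ℝ,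
        some p ∈ (MvPolynomial.rename (gdEmb H' i) F).vars → (p.1 : ℕ) < i + 1 := by
      intro F hF
      have := MvPolynomial.vars_rename _ _ hF
      rw [Finset.mem_image] at this
      obtain ⟨s, _, hs⟩ := this
      simp only [gdEmb, Option.some.injEq] at hs
      rw [← hs]
      simp only [Fin.ofNat]
      exact (Nat.mod_le _ _).trans_lt (Nat.lt_succ_self _)
    simp only [gdA] at hp
    rcases Finset.mem_union.1 (MvPolynomial.vars_add_subset _ _ hp) with h | h
    · exact (ih l h).trans (Nat.lt_succ_self _)
    rcases Finset.mem_union.1 (MvPolynomial.vars_add_subset _ _ h) with h | h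
    · rcases Finset.mem_union.1 (MvPolynomial.vars_mul _ _ h) with h | h
      · rw [MvPolynomial.vars_C] at h; simp at h
      · exact hren _ h
    · rcases Finset.mem_union.1 (MvPolynomial.vars_mul _ _ h) with h | h
      · rw [MvPolynomial.vars_C] at h; simp at h
      rcases Finset.mem_union.1 (MvPolynomial.vars_mul _ _ h) with h | h
      · rw [MvPolynomial.vars_X] at h; simp at h
      have := MvPolynomial.vars_sum_subset _ _ h
      rw [Finset.mem_biUnion] at this
      obtain ⟨l', _, h⟩ := this
      rcases Finset.mem_union.1 (MvPolynomial.vars_mul _ _ h) with h | h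
      · exact hren _ h
      · exact (ih l' h).trans (Nat.lt_succ_self _)

/-- The chain polynomials. -/
noncomputable def gdP (H' : ℕ) (P : Fin d → Fin q → MvPolynomial (Fin d ⊕ Fin q) ℝ)
    (Q : MvPolynomial (Fin d ⊕ Fin q) ℝ) (p : Fin (H' + 1) × (Fin d ⊕ Fin q)) :
    MvPolynomial (Option (Fin (H' + 1) × (Fin d ⊕ Fin q))) ℝ :=
  Sum.elim (fun l => gdA H' P Q p.1 l)
    (fun k => ∑ l, MvPolynomial.rename (gdEmb H' p.1) (P l k) * gdA H' P Q p.1 l) p.2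

/-- The chain functions. -/
noncomputable def gdG (H' : ℕ) (c : Fin q → (EuclideanSpace ℝ (Fin d) → ℝ))
    (f : EuclideanSpace ℝ (Fin d) → ℝ) (x : EuclideanSpace ℝ (Fin d))
    (p : Fin (H' + 1) × (Fin d ⊕ Fin q)) (η : ℝ) : ℝ :=
  gdR c (gdIter f x η p.1) p.2

theorem gd_eval_ren (H' : ℕ) (c : Fin q → (EuclideanSpace ℝ (Fin d) → ℝ))
    (f : EuclideanSpace ℝ (Fin d) → ℝ) (x : EuclideanSpace ℝ (Fin d)) (i : ℕ) (hi : i < H' + 1)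
    (t : ℝ) (F : MvPolynomial (Fin d ⊕ Fin q) ℝ) :
    MvPolynomial.eval (fun o : Option (Fin (H' + 1) × (Fin d ⊕ Fin q)) =>
      o.elim t (fun i => gdG H' c f x i t)) (MvPolynomial.rename (gdEmb H' i) F)
      = MvPolynomial.eval (gdR c (gdIter f x t i)) F := by
  rw [MvPolynomial.eval_rename]
  congr 2
  ext s
  simp [gdEmb, gdG, Nat.mod_eq_of_lt hi]

theorem gd_iter_deriv (H' : ℕ) {c : Fin q → (EuclideanSpace ℝ (Fin d) → ℝ)}
    (hc : ∀ j, Differentiable ℝ (c j)) {P : Fin d → Fin q → MvPolynomial (Fin d ⊕ Fin q) ℝ}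
    (hP : ∀ i j a, fderiv ℝ (c j) a (EuclideanSpace.single i 1) = MvPolynomial.eval (gdR c a) (P i j))
    (Q : MvPolynomial (Fin d ⊕ Fin q) ℝ) (f : EuclideanSpace ℝ (Fin d) → ℝ)
    (hf : ∀ a, f a = MvPolynomial.eval (gdR c a) Q) (x : EuclideanSpace ℝ (Fin d))
    (i : ℕ) (hi : i < H' + 1) (l : Fin d) (t : ℝ) :
    HasDerivAt (fun η => gdIter f x η i l)
      (MvPolynomial.eval (fun o : Option (Fin (H' + 1) × (Fin d ⊕ Fin q)) =>
        o.elim t (fun i => gdG H' c f x i t)) (gdA H' P Q i l)) t := by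
  induction i generalizing l with
  | zero => simpa [gdIter, gdA] using hasDerivAt_const t (x l)
  | succ i ih =>
    have ih := ih (by omega)
    have h1 := gd_chain hc hP (gdD P l Q) (fun η => gdIter f x η i) _ t ih
    have h2 := (ih l).sub ((hasDerivAt_id t).mul h1)
    have e : (fun η => gdIter f x η (i + 1) l) = fun η => gdIter f x η i l - η *
        MvPolynomial.eval (gdR c (gdIter f x η i)) (gdD P l Q) := by
      ext η
      simp [gdIter, gd_grad hc hP Q f hf]
    rw [e]
    refine HasDerivAt.congr_deriv h2 ?_
    simp only [gdA, map_add, map_mul, map_sum, MvPolynomial.eval_C, MvPolynomial.eval_X,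
      gd_eval_ren H' c f x i (by omega), Option.elim_none]
    simp only [id]
    ring

theorem gd_cost_changes {d q : ℕ} (H M Δ : ℕ) (hH : 1 ≤ H) (θ : ℝ) (hθ : 0 < θ)
    (f : EuclideanSpace ℝ (Fin d) → ℝ) (hf : IsPfaffian q M Δ f) (x : EuclideanSpace ℝ (Fin d))
    (u : ℕ → ℝ) (hu : Monotone u) (r : ℕ) :
    ((Finset.range r).filter (fun i => gdCost H θ f x (u i) ≠ gdCost H θ f x (u (i + 1)))).card
      ≤ H * khBound (H * (d + q)) (H * (Δ + 2 * M + 1)) (2 * (Δ + M)) := by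
  classical
  obtain ⟨c, ⟨hcd, P, hPP⟩, Q, hQ, hfQ⟩ := hf
  obtain ⟨H', rfl⟩ : ∃ H', H = H' + 1 := ⟨H - 1, by omega⟩
  have hc : ∀ j, Differentiable ℝ (c j) := fun j => (hcd j).differentiable (by norm_num)
  have hP : ∀ i j a, fderiv ℝ (c j) a (EuclideanSpace.single i 1) = MvPolynomial.eval (gdR c a) (P i j) :=
    fun i j a => (hPP i j).2.2 a
  have hPd : ∀ i j, (P i j).totalDegree ≤ M := fun i j => (hPP i j).1
  have hPv := fun i j => (hPP i j).2.1
  have hf : ∀ a, f a = MvPolynomial.eval (gdR c a) Q := hfQ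
  let e : Fin (H' + 1) × (Fin d ⊕ Fin q) ≃ Fin ((H' + 1) * (d + q)) :=
    (Equiv.prodCongr (Equiv.refl _) finSumFinEquiv).trans finProdFinEquiv
  have he : ∀ p, ((e p : Fin _) : ℕ) = (finSumFinEquiv p.2 : Fin (d + q)) + (d + q) * p.1 := by
    intro p; simp [e, finProdFinEquiv_apply_val]
  have helt : ∀ p p' : Fin (H' + 1) × (Fin d ⊕ Fin q), (p.1 : ℕ) < p'.1 → e p ≤ e p' := by
    intro p p' h
    rw [Fin.le_def, he, he]
    have h1 := (finSumFinEquiv p.2 : Fin (d + q)).2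
    have h2 : (d + q) * (p.1 + 1) ≤ (d + q) * p'.1 := Nat.mul_le_mul_left _ h
    rw [Nat.mul_add] at h2
    omega
  let φ : ℕ → MvPolynomial (Option (Fin (H' + 1) × (Fin d ⊕ Fin q))) ℝ := fun i =>
    ∑ l, (MvPolynomial.rename (gdEmb H' i) (gdD P l Q)) ^ 2 + MvPolynomial.C (-θ ^ 2)
  have hφd : ∀ i, (φ i).totalDegree ≤ 2 * (Δ + M) := by
    intro i
    refine (MvPolynomial.totalDegree_add _ _).trans (max_le ?_ (by rw [MvPolynomial.totalDegree_C]; omega))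
    refine MvPolynomial.totalDegree_finsetSum_le fun l _ => ?_
    refine (MvPolynomial.totalDegree_pow _ _).trans ?_
    refine Nat.mul_le_mul_left _ ?_
    exact (MvPolynomial.totalDegree_rename_le _ _).trans ((gdD_deg P hPd l Q).trans (by omega))
  have hφ : ∀ i < H' + 1, ∀ t, ‖gradient f (gdIter f x t i)‖ < θ ↔
      MvPolynomial.eval (fun o : Option (Fin (H' + 1) × (Fin d ⊕ Fin q)) =>
        o.elim t (fun i => gdG H' c f x i t)) (φ i) < 0 := by
    intro i hi t
    simp only [φ, map_add, map_sum, map_pow, MvPolynomial.eval_C, gd_eval_ren H' c f x i hi]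
    rw [← abs_of_pos hθ, ← abs_of_nonneg (norm_nonneg (gradient f _)), ← sq_lt_sq, abs_of_pos hθ,
      EuclideanSpace.norm_sq_eq]
    simp only [gd_grad hc hP Q f hf, Real.norm_eq_abs, sq_abs]
    constructor <;> intro h <;> linarith
  have key : ∀ i < H' + 1, ((Finset.range r).filter (fun n =>
      ¬ (‖gradient f (gdIter f x (u n) i)‖ < θ ↔ ‖gradient f (gdIter f x (u (n + 1)) i)‖ < θ))).card
      ≤ khBound ((H' + 1) * (d + q)) ((H' + 1) * (Δ + 2 * M + 1)) (2 * (Δ + M)) := by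
    intro i hi
    simp only [hφ i hi]
    refine kh_alternation e (gdG H' c f x) (gdP H' P Q) _ ?_ ?_ ?_ (φ i) _ (hφd i) u hu r
    · rintro ⟨i, l | k⟩
      · simp only [gdP, Sum.elim_inl]
        refine (gdA_deg H' P Q hPd hQ i l).trans (Nat.mul_le_mul_right _ (by omega))
      · simp only [gdP, Sum.elim_inr]
        refine MvPolynomial.totalDegree_finsetSum_le fun l _ => ?_
        refine (MvPolynomial.totalDegree_mul _ _).trans ?_
        have h1 := (MvPolynomial.totalDegree_rename_le (gdEmb H' i) (P l k)).trans (hPd l k)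
        have h2 := gdA_deg H' P Q hPd hQ i l
        have h3 : ((i : ℕ) + 1) * (Δ + 2 * M + 1) ≤ (H' + 1) * (Δ + 2 * M + 1) :=
          Nat.mul_le_mul_right _ (by omega)
        rw [Nat.add_mul] at h3
        omega
    · rintro p ⟨i, l | k⟩ hp
      · simp only [gdP, Sum.elim_inl] at hp
        exact helt _ _ (gdA_vars H' P Q i (by omega) l p hp)
      · simp only [gdP, Sum.elim_inr] at hp
        have := MvPolynomial.vars_sum_subset _ _ hp
        rw [Finset.mem_biUnion] at this
        obtain ⟨l', _, h⟩ := this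
        rcases Finset.mem_union.1 (MvPolynomial.vars_mul _ _ h) with h | h
        · have := MvPolynomial.vars_rename _ _ h
          rw [Finset.mem_image] at this
          obtain ⟨s, hs1, hs⟩ := this
          simp only [gdEmb, Option.some.injEq] at hs
          rw [← hs, Fin.le_def, he, he]
          have h0 : (Fin.ofNat (H' + 1) (i : ℕ)) = i := by ext; simp
          simp only [h0]
          refine Nat.add_le_add_right ?_ _
          rcases s with l'' | k''
          · simp; omega
          · have := hPv l' k k'' hs1
            simpa using this
        · exact helt _ _ (gdA_vars H' P Q i (by omega) l' p h)
    · rintro ⟨i, l | k⟩ t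
      · exact gd_iter_deriv H' hc hP Q f hf x i i.2 l t
      · have := gd_chain_c hc hP (fun η => gdIter f x η i) _ t
          (fun l => gd_iter_deriv H' hc hP Q f hf x i i.2 l t) k
        simp only [gdP, Sum.elim_inr, map_sum, map_mul, gd_eval_ren H' c f x i i.2]
        exact this
  calc _ ≤ ((Finset.range (H' + 1)).biUnion (fun i => (Finset.range r).filter (fun n =>
      ¬ (‖gradient f (gdIter f x (u n) i)‖ < θ ↔ ‖gradient f (gdIter f x (u (n + 1)) i)‖ < θ)))).card := by
        refine Finset.card_le_card fun n hn => ?_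
        rw [Finset.mem_filter] at hn
        by_contra hcon
        apply hn.2
        simp only [Finset.mem_biUnion, Finset.mem_filter, not_exists, not_and, not_not] at hcon
        unfold gdCost
        congr 2
        ext i
        simp only [Set.mem_ofPred_eq]
        constructor
        · rintro ⟨h1, h2, h3⟩
          exact ⟨h1, h2, (hcon (i - 1) (Finset.mem_range.2 (by omega)) hn.1).1 h3⟩
        · rintro ⟨h1, h2, h3⟩
          exact ⟨h1, h2, (hcon (i - 1) (Finset.mem_range.2 (by omega)) hn.1).2 h3⟩
    _ ≤ ∑ i ∈ Finset.range (H' + 1), _ := Finset.card_biUnion_le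
    _ ≤ ∑ i ∈ Finset.range (H' + 1), khBound ((H' + 1) * (d + q)) ((H' + 1) * (Δ + 2 * M + 1)) (2 * (Δ + M)) :=
        Finset.sum_le_sum fun i hi => key i (Finset.mem_range.1 hi)
    _ = _ := by simp

end GD

end

section

open MeasureTheory

section EMP
variable {Ω : Type} [MeasurableSpace Ω] {D : Measure Ω} [IsProbabilityMeasure D]

theorem emp_int {X : Ω → ℝ} (hX : Measurable X) {B : ℝ} (hb : ∀ z, |X z| ≤ B) : Integrable X D :=
  Integrable.of_bound hX.aestronglyMeasurable B (Filter.Eventually.of_forall hb)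

theorem emp_mgf {X : Ω → ℝ} (hX : Measurable X) (hb : ∀ z, |X z| ≤ 1) {v lam : ℝ}
    (hv : ∫ z, X z ^ 2 ∂D ≤ v) (h0 : 0 ≤ lam) (h1 : lam ≤ 1) :
    ∫ z, Real.exp (lam * (X z - ∫ z, X z ∂D)) ∂D ≤ Real.exp (lam ^ 2 * v) := by
  set μ := ∫ z, X z ∂D with hμ
  have hi : Integrable X D := emp_int hX hb
  have hi2 : Integrable (fun z => X z ^ 2) D := emp_int (hX.pow_const 2) (B := 1) (fun z => by
    rw [abs_pow]; exact pow_le_one₀ (abs_nonneg _) (hb z))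
  have hpt : ∀ z, Real.exp (lam * (X z - μ)) ≤ Real.exp (-(lam * μ)) * (1 + lam * X z + lam ^ 2 * X z ^ 2) := by
    intro z
    have hy : |lam * X z| ≤ 1 := by
      rw [abs_mul, abs_of_nonneg h0]; exact mul_le_one₀ h1 (abs_nonneg _) (hb z)
    have := (abs_le.1 (Real.abs_exp_sub_one_sub_id_le hy)).2
    rw [show lam * (X z - μ) = -(lam * μ) + lam * X z by ring, Real.exp_add]
    refine mul_le_mul_of_nonneg_left ?_ (Real.exp_pos _).le
    nlinarith
  have hi3 : Integrable (fun z => 1 + lam * X z + lam ^ 2 * X z ^ 2) D :=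
    ((integrable_const 1).add (hi.const_mul lam)).add (hi2.const_mul _)
  calc ∫ z, Real.exp (lam * (X z - μ)) ∂D
      ≤ ∫ z, Real.exp (-(lam * μ)) * (1 + lam * X z + lam ^ 2 * X z ^ 2) ∂D := by
        refine integral_mono_of_nonneg (Filter.Eventually.of_forall fun z => (Real.exp_pos _).le)
          (hi3.const_mul _) (Filter.Eventually.of_forall hpt)
    _ = Real.exp (-(lam * μ)) * (1 + lam * μ + lam ^ 2 * ∫ z, X z ^ 2 ∂D) := by
        rw [integral_const_mul, integral_add, integral_add, integral_const_mul, integral_const_mul]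
        · simp [hμ]
        · exact integrable_const 1
        · exact hi.const_mul lam
        · exact (integrable_const 1).add (hi.const_mul lam)
        · exact hi2.const_mul _
    _ ≤ Real.exp (-(lam * μ)) * Real.exp (lam * μ + lam ^ 2 * v) := by
        refine mul_le_mul_of_nonneg_left ?_ (Real.exp_pos _).le
        have := Real.add_one_le_exp (lam * μ + lam ^ 2 * v)
        nlinarith [sq_nonneg lam]
    _ = Real.exp (lam ^ 2 * v) := by rw [← Real.exp_add]; congr 1; ring

theorem emp_chernoff {X : Ω → ℝ} (hX : Measurable X) (hb : ∀ z, |X z| ≤ 1) {v t : ℝ}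
    (hv : ∫ z, X z ^ 2 ∂D ≤ v) (ht : 0 < t) (htv : t ≤ v) (m : ℕ) :
    (Measure.pi fun _ : Fin m => D).real {s | m * t ≤ ∑ j, (X (s j) - ∫ z, X z ∂D)}
      ≤ Real.exp (-(m * t ^ 2 / (4 * v))) := by
  have hv0 : 0 < v := ht.trans_le htv
  set lam := t / (2 * v) with hlam
  have h0 : 0 ≤ lam := by positivity
  have h1 : lam ≤ 1 := by rw [hlam, div_le_one (by positivity)]; linarith
  set μ := ∫ z, X z ∂D with hμ
  have hmeas : Measurable (fun s : Fin m → Ω => ∑ j, (X (s j) - μ)) := by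
    refine Finset.measurable_sum _ fun j _ => ?_
    exact (hX.comp (measurable_pi_apply j)).sub_const _
  have hμb : |μ| ≤ 1 := by
    have := norm_integral_le_of_norm_le_const (μ := D) (f := X) (C := 1) (Filter.Eventually.of_forall hb)
    simpa using this
  have hintg : Integrable (fun s : Fin m → Ω => Real.exp (lam * ∑ j, (X (s j) - μ)))
      (Measure.pi fun _ : Fin m => D) := by
    refine Integrable.of_bound ((hmeas.const_mul lam).exp).aestronglyMeasurable
      (Real.exp (lam * (m * 2))) (Filter.Eventually.of_forall fun s => ?_)
    rw [Real.norm_eq_abs, Real.abs_exp]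
    refine Real.exp_le_exp.2 (mul_le_mul_of_nonneg_left ?_ h0)
    calc ∑ j, (X (s j) - μ) ≤ ∑ j : Fin m, (2 : ℝ) := Finset.sum_le_sum fun j _ => by
          linarith [(abs_le.1 (hb (s j))).2, (abs_le.1 hμb).1]
      _ = m * 2 := by simp
  have h := ProbabilityTheory.measure_ge_le_exp_mul_mgf (μ := Measure.pi fun _ : Fin m => D) (X := fun s => ∑ j, (X (s j) - μ))
    (m * t) h0 hintg
  refine h.trans ?_
  have hm : ProbabilityTheory.mgf (fun s : Fin m → Ω => ∑ j, (X (s j) - μ)) (Measure.pi fun _ : Fin m => D) lam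
      ≤ Real.exp (lam ^ 2 * v) ^ m := by
    unfold ProbabilityTheory.mgf
    have : ∀ s : Fin m → Ω, Real.exp (lam * ∑ j, (X (s j) - μ)) = ∏ j, Real.exp (lam * (X (s j) - μ)) := by
      intro s; rw [Finset.mul_sum, Real.exp_sum]
    simp only [this]
    rw [integral_fintype_prod_eq_prod (fun _ z => Real.exp (lam * (X z - μ)))]
    rw [Finset.prod_const, Finset.card_univ, Fintype.card_fin]
    exact pow_le_pow_left₀ (integral_nonneg fun z => (Real.exp_pos _).le) (emp_mgf hX hb hv h0 h1) m
  calc _ ≤ Real.exp (-lam * (m * t)) * Real.exp (lam ^ 2 * v) ^ m :=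
        mul_le_mul_of_nonneg_left hm (Real.exp_pos _).le
    _ = Real.exp (-(m * t ^ 2 / (4 * v))) := by
        rw [← Real.exp_nat_mul, ← Real.exp_add]
        congr 1
        rw [hlam]; field_simp; ring

theorem emp_chernoff_abs {X : Ω → ℝ} (hX : Measurable X) (hb : ∀ z, |X z| ≤ 1) {v t : ℝ}
    (hv : ∫ z, X z ^ 2 ∂D ≤ v) (ht : 0 < t) (htv : t ≤ v) (m : ℕ) :
    (Measure.pi fun _ : Fin m => D).real {s | m * t ≤ |∑ j, (X (s j) - ∫ z, X z ∂D)|}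
      ≤ 2 * Real.exp (-(m * t ^ 2 / (4 * v))) := by
  have h1 := emp_chernoff (D := D) hX hb hv ht htv m
  have h2 := emp_chernoff (D := D) (X := fun z => - X z) hX.neg (fun z => by simpa using hb z)
    (v := v) (by simpa using hv) ht htv m
  calc _ ≤ (Measure.pi fun _ : Fin m => D).real ({s | m * t ≤ ∑ j, (X (s j) - ∫ z, X z ∂D)} ∪
      {s | m * t ≤ ∑ j, (- X (s j) - ∫ z, - X z ∂D)}) := by
        refine measureReal_mono ?_
        intro s hs
        simp only [Set.mem_ofPred_eq, Set.mem_union] at hs ⊢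
        rcases le_abs.1 hs with h | h
        · exact Or.inl h
        · right
          refine h.trans (le_of_eq ?_)
          rw [integral_neg, ← Finset.sum_neg_distrib]
          refine Finset.sum_congr rfl fun j _ => by ring
    _ ≤ _ := measureReal_union_le _ _
    _ ≤ _ := by linarith

end EMP

end

section

open MeasureTheory

section EMP
set_option linter.unusedSectionVars false
variable {Ω : Type} [MeasurableSpace Ω] {D : Measure Ω} [IsProbabilityMeasure D]

/-- cumulative change mass -/
noncomputable def empW (D : Measure Ω) (f : ℕ → Ω → ℝ) (i : ℕ) : ℝ :=
  ∑ j ∈ Finset.range i, D.real {z | f j z ≠ f (j + 1) z}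

theorem empW_mono (f : ℕ → Ω → ℝ) : Monotone (empW D f) := by
  refine monotone_nat_of_le_succ fun i => ?_
  unfold empW
  rw [Finset.sum_range_succ]
  linarith [measureReal_nonneg (μ := D) (s := {z | f i z ≠ f (i + 1) z})]

theorem empW_nonneg (f : ℕ → Ω → ℝ) (i : ℕ) : 0 ≤ empW D f i :=
  Finset.sum_nonneg fun _ _ => measureReal_nonneg

theorem empW_le {f : ℕ → Ω → ℝ} (hf : ∀ i, Measurable (f i)) {N r : ℕ}
    (hN : ∀ z, ((Finset.range r).filter (fun i => f i z ≠ f (i + 1) z)).card ≤ N) {i : ℕ} (hi : i ≤ r) :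
    empW D f i ≤ N := by
  classical
  refine (empW_mono f hi).trans ?_
  have hms : ∀ j, MeasurableSet {z | f j z ≠ f (j + 1) z} := fun j =>
    (measurableSet_eq_fun (hf j) (hf (j + 1))).compl
  have h1 : empW D f r = ∫ z, ∑ j ∈ Finset.range r, ({z | f j z ≠ f (j + 1) z}.indicator (fun _ => (1:ℝ)) z) ∂D := by
    rw [integral_finsetSum _ (fun j _ => (integrable_const (1:ℝ)).indicator (hms j))]
    unfold empW
    refine Finset.sum_congr rfl fun j _ => ?_
    rw [integral_indicator_const _ (hms j)]; simp
  rw [h1]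
  have h2 : ∀ z, ∑ j ∈ Finset.range r, ({z | f j z ≠ f (j + 1) z}.indicator (fun _ => (1:ℝ)) z) ≤ N := by
    intro z
    have := hN z
    rw [Finset.card_filter] at this
    have h3 : ((∑ i ∈ Finset.range r, if f i z ≠ f (i + 1) z then 1 else 0 : ℕ) : ℝ) ≤ N := by exact_mod_cast this
    push_cast at h3
    simpa [Set.indicator_apply] using h3
  calc _ ≤ ∫ z, (N : ℝ) ∂D := by
        refine integral_mono (integrable_finsetSum _ fun j _ => (integrable_const (1:ℝ)).indicator (hms j))
          (integrable_const _) h2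
    _ = N := by simp

theorem emp_ne {f : ℕ → Ω → ℝ} {b a : ℕ} (h : b ≤ a) :
    D.real {z | f a z ≠ f b z} ≤ empW D f a - empW D f b := by
  induction a, h using Nat.le_induction with
  | base => simp
  | succ a hba ih =>
    have : {z | f (a + 1) z ≠ f b z} ⊆ {z | f a z ≠ f b z} ∪ {z | f a z ≠ f (a + 1) z} := by
      intro z hz
      by_contra hcon
      simp only [Set.mem_union, Set.mem_ofPred_eq, not_or, not_not] at hcon hz
      exact hz (by rw [← hcon.2, hcon.1])
    have h1 := (measureReal_mono (μ := D) this).trans (measureReal_union_le _ _)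
    have h2 : empW D f (a + 1) = empW D f a + D.real {z | f a z ≠ f (a + 1) z} := Finset.sum_range_succ _ _
    linarith

/-- dyadic cells -/
noncomputable def empCell (D : Measure Ω) (f : ℕ → Ω → ℝ) (k i : ℕ) : ℕ := ⌊empW D f i * 2 ^ k⌋₊

/-- representative of a cell -/
noncomputable def empPi (D : Measure Ω) (f : ℕ → Ω → ℝ) (k c : ℕ) : ℕ := sInf {j | empCell D f k j = c}

theorem empPi_cell (f : ℕ → Ω → ℝ) (k i : ℕ) :
    empCell D f k (empPi D f k (empCell D f k i)) = empCell D f k i :=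
  Nat.sInf_mem (s := {j | empCell D f k j = empCell D f k i}) ⟨i, rfl⟩

theorem empPi_le (f : ℕ → Ω → ℝ) (k i : ℕ) : empPi D f k (empCell D f k i) ≤ i :=
  Nat.sInf_le (rfl : empCell D f k i = empCell D f k i)

theorem empCell_half (f : ℕ → Ω → ℝ) (k i : ℕ) : empCell D f (k + 1) i / 2 = empCell D f k i := by
  unfold empCell
  rw [← Nat.floor_div_natCast]
  congr 1
  rw [pow_succ]; push_cast; ring

theorem empCell_bounds (f : ℕ → Ω → ℝ) (k i : ℕ) :
    (empCell D f k i : ℝ) ≤ empW D f i * 2 ^ k ∧ empW D f i * 2 ^ k < empCell D f k i + 1 :=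
  ⟨Nat.floor_le (mul_nonneg (empW_nonneg f i) (by positivity)), Nat.lt_floor_add_one _⟩

theorem empCell_close (f : ℕ → Ω → ℝ) (k a b : ℕ) (h : empCell D f k a = empCell D f k b) :
    empW D f a - empW D f b ≤ (1 / 2) ^ k := by
  have h1 := (empCell_bounds (D := D) f k a).2
  have h2 := (empCell_bounds (D := D) f k b).1
  rw [h] at h1
  rw [one_div, inv_pow]
  have h3 : (empW D f a - empW D f b) * 2 ^ k ≤ 1 := by linarith
  rwa [← le_div_iff₀ (by positivity), one_div] at h3

theorem empCell_le {f : ℕ → Ω → ℝ} {N i : ℕ} (h : empW D f i ≤ N) (k : ℕ) :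
    empCell D f k i ≤ N * 2 ^ k := by
  unfold empCell
  refine Nat.floor_le_of_le ?_
  push_cast
  exact mul_le_mul_of_nonneg_right h (by positivity)

/-- the link functions -/
noncomputable def empLink (D : Measure Ω) (f : ℕ → Ω → ℝ) : ℕ → ℕ → Ω → ℝ
  | 0, c => f (empPi D f 0 c)
  | k + 1, c => fun z => f (empPi D f (k + 1) c) z - f (empPi D f k (c / 2)) z

theorem empLink_meas {f : ℕ → Ω → ℝ} (hf : ∀ i, Measurable (f i)) (k c : ℕ) : Measurable (empLink D f k c) := by
  cases k with
  | zero => exact hf _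
  | succ k => exact (hf _).sub (hf _)

theorem empLink_bd {f : ℕ → Ω → ℝ} (h01 : ∀ i z, 0 ≤ f i z ∧ f i z ≤ 1) (k c : ℕ) (z : Ω) :
    |empLink D f k c z| ≤ 1 := by
  cases k with
  | zero => have := h01 (empPi D f 0 c) z; simp only [empLink]; rw [abs_le]; constructor <;> linarith
  | succ k =>
    have := h01 (empPi D f (k + 1) c) z
    have := h01 (empPi D f k (c / 2)) z
    simp only [empLink]; rw [abs_le]; constructor <;> linarith

theorem empLink_sq {f : ℕ → Ω → ℝ} (hf : ∀ i, Measurable (f i)) (h01 : ∀ i z, 0 ≤ f i z ∧ f i z ≤ 1)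
    (k i : ℕ) : ∫ z, empLink D f k (empCell D f k i) z ^ 2 ∂D ≤ 2 * (1 / 2) ^ k := by
  have hle1 : ∀ c z, empLink D f k c z ^ 2 ≤ 1 := fun c z => by
    rw [← sq_abs]; exact pow_le_one₀ (abs_nonneg _) (empLink_bd h01 k c z)
  have hintg : ∀ c, Integrable (fun z => empLink D f k c z ^ 2) D := fun c =>
    emp_int ((empLink_meas hf k c).pow_const 2) (B := 1) fun z => by
      rw [abs_of_nonneg (sq_nonneg _)]; exact hle1 c z
  cases k with
  | zero =>
    calc _ ≤ ∫ z, (1:ℝ) ∂D := integral_mono (hintg _) (integrable_const _) (hle1 _)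
      _ ≤ _ := by simp
  | succ k =>
    set a := empPi D f (k + 1) (empCell D f (k + 1) i) with ha
    set b := empPi D f k (empCell D f (k + 1) i / 2) with hb
    have hca : empCell D f (k + 1) a = empCell D f (k + 1) i := empPi_cell f _ _
    have hcak : empCell D f (k + 1) i / 2 = empCell D f k a := by rw [← hca, empCell_half]
    have hba : b ≤ a := by rw [hb, hcak]; exact empPi_le f k a
    have hcb : empCell D f k a = empCell D f k b := by rw [hb, hcak, empPi_cell]
    have hms : MeasurableSet {z | f a z ≠ f b z} := (measurableSet_eq_fun (hf a) (hf b)).compl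
    have hpt : ∀ z, empLink D f (k + 1) (empCell D f (k + 1) i) z ^ 2 ≤ {z | f a z ≠ f b z}.indicator (fun _ => (1:ℝ)) z := by
      intro z
      by_cases hz : f a z = f b z
      · simp only [empLink]
        rw [← ha, ← hb, hz]; simp [hz]
      · refine (hle1 _ z).trans ?_
        simp [hz]
    calc _ ≤ ∫ z, {z | f a z ≠ f b z}.indicator (fun _ => (1:ℝ)) z ∂D :=
          integral_mono (hintg _) ((integrable_const (1:ℝ)).indicator hms) hpt
      _ = D.real {z | f a z ≠ f b z} := by rw [integral_indicator_const _ hms]; simp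
      _ ≤ empW D f a - empW D f b := emp_ne hba
      _ ≤ (1 / 2) ^ k := empCell_close f k a b hcb
      _ = _ := by rw [pow_succ]; ring

/-- bracket sets -/
def empB (D : Measure Ω) (f : ℕ → Ω → ℝ) (r K c : ℕ) : Set Ω :=
  {z | ∃ j < r, empCell D f K j = c ∧ empCell D f K (j + 1) = c ∧ f j z ≠ f (j + 1) z}

theorem empB_meas {f : ℕ → Ω → ℝ} (hf : ∀ i, Measurable (f i)) (r K c : ℕ) : MeasurableSet (empB D f r K c) := by
  have : empB D f r K c = ⋃ j ∈ {j | j < r ∧ empCell D f K j = c ∧ empCell D f K (j + 1) = c}, {z | f j z ≠ f (j + 1) z} := by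
    ext z; simp [empB, and_assoc]
  rw [this]
  exact MeasurableSet.biUnion (Set.to_countable _) fun j _ => (measurableSet_eq_fun (hf j) (hf (j + 1))).compl

theorem empB_le (f : ℕ → Ω → ℝ) (r K c : ℕ) : D.real (empB D f r K c) ≤ (1 / 2) ^ K := by
  have key : D.real (empB D f r K c) ≤ max 0 (min (empW D f r) ((c + 1) / 2 ^ K) - c / 2 ^ K) := by
    induction r with
    | zero => simp [empB]
    | succ r ih =>
      have hW : empW D f r ≤ empW D f (r + 1) := empW_mono f (Nat.le_succ r)
      by_cases h : empCell D f K r = c ∧ empCell D f K (r + 1) = c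
      · have hsub : empB D f (r + 1) K c ⊆ empB D f r K c ∪ {z | f r z ≠ f (r + 1) z} := by
          rintro z ⟨j, hj, h1, h2, h3⟩
          rcases Nat.lt_succ_iff_lt_or_eq.1 hj with hj | rfl
          · exact Or.inl ⟨j, hj, h1, h2, h3⟩
          · exact Or.inr h3
        have h1 := (measureReal_mono (μ := D) hsub).trans (measureReal_union_le _ _)
        have h2 : empW D f (r + 1) = empW D f r + D.real {z | f r z ≠ f (r + 1) z} := Finset.sum_range_succ _ _
        have h3 := (empCell_bounds (D := D) f K r).1
        have h4 := (empCell_bounds (D := D) f K (r + 1)).2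
        rw [h.1] at h3; rw [h.2] at h4
        have h5 : (c:ℝ) / 2 ^ K ≤ empW D f r := by rwa [div_le_iff₀ (by positivity)]
        have h6 : empW D f (r + 1) ≤ (c + 1) / 2 ^ K := by rw [le_div_iff₀ (by positivity)]; exact h4.le
        rw [min_eq_left h6, max_eq_right (by linarith)]
        rw [min_eq_left (hW.trans h6), max_eq_right (by linarith)] at ih
        linarith
      · have hsub : empB D f (r + 1) K c ⊆ empB D f r K c := by
          rintro z ⟨j, hj, h1, h2, h3⟩
          rcases Nat.lt_succ_iff_lt_or_eq.1 hj with hj | rfl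
          · exact ⟨j, hj, h1, h2, h3⟩
          · exact absurd ⟨h1, h2⟩ h
        refine (measureReal_mono hsub).trans (ih.trans ?_)
        gcongr
  refine key.trans (max_le (by positivity) ?_)
  have : min (empW D f r) (((c:ℝ) + 1) / 2 ^ K) ≤ (c + 1) / 2 ^ K := min_le_right _ _
  have e : ((c:ℝ) + 1) / 2 ^ K = c / 2 ^ K + 1 / 2 ^ K := add_div _ _ _
  rw [one_div, inv_pow, ← one_div]
  linarith

theorem empB_diff {f : ℕ → Ω → ℝ} (r K i : ℕ) (hi : i ≤ r) (z : Ω) (hz : z ∉ empB D f r K (empCell D f K i)) :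
    f i z = f (empPi D f K (empCell D f K i)) z := by
  set a := empPi D f K (empCell D f K i) with ha
  have hai : a ≤ i := empPi_le f K i
  have hca : empCell D f K a = empCell D f K i := empPi_cell f K i
  have hcm : Monotone (empCell D f K) := fun x y h => Nat.floor_mono
    (mul_le_mul_of_nonneg_right (empW_mono f h) (by positivity))
  have : ∀ j, a ≤ j → j ≤ i → f j z = f a z := by
    intro j hj
    induction j, hj using Nat.le_induction with
    | base => intro _; rfl
    | succ j haj ih =>
      intro hji
      rw [← ih (by omega)]
      by_contra hne
      apply hz
      refine ⟨j, by omega, ?_, ?_, fun h => hne h.symm⟩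
      · exact le_antisymm (hcm (by omega)) (hca ▸ hcm haj)
      · exact le_antisymm (hcm hji) (hca ▸ hcm (by omega))
  exact this i hai le_rfl

end EMP

end

section

open MeasureTheory

section EMP
set_option linter.unusedSectionVars false
variable {Ω : Type} [MeasurableSpace Ω] {D : Measure Ω} [IsProbabilityMeasure D]

/-- threshold at level k -/
noncomputable def empT (ε : ℝ) (k : ℕ) : ℝ := ε / 16 * (3 / 4) ^ k

/-- centred sum -/
noncomputable def empS (D : Measure Ω) {m : ℕ} (s : Fin m → Ω) (g : Ω → ℝ) : ℝ :=
  ∑ j, (g (s j) - ∫ z, g z ∂D)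

theorem empS_sub {m : ℕ} (s : Fin m → Ω) {g h : Ω → ℝ} (hg : Integrable g D) (hh : Integrable h D) :
    empS D s (fun z => g z - h z) = empS D s g - empS D s h := by
  unfold empS
  rw [integral_sub hg hh, ← Finset.sum_sub_distrib]
  refine Finset.sum_congr rfl fun j _ => by ring

theorem empT_sum (ε : ℝ) (hε : 0 < ε) (K : ℕ) : ∑ k ∈ Finset.range (K + 1), empT ε k ≤ ε / 4 := by
  have : ∑ k ∈ Finset.range (K + 1), empT ε k = ε / 4 * (1 - (3 / 4) ^ (K + 1)) := by
    generalize K + 1 = n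
    induction n with
    | zero => simp
    | succ n ih => rw [Finset.sum_range_succ, ih, empT]; ring
  rw [this]
  have : (0:ℝ) < (3 / 4) ^ (K + 1) := by positivity
  nlinarith

theorem emp_det {f : ℕ → Ω → ℝ} (hf : ∀ i, Measurable (f i)) (h01 : ∀ i z, 0 ≤ f i z ∧ f i z ≤ 1)
    {m r K i : ℕ} {ε : ℝ} (hε : 0 < ε) (hK : (1 / 2 : ℝ) ^ K ≤ ε / 8) (hi : i ≤ r) (s : Fin m → Ω)
    (hL : ∀ k ≤ K, |empS D s (empLink D f k (empCell D f k i))| ≤ m * empT ε k)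
    (hB : empS D s ((empB D f r K (empCell D f K i)).indicator (fun _ => (1:ℝ))) ≤ m * (1 / 2) ^ K) :
    |empS D s (f i)| ≤ m * ε := by
  have hfi : ∀ i, Integrable (f i) D := fun i => emp_int (hf i) (B := 1) fun z => by
    rw [abs_of_nonneg (h01 i z).1]; exact (h01 i z).2
  have h1 : ∀ k ≤ K, |empS D s (f (empPi D f k (empCell D f k i)))| ≤ m * ∑ k' ∈ Finset.range (k + 1), empT ε k' := by
    intro k
    induction k with
    | zero => intro hk; simpa [empLink] using hL 0 (Nat.zero_le _)
    | succ k ih =>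
      intro hk
      have ih := ih (by omega)
      have h2 := hL (k + 1) hk
      rw [show empLink D f (k + 1) (empCell D f (k + 1) i) = fun z => f (empPi D f (k + 1) (empCell D f (k + 1) i)) z -
        f (empPi D f k (empCell D f (k + 1) i / 2)) z from rfl, empS_sub s (hfi _) (hfi _), empCell_half] at h2
      rw [Finset.sum_range_succ, mul_add]
      rw [abs_le] at *
      constructor <;> linarith [ih.1, ih.2, h2.1, h2.2]
  have h2 := (h1 K le_rfl).trans (mul_le_mul_of_nonneg_left (empT_sum ε hε K) (Nat.cast_nonneg m))
  set a := empPi D f K (empCell D f K i) with ha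
  set B := empB D f r K (empCell D f K i) with hBdef
  have hBm : MeasurableSet B := empB_meas hf _ _ _
  have hpt : ∀ z, |f i z - f a z| ≤ B.indicator (fun _ => (1:ℝ)) z := by
    intro z
    by_cases hz : z ∈ B
    · rw [Set.indicator_of_mem hz, abs_le]
      have := h01 i z; have := h01 a z
      constructor <;> linarith
    · rw [Set.indicator_of_notMem hz, empB_diff r K i hi z hz]; simp [ha]
  have hBi : Integrable (B.indicator (fun _ => (1:ℝ))) D := (integrable_const (1:ℝ)).indicator hBm
  have hBE : ∫ z, B.indicator (fun _ => (1:ℝ)) z ∂D ≤ (1 / 2) ^ K := by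
    rw [integral_indicator_const _ hBm]; simpa using empB_le (D := D) f r K (empCell D f K i)
  set e := ∫ z, B.indicator (fun _ => (1:ℝ)) z ∂D with he
  have hE : |∫ z, (f i z - f a z) ∂D| ≤ e :=
    abs_integral_le_integral_abs.trans (integral_mono ((hfi i).sub (hfi a)).abs hBi hpt)
  have h3 : |empS D s (fun z => f i z - f a z)| ≤ m * (3 * (1 / 2) ^ K) := by
    have : |empS D s (fun z => f i z - f a z)| ≤ ∑ j : Fin m, (B.indicator (fun _ => (1:ℝ)) (s j) + e) := by
      unfold empS
      refine (Finset.abs_sum_le_sum_abs _ _).trans (Finset.sum_le_sum fun j _ => ?_)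
      exact (abs_sub _ _).trans (add_le_add (hpt _) hE)
    refine this.trans ?_
    have e2 : ∑ j : Fin m, (B.indicator (fun _ => (1:ℝ)) (s j) + e) =
        empS D s (B.indicator (fun _ => (1:ℝ))) + m * (2 * e) := by
      unfold empS
      rw [← he, Finset.sum_add_distrib, Finset.sum_sub_distrib]; simp; ring
    rw [e2]
    have : (m:ℝ) * (2 * e) ≤ m * (2 * (1 / 2) ^ K) := by gcongr
    linarith
  rw [empS_sub s (hfi i) (hfi a)] at h3
  have h4 : (m:ℝ) * (3 * (1 / 2) ^ K) ≤ m * (3 * (ε / 8)) := by gcongr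
  have h5 : (0:ℝ) ≤ m * ε := by positivity
  rw [abs_le] at *
  constructor <;> nlinarith [h2.1, h2.2, h3.1, h3.2]

theorem emp_chain {f : ℕ → Ω → ℝ} (hf : ∀ i, Measurable (f i)) (h01 : ∀ i z, 0 ≤ f i z ∧ f i z ≤ 1)
    {N r : ℕ} (hN1 : 1 ≤ N)
    (hN : ∀ z, ((Finset.range r).filter (fun i => f i z ≠ f (i + 1) z)).card ≤ N)
    {ε A : ℝ} (hε : 0 < ε) (hε1 : ε ≤ 1) (m : ℕ) (hA : A = m * ε ^ 2 / 2048) (hA16 : 16 ≤ A) :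
    (Measure.pi fun _ : Fin m => D).real {s | ∃ i ≤ r, m * ε < |empS D s (f i)|} ≤ 10 * N * Real.exp (-A) := by
  classical
  obtain ⟨n, hn1, hn2⟩ := exists_nat_pow_near_of_lt_one (x := ε / 8) (y := (1 / 2 : ℝ)) (by positivity) (by linarith)
    (by norm_num) (by norm_num)
  set K := n + 1 with hK
  have hK1 : (1 / 2 : ℝ) ^ K ≤ ε / 8 := hn1.le
  have hK2 : ε / 16 ≤ (1 / 2 : ℝ) ^ K := by rw [hK, pow_succ]; linarith
  set μ := Measure.pi fun _ : Fin m => D with hμ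
  -- link events
  let Lk : ℕ → ℕ → Set (Fin m → Ω) := fun k c =>
    {s | (∃ i, empCell D f k i = c) ∧ m * empT ε k ≤ |empS D s (empLink D f k c)|}
  let Bk : ℕ → Set (Fin m → Ω) := fun c =>
    {s | m * (1 / 2) ^ K ≤ empS D s ((empB D f r K c).indicator (fun _ => (1:ℝ)))}
  have hLb : ∀ k ≤ K, ∀ c, μ.real (Lk k c) ≤ 2 * (Real.exp (-A) * Real.exp (-(2 * k))) := by
    intro k hk c
    by_cases hc : ∃ i, empCell D f k i = c
    · obtain ⟨i, rfl⟩ := hc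
      have hpow : ε * (3 / 2) ^ k ≤ 16 := by
        have h1 : ((3:ℝ) / 2) ^ k ≤ 2 ^ K :=
          (pow_le_pow_left₀ (by norm_num) (by norm_num) k).trans (pow_le_pow_right₀ (by norm_num) hk)
        have h2 : (1 / 2 : ℝ) ^ K * 2 ^ K = 1 := by rw [← mul_pow]; norm_num
        have h3 : (0:ℝ) < 2 ^ K := by positivity
        nlinarith
      have htv : empT ε k ≤ 2 * (1 / 2) ^ k := by
        unfold empT
        have : ((3:ℝ) / 4) ^ k = (3 / 2) ^ k * (1 / 2) ^ k := by rw [← mul_pow]; norm_num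
        rw [this]
        have h3 : (0:ℝ) < (1 / 2) ^ k := by positivity
        nlinarith
      have h := emp_chernoff_abs (D := D) (empLink_meas hf k (empCell D f k i)) (empLink_bd h01 k (empCell D f k i))
        (empLink_sq hf h01 k i) (t := empT ε k) (by unfold empT; positivity) htv m
      refine (measureReal_mono (μ := μ) (fun s hs => hs.2)).trans (h.trans ?_)
      rw [← Real.exp_add]
      refine mul_le_mul_of_nonneg_left (Real.exp_le_exp.2 ?_) (by norm_num)
      have e1 : m * empT ε k ^ 2 / (4 * (2 * (1 / 2) ^ k)) = A * (9 / 8) ^ k := by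
        rw [hA, empT, show ((9:ℝ) / 8) ^ k = ((3 / 4) ^ k) ^ 2 / (1 / 2) ^ k by
          rw [← pow_mul, mul_comm k 2, pow_mul, ← div_pow]; norm_num]
        field_simp; ring
      rw [e1]
      have hb := one_add_mul_le_pow (a := (1/8 : ℝ)) (by norm_num) k
      rw [show (1:ℝ) + 1 / 8 = 9 / 8 by norm_num] at hb
      have hk0 : (0:ℝ) ≤ k := Nat.cast_nonneg k
      nlinarith
    · have : Lk k c = ∅ := by ext s; simp [Lk, hc]
      rw [this]; simp; positivity
  have hBb : ∀ c, μ.real (Bk c) ≤ Real.exp (-A) * Real.exp (-(2 ^ K)) := by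
    intro c
    have hBm : MeasurableSet (empB D f r K c) := empB_meas hf _ _ _
    have h := emp_chernoff (D := D) (X := (empB D f r K c).indicator (fun _ => (1:ℝ))) (measurable_const.indicator hBm)
      (fun z => by
        by_cases hz : z ∈ empB D f r K c
        · simp [Set.indicator_of_mem hz]
        · simp [Set.indicator_of_notMem hz])
      (v := (1 / 2) ^ K) (t := (1 / 2) ^ K) (by
        have : ∀ z, ((empB D f r K c).indicator (fun _ => (1:ℝ)) z) ^ 2 = (empB D f r K c).indicator (fun _ => (1:ℝ)) z := by
          intro z
          by_cases hz : z ∈ empB D f r K c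
          · simp [Set.indicator_of_mem hz]
          · simp [Set.indicator_of_notMem hz]
        simp only [this]
        rw [integral_indicator_const _ hBm]; simpa using empB_le (D := D) f r K c) (by positivity) le_rfl m
    refine h.trans ?_
    rw [← Real.exp_add]
    refine Real.exp_le_exp.2 ?_
    set y := (1 / 2 : ℝ) ^ K with hy
    have h2 : y * 2 ^ K = 1 := by rw [hy, ← mul_pow]; norm_num
    have hy0 : 0 < y := by positivity
    have e1 : (m:ℝ) * y ^ 2 / (4 * y) = m * y / 4 := by field_simp
    rw [e1]
    have h3 : (1:ℝ) ≤ 2 ^ K := one_le_pow₀ (by norm_num)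
    -- m y / 4 ≥ 2 A 2^K
    have h4 : 2 * A * 2 ^ K ≤ m * y / 4 := by
      have h5 : ε * 2 ^ K ≤ 16 := by nlinarith
      have h6 : 2 * A * 2 ^ K = m * ε / 1024 * (ε * 2 ^ K) := by rw [hA]; ring
      have h7 : (0:ℝ) ≤ m * ε / 1024 := by positivity
      have h8 : (m:ℝ) * (ε / 16) ≤ m * y := by gcongr
      nlinarith
    nlinarith
  have hsub : {s | ∃ i ≤ r, m * ε < |empS D s (f i)|} ⊆
      (⋃ k ∈ Finset.range (K + 1), ⋃ c ∈ Finset.range (N * 2 ^ k + 1), Lk k c) ∪ ⋃ c ∈ Finset.range (N * 2 ^ K + 1), Bk c := by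
    rintro s ⟨i, hi, hs⟩
    by_contra hcon
    simp only [Set.mem_union, Set.mem_iUnion, not_or, not_exists, Finset.mem_range] at hcon
    have hc : ∀ k, empCell D f k i < N * 2 ^ k + 1 := fun k => Nat.lt_succ_of_le (empCell_le (empW_le hf hN hi) k)
    refine absurd (emp_det hf h01 hε hK1 hi s ?_ ?_) (not_le.2 hs)
    · intro k hk
      have := hcon.1 k (by omega) _ (hc k)
      by_contra h
      exact this ⟨⟨i, rfl⟩, (not_le.1 h).le⟩
    · have := hcon.2 _ (hc K)
      by_contra h
      exact this (not_le.1 h).le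
  have hN1' : (1:ℝ) ≤ N := by exact_mod_cast hN1
  have hcard : ∀ k, ((N * 2 ^ k + 1 : ℕ) : ℝ) ≤ 2 * N * 2 ^ k := by
    intro k; push_cast
    have : (1:ℝ) ≤ 2 ^ k := one_le_pow₀ (by norm_num)
    nlinarith
  have hexp2 : Real.exp (-2) ≤ 1 / 4 := by
    rw [Real.exp_neg, inv_eq_one_div]
    refine one_div_le_one_div_of_le (by norm_num) ?_
    have := Real.add_one_le_exp (1:ℝ)
    rw [show (2:ℝ) = 1 + 1 by norm_num, Real.exp_add]; nlinarith
  have hEA : 0 < Real.exp (-A) := Real.exp_pos _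
  have hpart1 : μ.real (⋃ k ∈ Finset.range (K + 1), ⋃ c ∈ Finset.range (N * 2 ^ k + 1), Lk k c) ≤ 8 * N * Real.exp (-A) := by
    refine (measureReal_biUnion_finset_le _ _).trans ?_
    have hone : ∀ k ∈ Finset.range (K + 1), μ.real (⋃ c ∈ Finset.range (N * 2 ^ k + 1), Lk k c) ≤
        4 * N * Real.exp (-A) * (1 / 2) ^ k := by
      intro k hk
      refine (measureReal_biUnion_finset_le _ _).trans ?_
      refine (Finset.sum_le_sum fun c _ => hLb k (by simpa [Nat.lt_succ_iff] using hk) c).trans ?_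
      rw [Finset.sum_const, Finset.card_range, nsmul_eq_mul]
      have h1 : Real.exp (-(2 * k)) ≤ (1 / 4) ^ k := by
        rw [show (-(2 * (k:ℝ))) = k * (-2) by ring, Real.exp_nat_mul]
        exact pow_le_pow_left₀ (Real.exp_pos _).le hexp2 k
      calc ((N * 2 ^ k + 1 : ℕ) : ℝ) * (2 * (Real.exp (-A) * Real.exp (-(2 * k))))
          ≤ (2 * N * 2 ^ k) * (2 * (Real.exp (-A) * (1 / 4) ^ k)) := by
            gcongr
            exact hcard k
        _ = 4 * N * Real.exp (-A) * (2 ^ k * (1 / 4) ^ k) := by ring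
        _ = _ := by rw [← mul_pow]; norm_num
    refine (Finset.sum_le_sum hone).trans ?_
    rw [← Finset.mul_sum]
    have hg : ∑ k ∈ Finset.range (K + 1), (1 / 2 : ℝ) ^ k ≤ 2 := by
      have := sum_geometric_two_le (K + 1)
      simpa using this
    have : (0:ℝ) ≤ 4 * N * Real.exp (-A) := by positivity
    nlinarith
  have hpart2 : μ.real (⋃ c ∈ Finset.range (N * 2 ^ K + 1), Bk c) ≤ 2 * N * Real.exp (-A) := by
    refine (measureReal_biUnion_finset_le _ _).trans ?_
    refine (Finset.sum_le_sum fun c _ => hBb c).trans ?_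
    rw [Finset.sum_const, Finset.card_range, nsmul_eq_mul]
    have h1 : (2:ℝ) ^ K * Real.exp (-(2 ^ K)) ≤ 1 := by
      rw [Real.exp_neg, ← div_eq_mul_inv, div_le_one (Real.exp_pos _)]
      linarith [Real.add_one_le_exp ((2:ℝ) ^ K)]
    calc ((N * 2 ^ K + 1 : ℕ) : ℝ) * (Real.exp (-A) * Real.exp (-(2 ^ K)))
        ≤ (2 * N * 2 ^ K) * (Real.exp (-A) * Real.exp (-(2 ^ K))) := by
          gcongr
          exact hcard K
      _ = 2 * N * Real.exp (-A) * (2 ^ K * Real.exp (-(2 ^ K))) := by ring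
      _ ≤ 2 * N * Real.exp (-A) * 1 := by gcongr
      _ = _ := by ring
  calc _ ≤ _ := measureReal_mono (μ := μ) hsub
    _ ≤ _ := measureReal_union_le _ _
    _ ≤ _ := by linarith

end EMP

end

section

open MeasureTheory

section EMP
set_option linter.unusedSectionVars false
variable {Ω : Type} [MeasurableSpace Ω] {D : Measure Ω} [IsProbabilityMeasure D]

theorem emp_null {R : Ω → Ω → Prop} (hsym : ∀ z z', R z z' → R z' z) (hR : ∀ z, D {z' | R z z'} = 0) (m : ℕ)
    (E : Set (Fin m → Ω)) (hE : MeasurableSet E) (hsub : ∀ s ∈ E, ∃ i j, i ≠ j ∧ R (s i) (s j)) :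
    (Measure.pi fun _ : Fin m => D) E = 0 := by
  induction m with
  | zero =>
    have : E = ∅ := by
      ext s
      simp only [Set.mem_empty_iff_false, iff_false]
      intro hs
      obtain ⟨i, _⟩ := hsub s hs
      exact i.elim0
    rw [this]; simp
  | succ m ih =>
    have hmp := (measurePreserving_piFinSuccAbove (fun _ : Fin (m + 1) => D) 0).symm
    rw [← hmp.measure_preimage hE.nullMeasurableSet]
    have hE' : MeasurableSet ((MeasurableEquiv.piFinSuccAbove (fun _ : Fin (m + 1) => Ω) 0).symm ⁻¹' E) :=
      (MeasurableEquiv.measurable _) hE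
    rw [Measure.measure_prod_null hE']
    refine Filter.Eventually.of_forall fun z => ?_
    simp only [Pi.zero_apply]
    set F : Set (Fin m → Ω) := Prod.mk z ⁻¹' ((MeasurableEquiv.piFinSuccAbove (fun _ : Fin (m + 1) => Ω) 0).symm ⁻¹' E) with hF
    have hFm : MeasurableSet F := measurable_prodMk_left hE'
    have hFmem : ∀ s ∈ F, (Fin.cons z s : Fin (m + 1) → Ω) ∈ E := by
      intro s hs
      simpa [hF, MeasurableEquiv.piFinSuccAbove_symm_apply, Fin.insertNthEquiv] using hs
    set G : Set (Fin m → Ω) := ⋃ j, (fun s => s j) ⁻¹' {z' | R z z'} with hG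
    have hG0 : (Measure.pi fun _ : Fin m => D) G = 0 := by
      rw [hG, measure_iUnion_null_iff]
      intro j
      exact (Measure.quasiMeasurePreserving_eval (fun _ : Fin m => D) j).preimage_null (hR z)
    have h1 : (Measure.pi fun _ : Fin m => D) (F \ toMeasurable (Measure.pi fun _ : Fin m => D) G) = 0 := by
      refine ih _ (hFm.diff (measurableSet_toMeasurable _ _)) ?_
      rintro s ⟨hs, hsG⟩
      have hsG' : s ∉ G := fun h => hsG (subset_toMeasurable _ _ h)
      simp only [hG, Set.mem_iUnion, Set.mem_preimage, Set.mem_ofPred_eq, not_exists] at hsG'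
      obtain ⟨i, j, hij, h⟩ := hsub _ (hFmem s hs)
      induction i using Fin.cases with
      | zero =>
        induction j using Fin.cases with
        | zero => exact absurd rfl hij
        | succ j => exact absurd (by simpa using h) (hsG' j)
      | succ i =>
        induction j using Fin.cases with
        | zero => exact absurd (hsym _ _ (by simpa using h)) (hsG' i)
        | succ j => exact ⟨i, j, fun e => hij (by rw [e]), by simpa using h⟩
    have h2 : F ⊆ (F \ toMeasurable (Measure.pi fun _ : Fin m => D) G) ∪ toMeasurable (Measure.pi fun _ : Fin m => D) G := by
      intro s hs
      by_cases h : s ∈ toMeasurable (Measure.pi fun _ : Fin m => D) G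
      · exact Or.inr h
      · exact Or.inl ⟨hs, h⟩
    refine measure_mono_null h2 (measure_union_null h1 ?_)
    rw [measure_toMeasurable, hG0]

/-- change-count hypothesis -/
def empChg (N : ℕ) (l : ℝ → Ω → ℝ) : Prop :=
  ∀ z (u : ℕ → ℝ), Monotone u → ∀ r, ((Finset.range r).filter (fun i => l (u i) z ≠ l (u (i + 1)) z)).card ≤ N

theorem emp_finite {l : ℝ → Ω → ℝ} {N : ℕ} (hN1 : 1 ≤ N) (hN : empChg N l) (h01 : ∀ x z, 0 ≤ l x z ∧ l x z ≤ 1)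
    (F : Finset ℝ) (hF : ∀ x ∈ F, Measurable (l x))
    {ε A : ℝ} (hε : 0 < ε) (hε1 : ε ≤ 1) (m : ℕ) (hA : A = m * ε ^ 2 / 2048) (hA16 : 16 ≤ A) :
    (Measure.pi fun _ : Fin m => D).real {s | ∃ x ∈ F, m * ε < |empS D s (l x)|} ≤ 10 * N * Real.exp (-A) := by
  rcases F.eq_empty_or_nonempty with rfl | hne
  · simp; positivity
  obtain ⟨k, hk⟩ : ∃ k, F.card = k + 1 := ⟨F.card - 1, by have := hne.card_pos; omega⟩
  let u : ℕ → ℝ := fun i => F.orderEmbOfFin hk ⟨min i k, by omega⟩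
  have hu : Monotone u := by
    intro i j hij
    refine (F.orderEmbOfFin hk).monotone ?_
    rw [Fin.mk_le_mk]
    exact min_le_min_right _ hij
  have h := emp_chain (D := D) (f := fun i => l (u i)) (fun i => hF _ (F.orderEmbOfFin_mem hk _)) (fun i z => h01 _ z) hN1
    (r := k) (fun z => hN z u hu k) hε hε1 m hA hA16
  refine le_trans (measureReal_mono ?_) h
  rintro s ⟨x, hx, hs⟩
  have : x ∈ Set.range (F.orderEmbOfFin hk) := by rw [Finset.range_orderEmbOfFin]; exact hx
  obtain ⟨i, rfl⟩ := this
  refine ⟨i, by omega, ?_⟩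
  have : u i = F.orderEmbOfFin hk i := by
    simp only [u]; congr 1; ext; simp; omega
  simp only [this]
  exact hs

theorem emp_countable {l : ℝ → Ω → ℝ} {N : ℕ} (hN1 : 1 ≤ N) (hN : empChg N l) (h01 : ∀ x z, 0 ≤ l x z ∧ l x z ≤ 1)
    (P : Set ℝ) (hP : P.Countable) (hF : ∀ x ∈ P, Measurable (l x))
    {ε A : ℝ} (hε : 0 < ε) (hε1 : ε ≤ 1) (m : ℕ) (hA : A = m * ε ^ 2 / 2048) (hA16 : 16 ≤ A) :
    (Measure.pi fun _ : Fin m => D) {s | ∃ x ∈ P, m * ε < |empS D s (l x)|} ≤ ENNReal.ofReal (10 * N * Real.exp (-A)) := by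
  classical
  rcases P.eq_empty_or_nonempty with rfl | hne
  · simp
  obtain ⟨p, rfl⟩ := hP.exists_eq_range hne
  have e : {s : Fin m → Ω | ∃ x ∈ Set.range p, m * ε < |empS D s (l x)|} =
      ⋃ n : ℕ, {s : Fin m → Ω | ∃ x ∈ (Finset.range n).image p, m * ε < |empS D s (l x)|} := by
    ext s
    simp only [Set.mem_range, Set.mem_ofPred_eq, Set.mem_iUnion, Finset.mem_image, Finset.mem_range]
    constructor
    · rintro ⟨x, ⟨i, rfl⟩, h⟩
      exact ⟨i + 1, _, ⟨i, Nat.lt_succ_self i, rfl⟩, h⟩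
    · rintro ⟨n, x, ⟨i, _, rfl⟩, h⟩
      exact ⟨_, ⟨i, rfl⟩, h⟩
  rw [e, Monotone.measure_iUnion]
  · refine iSup_le fun n => ?_
    have h := emp_finite (D := D) hN1 hN h01 ((Finset.range n).image p) (fun x hx => by
      obtain ⟨i, _, rfl⟩ := Finset.mem_image.1 hx
      exact hF _ ⟨i, rfl⟩) hε hε1 m hA hA16
    rw [← ofReal_measureReal]
    exact ENNReal.ofReal_le_ofReal h
  · intro a b hab s hs
    obtain ⟨x, hx, h⟩ := hs
    refine ⟨x, ?_, h⟩
    exact Finset.image_subset_image (Finset.range_mono hab) hx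

/-- right-discontinuity event -/
def empTset (l : ℝ → Ω → ℝ) (x : ℝ) : Set Ω := {z | ¬ ∃ b > x, ∀ y, x < y → y < b → l y z = l x z}

theorem emp_right {l : ℝ → Ω → ℝ} {N : ℕ} (hN : empChg N l) (z : Ω) (x : ℝ) :
    ∃ b > x, ∀ y, x < y → y < b → l y z = l b z := by
  by_contra hcon
  push Not at hcon
  have hc : ∀ b : Set.Ioi x, ∃ y : Set.Ioi x, (y : ℝ) < b ∧ l y z ≠ l b z := by
    rintro ⟨b, hb⟩
    obtain ⟨y, h1, h2, h3⟩ := hcon b hb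
    exact ⟨⟨y, h1⟩, h2, h3⟩
  choose g hg using hc
  let b : ℕ → Set.Ioi x := fun n => g^[n] ⟨x + 1, by simp⟩
  have hb : ∀ n, b (n + 1) = g (b n) := fun n => Function.iterate_succ_apply' g n _
  have hanti : Antitone fun n => (b n : ℝ) := antitone_nat_of_succ_le fun n => by rw [hb]; exact (hg (b n)).1.le
  have h := hN z (fun i => (b (N + 1 - i) : ℝ)) (fun i j hij => hanti (by omega)) (N + 1)
  rw [Finset.filter_true_of_mem] at h
  · simp at h
  · intro i hi
    have hi := Finset.mem_range.1 hi
    have e : N + 1 - i = (N + 1 - (i + 1)) + 1 := by omega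
    rw [e, hb]
    exact (hg _).2

theorem emp_T_card {l : ℝ → Ω → ℝ} {N : ℕ} (hN : empChg N l) (z : Ω) (F : Finset ℝ)
    (hF : ∀ x ∈ F, z ∈ empTset l x) : F.card ≤ N := by
  classical
  have key : (∀ x ∈ F, z ∈ empTset l x) → ∀ c, (∀ x ∈ F, c < x) → ∃ u : ℕ → ℝ, Monotone u ∧ c < u 0 ∧ ∃ r,
      F.card ≤ ((Finset.range r).filter (fun i => l (u i) z ≠ l (u (i + 1)) z)).card := by
    clear hF
    induction F using Finset.induction_on_min with
    | empty => intro _ c _; exact ⟨fun _ => c + 1, monotone_const, by simp, 0, by simp⟩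
    | insert a F ha ih =>
      intro hT c hc
      obtain ⟨u, hu, hu0, r, hr⟩ := ih (fun x hx => hT x (Finset.mem_insert_of_mem hx)) a ha
      have haT := hT a (Finset.mem_insert_self _ _)
      simp only [empTset, Set.mem_ofPred_eq] at haT
      push Not at haT
      obtain ⟨y, hy1, hy2, hy3⟩ := haT (u 0) hu0
      let u' : ℕ → ℝ := fun n => match n with
        | 0 => a
        | 1 => y
        | n + 2 => u n
      refine ⟨u', ?_, hc a (Finset.mem_insert_self _ _), r + 2, ?_⟩
      · refine monotone_nat_of_le_succ fun n => ?_
        match n with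
        | 0 => exact hy1.le
        | 1 => exact hy2.le
        | n + 2 => exact hu (Nat.le_succ n)
      · have hnot : a ∉ F := fun h => lt_irrefl _ (ha a h)
        rw [Finset.card_insert_of_notMem hnot]
        rw [Finset.card_filter] at hr ⊢
        rw [Finset.sum_range_succ', Finset.sum_range_succ']
        have h0 : (if l (u' 0) z ≠ l (u' (0 + 1)) z then 1 else 0) = 1 := if_pos fun h => hy3 h.symm
        have h1 : ∀ i, (if l (u' (i + 1 + 1)) z ≠ l (u' (i + 1 + 1 + 1)) z then 1 else 0) =
            if l (u i) z ≠ l (u (i + 1)) z then 1 else 0 := fun i => rfl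
        simp only [h1]
        rw [h0]
        omega
  obtain ⟨c, hc⟩ : ∃ c, ∀ x ∈ F, c < x := by
    obtain ⟨c, hc⟩ := F.bddBelow
    exact ⟨c - 1, fun x hx => by have := hc hx; linarith⟩
  obtain ⟨u, hu, _, r, hr⟩ := key hF c hc
  exact hr.trans (hN z u hu r)

theorem emp_T_countable {l : ℝ → Ω → ℝ} {N : ℕ} (hN : empChg N l) (z : Ω) : {x | z ∈ empTset l x}.Countable := by
  refine Set.Finite.countable ?_
  by_contra hinf
  obtain ⟨F, hF, hc⟩ := Set.Infinite.exists_subset_card_eq (hs := hinf) (N + 1)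
  have := emp_T_card hN z F (fun x hx => hF hx)
  omega

theorem emp_T_seq {l : ℝ → Ω → ℝ} {N : ℕ} (hN : empChg N l) {x : ℝ} {y : ℕ → ℝ} (hy : ∀ n, x < y n)
    (hy' : Filter.Tendsto y Filter.atTop (nhds x)) (z : Ω) :
    z ∉ empTset l x ↔ ∃ n, ∀ k ≥ n, l (y k) z = l x z := by
  simp only [empTset, Set.mem_ofPred_eq, not_not]
  constructor
  · rintro ⟨b, hb, h⟩
    obtain ⟨n, hn⟩ := Filter.eventually_atTop.1 (hy'.eventually (gt_mem_nhds hb))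
    exact ⟨n, fun k hk => h _ (hy k) (hn k hk)⟩
  · rintro ⟨n, hn⟩
    obtain ⟨b, hb, h⟩ := emp_right hN z x
    obtain ⟨n', hn'⟩ := Filter.eventually_atTop.1 (hy'.eventually (gt_mem_nhds hb))
    refine ⟨b, hb, fun w h1 h2 => ?_⟩
    rw [h w h1 h2, ← h _ (hy (max n n')) (hn' _ (le_max_right _ _)), hn _ (le_max_left _ _)]

theorem emp_T_meas {l : ℝ → Ω → ℝ} {N : ℕ} (hN : empChg N l) {x : ℝ} (hx : Measurable (l x)) {y : ℕ → ℝ} (hy : ∀ n, x < y n)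
    (hy' : Filter.Tendsto y Filter.atTop (nhds x)) (hm : ∀ n, Measurable (l (y n))) : MeasurableSet (empTset l x) := by
  have : (empTset l x)ᶜ = ⋃ n, ⋂ k ∈ Set.Ici n, {z | l (y k) z = l x z} := by
    ext z
    rw [Set.mem_compl_iff, emp_T_seq hN hy hy' z]
    simp
  rw [← compl_compl (empTset l x), this]
  refine (MeasurableSet.iUnion fun n => MeasurableSet.biInter (Set.to_countable _) fun k _ => ?_).compl
  exact measurableSet_eq_fun (hm k) hx

theorem emp_T_pos {l : ℝ → Ω → ℝ} {N : ℕ} (hN : empChg N l) (S : Set ℝ) (hS : ∀ x ∈ S, MeasurableSet (empTset l x)) :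
    {x | x ∈ S ∧ D (empTset l x) ≠ 0}.Countable := by
  classical
  have hsum : ∑' x : S, D (empTset l x) ≤ N := by
    rw [ENNReal.tsum_eq_iSup_sum]
    refine iSup_le fun F => ?_
    calc ∑ x ∈ F, D (empTset l x) = ∑ x ∈ F, ∫⁻ z, (empTset l (x : ℝ)).indicator 1 z ∂D := by
          refine Finset.sum_congr rfl fun x _ => ?_
          rw [lintegral_indicator_one (hS x x.2)]
      _ = ∫⁻ z, ∑ x ∈ F, (empTset l (x : ℝ)).indicator 1 z ∂D := by
          rw [lintegral_finsetSum]
          intro x _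
          exact measurable_one.indicator (hS x x.2)
      _ ≤ ∫⁻ z, (N : ENNReal) ∂D := by
          refine lintegral_mono fun z => ?_
          have h1 : ∑ x ∈ F, (empTset l (x : ℝ)).indicator (1 : Ω → ENNReal) z = ((F.filter fun x : S => z ∈ empTset l (x : ℝ)).card : ENNReal) := by
            rw [Finset.card_filter]; push_cast
            exact Finset.sum_congr rfl fun x _ => by simp [Set.indicator_apply]
          rw [h1]
          have := emp_T_card hN z ((F.filter fun x : S => z ∈ empTset l (x : ℝ)).map (Function.Embedding.subtype _)) (by
            intro x hx
            obtain ⟨y, hy, rfl⟩ := Finset.mem_map.1 hx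
            exact (Finset.mem_filter.1 hy).2)
          rw [Finset.card_map] at this
          refine Nat.cast_le.2 ?_
          convert this
      _ = N := by simp
  have h := Summable.countable_support_ennreal (ne_top_of_le_ne_top (ENNReal.natCast_ne_top N) hsum)
  refine (h.image (fun x : S => (x : ℝ))).mono ?_
  rintro x ⟨hx, hx'⟩
  exact ⟨⟨x, hx⟩, hx', rfl⟩

end EMP

end

section

open MeasureTheory

section EMP5
set_option linter.unusedSectionVars false
variable {Ω : Type} [MeasurableSpace Ω] {D : Measure Ω} [IsProbabilityMeasure D]

theorem emp_seq {S : Set ℝ} {x : ℝ} (h : ∀ b > x, ∃ y ∈ S, x < y ∧ y < b) :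
    ∃ y : ℕ → ℝ, (∀ n, y n ∈ S) ∧ (∀ n, x < y n) ∧ Filter.Tendsto y Filter.atTop (nhds x) := by
  have h1 : ∀ n : ℕ, ∃ y ∈ S, x < y ∧ y < x + 1 / ((n : ℝ) + 1) := fun n => h _ (by
    have : (0:ℝ) < 1 / ((n : ℝ) + 1) := by positivity
    linarith)
  choose y hy1 hy2 hy3 using h1
  refine ⟨y, hy1, hy2, ?_⟩
  have h2 : Filter.Tendsto (fun n : ℕ => x + 1 / ((n : ℝ) + 1)) Filter.atTop (nhds x) := by
    simpa using (tendsto_one_div_add_atTop_nhds_zero_nat (𝕜 := ℝ)).const_add x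
  exact tendsto_of_tendsto_of_tendsto_of_le_of_le tendsto_const_nhds h2 (fun n => (hy2 n).le) (fun n => (hy3 n).le)

theorem emp_isol (P : Set ℝ) : {x | x ∈ P ∧ ∃ b > x, ∀ y ∈ P, x < y → ¬ y < b}.Countable := by
  refine (countable_setOfPred_isolated_right_within (s := P)).mono ?_
  rintro x ⟨hx, b, hb, h⟩
  refine ⟨hx, ?_⟩
  rw [← Filter.empty_mem_iff_bot]
  refine mem_nhdsWithin.2 ⟨Set.Iio b, isOpen_Iio, hb, ?_⟩
  rintro y ⟨h1, h2, h3⟩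
  exact absurd h1 (h y h2 h3)

theorem emp_core (P : Set ℝ) : ∃ P1 ⊆ P, P1.Countable ∧ ∀ a b, (∃ y ∈ P, a < y ∧ y < b) → ∃ y ∈ P1, a < y ∧ y < b := by
  classical
  let I : Set (ℚ × ℚ) := {p | ∃ y ∈ P, (p.1 : ℝ) < y ∧ y < p.2}
  have h : ∀ p : I, ∃ y ∈ P, (p.1.1 : ℝ) < y ∧ y < p.1.2 := fun p => p.2
  choose g hg1 hg2 hg3 using h
  refine ⟨Set.range g, by rintro _ ⟨p, rfl⟩; exact hg1 p, Set.countable_range g, ?_⟩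
  rintro a b ⟨y, hy, h1, h2⟩
  obtain ⟨r1, hr1, hr1'⟩ := exists_rat_btwn h1
  obtain ⟨r2, hr2, hr2'⟩ := exists_rat_btwn h2
  let p : I := ⟨(r1, r2), y, hy, hr1', hr2⟩
  exact ⟨g p, ⟨p, rfl⟩, hr1.trans (hg2 p), (hg3 p).trans hr2'⟩

theorem emp_near {l : ℝ → Ω → ℝ} (h01 : ∀ x z, 0 ≤ l x z ∧ l x z ≤ 1)
    {S : Set ℝ} (hS : ∀ x ∈ S, Measurable (l x)) {x : ℝ} (h : ∀ b > x, ∃ y ∈ S, x < y ∧ y < b)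
    (hT : D (empTset l x) = 0) {m : ℕ} (s : Fin m → Ω)
    (hs : ∀ i j, s i ∈ empTset l x → s j ∈ empTset l x → i = j) :
    ∃ y ∈ S, |empS D s (l x)| ≤ |empS D s (l y)| + 2 := by
  classical
  obtain ⟨y, hyS, hyx, hy⟩ := emp_seq h
  have hstab : ∀ z, z ∉ empTset l x → ∀ᶠ n in Filter.atTop, l (y n) z = l x z := by
    intro z hz
    simp only [empTset, Set.mem_ofPred_eq, not_not] at hz
    obtain ⟨b, hb, h⟩ := hz
    filter_upwards [hy.eventually (gt_mem_nhds hb)] with n hn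
    exact h _ (hyx n) hn
  have hintg : Filter.Tendsto (fun n => ∫ z, l (y n) z ∂D) Filter.atTop (nhds (∫ z, l x z ∂D)) := by
    refine tendsto_integral_of_dominated_convergence (fun _ => (1:ℝ)) (fun n => (hS _ (hyS n)).aestronglyMeasurable)
      (integrable_const _) (fun n => Filter.Eventually.of_forall fun z => ?_) ?_
    · rw [Real.norm_eq_abs, abs_of_nonneg (h01 _ z).1]; exact (h01 _ z).2
    · have : ∀ᵐ z ∂D, z ∉ empTset l x := measure_eq_zero_iff_ae_notMem.1 hT
      filter_upwards [this] with z hz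
      exact tendsto_const_nhds.congr' ((hstab z hz).mono fun n hn => hn.symm)
  have hm : (0:ℝ) < 1 / ((m:ℝ) + 1) := by positivity
  have e1 := (Metric.tendsto_atTop.1 hintg) _ hm
  obtain ⟨n1, hn1⟩ := e1
  have e2 : ∀ᶠ n in Filter.atTop, ∀ j, s j ∉ empTset l x → l (y n) (s j) = l x (s j) := by
    rw [Filter.eventually_all]
    intro j
    by_cases hj : s j ∈ empTset l x
    · exact Filter.Eventually.of_forall fun n h => absurd hj h
    · exact (hstab _ hj).mono fun n hn _ => hn
  obtain ⟨n2, hn2⟩ := Filter.eventually_atTop.1 e2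
  set n := max n1 n2
  refine ⟨y n, hyS n, ?_⟩
  have a1 := hn1 n (le_max_left _ _)
  have a2 := hn2 n (le_max_right _ _)
  rw [Real.dist_eq] at a1
  have key : |empS D s (l x) - empS D s (l (y n))| ≤ 2 := by
    have : empS D s (l x) - empS D s (l (y n)) = ∑ j, (l x (s j) - l (y n) (s j)) +
        m * (∫ z, l (y n) z ∂D - ∫ z, l x z ∂D) := by
      simp only [empS, Finset.sum_sub_distrib, Finset.sum_const, Finset.card_univ, Fintype.card_fin, nsmul_eq_mul]
      ring
    rw [this]
    have b1 : |∑ j, (l x (s j) - l (y n) (s j))| ≤ 1 := by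
      have bd : ∀ j, |l x (s j) - l (y n) (s j)| ≤ 1 := by
        intro j
        have := h01 x (s j)
        have := h01 (y n) (s j)
        rw [abs_le]; constructor <;> linarith
      by_cases hex : ∃ i, s i ∈ empTset l x
      · obtain ⟨i, hi⟩ := hex
        rw [Finset.sum_eq_single i]
        · exact bd i
        · intro j _ hj
          rw [a2 j (fun h => hj (hs j i h hi)), sub_self]
        · simp
      · rw [Finset.sum_eq_zero]
        · simp
        · intro j _
          rw [a2 j (fun h => hex ⟨j, h⟩), sub_self]
    have b2 : |(m:ℝ) * (∫ z, l (y n) z ∂D - ∫ z, l x z ∂D)| ≤ 1 := by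
      rw [abs_mul, Nat.abs_cast]
      calc (m:ℝ) * |∫ z, l (y n) z ∂D - ∫ z, l x z ∂D| ≤ m * (1 / (m + 1)) := by gcongr
        _ ≤ 1 := by rw [mul_one_div, div_le_one (by positivity)]; linarith
    exact (abs_add_le _ _).trans (by linarith)
  have := abs_sub_abs_le_abs_sub (empS D s (l x)) (empS D s (l (y n)))
  linarith

theorem emp_general {l : ℝ → Ω → ℝ} {N : ℕ} (hN1 : 1 ≤ N) (hN : empChg N l) (h01 : ∀ x z, 0 ≤ l x z ∧ l x z ≤ 1)
    (P : Set ℝ) (hF : ∀ x ∈ P, Measurable (l x))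
    {ε A : ℝ} (hε : 0 < ε) (hε1 : ε ≤ 1) (m : ℕ) (hA : A = m * (ε / 2) ^ 2 / 2048) (hA16 : 16 ≤ A)
    (hmeas : MeasurableSet {s : Fin m → Ω | ∃ x ∈ P, m * ε < |empS D s (l x)|}) :
    (Measure.pi fun _ : Fin m => D) {s | ∃ x ∈ P, m * ε < |empS D s (l x)|} ≤ ENNReal.ofReal (10 * N * Real.exp (-A)) := by
  classical
  obtain ⟨P1, hP1, hP1c, hP1d⟩ := emp_core P
  set P2 : Set ℝ := {x | x ∈ P ∧ ∃ b > x, ∀ y ∈ P, x < y → ¬ y < b} with hP2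
  have hP2c : P2.Countable := emp_isol P
  have hdec : ∀ x ∈ P \ P2, ∀ b > x, ∃ y ∈ P, x < y ∧ y < b := by
    rintro x ⟨hx, hx2⟩ b hb
    by_contra hcon
    push Not at hcon
    exact hx2 ⟨hx, b, hb, fun y hy h => not_lt.2 (hcon y hy h)⟩
  set P3 : Set ℝ := {x | x ∈ P \ P2 ∧ D (empTset l x) ≠ 0} with hP3
  have hP3c : P3.Countable := by
    refine emp_T_pos hN _ fun x hx => ?_
    obtain ⟨y, hyS, hyx, hy⟩ := emp_seq (hdec x hx)
    exact emp_T_meas hN (hF x hx.1) hyx hy (fun n => hF _ (hyS n))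
  set P' : Set ℝ := P1 ∪ P2 ∪ P3 with hP'
  have hP'P : P' ⊆ P := by
    rintro x ((hx | hx) | hx)
    · exact hP1 hx
    · exact hx.1
    · exact hx.1.1
  have hP'c : P'.Countable := (hP1c.union hP2c).union hP3c
  have hb := emp_countable (D := D) hN1 hN h01 P' hP'c (fun x hx => hF x (hP'P hx)) (half_pos hε) (by linarith) m hA hA16
  set B' : Set (Fin m → Ω) := {s | ∃ x ∈ P', m * (ε / 2) < |empS D s (l x)|} with hB'
  set B : Set (Fin m → Ω) := {s | ∃ x ∈ P, m * ε < |empS D s (l x)|} with hB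
  set μ := (Measure.pi fun _ : Fin m => D)
  have hmε : 4 ≤ (m:ℝ) * ε := by
    have h1 : (m:ℝ) * ε ^ 2 = A * 8192 := by rw [hA]; ring
    have h2 : (m:ℝ) * ε ^ 2 ≤ m * ε := by
      have : ε ^ 2 ≤ ε := by nlinarith
      gcongr
    linarith
  have hnull : μ (B \ toMeasurable μ B') = 0 := by
    refine emp_null (R := fun z z' => ∃ x ∈ P \ P', z ∈ empTset l x ∧ z' ∈ empTset l x) ?_ ?_ m _
      (hmeas.diff (measurableSet_toMeasurable _ _)) ?_
    · rintro z z' ⟨x, hx, h1, h2⟩; exact ⟨x, hx, h2, h1⟩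
    · intro z
      have : {z' | ∃ x ∈ P \ P', z ∈ empTset l x ∧ z' ∈ empTset l x} =
          ⋃ x ∈ {x | z ∈ empTset l x} ∩ (P \ P'), empTset l x := by
        ext z'; simp only [Set.mem_iUnion, Set.mem_ofPred_eq, Set.mem_inter_iff]
        constructor
        · rintro ⟨x, hx, h1, h2⟩; exact ⟨x, ⟨h1, hx⟩, h2⟩
        · rintro ⟨x, ⟨h1, hx⟩, h2⟩; exact ⟨x, hx, h1, h2⟩
      rw [this, measure_biUnion_null_iff ((emp_T_countable hN z).mono Set.inter_subset_left)]
      rintro x ⟨_, hx⟩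
      by_contra h0
      exact hx.2 (Or.inr ⟨⟨hx.1, fun h => hx.2 (Or.inl (Or.inr h))⟩, h0⟩)
    · rintro s ⟨⟨x, hxP, hx⟩, hs⟩
      have hs' : s ∉ B' := fun h => hs (subset_toMeasurable _ _ h)
      by_contra hcon
      push Not at hcon
      have hsm : ∀ y ∈ P', |empS D s (l y)| ≤ m * (ε / 2) := by
        intro y hy
        by_contra h
        exact hs' ⟨y, hy, not_le.1 h⟩
      by_cases hxP' : x ∈ P'
      · have := hsm x hxP'
        linarith
      have hx2 : x ∉ P2 := fun h => hxP' (Or.inl (Or.inr h))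
      have hT : D (empTset l x) = 0 := by
        by_contra h0
        exact hxP' (Or.inr ⟨⟨hxP, hx2⟩, h0⟩)
      obtain ⟨y, hy, h⟩ := emp_near h01 (S := P') (fun x hx => hF x (hP'P hx)) (x := x) (fun b hb => by
        obtain ⟨y, hy, h⟩ := hP1d x b (hdec x ⟨hxP, hx2⟩ b hb)
        exact ⟨y, Or.inl (Or.inl hy), h⟩) hT s (fun i j hi hj => by
          by_contra hij
          exact hcon i j hij x ⟨hxP, hxP'⟩ hi hj)
      have := hsm y hy
      linarith
  calc μ B ≤ μ ((B \ toMeasurable μ B') ∪ toMeasurable μ B') := measure_mono (by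
        intro s hs
        by_cases h : s ∈ toMeasurable μ B'
        · exact Or.inr h
        · exact Or.inl ⟨hs, h⟩)
    _ ≤ μ (B \ toMeasurable μ B') + μ (toMeasurable μ B') := measure_union_le _ _
    _ = μ B' := by rw [hnull, measure_toMeasurable, zero_add]
    _ ≤ _ := hb

end EMP5

end

section

open MeasureTheory

theorem fin_log {d H q M Δ : ℕ} (hd : 1 ≤ d) (hH : 1 ≤ H) (hq : 1 ≤ q) (hM : 1 ≤ M) (hΔ : 1 ≤ Δ) :
    1 ≤ H * khBound (H * (d + q)) (H * (Δ + 2 * M + 1)) (2 * (Δ + M)) ∧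
    Real.log ((H * khBound (H * (d + q)) (H * (Δ + 2 * M + 1)) (2 * (Δ + M)) : ℕ) : ℝ) ≤
      79 * ((q : ℝ) ^ 2 * (d : ℝ) ^ 2 * (H : ℝ) ^ 2 + (q : ℝ) * d * H * Real.log (Δ + M)) := by
  have hdR : (1:ℝ) ≤ d := by exact_mod_cast hd
  have hHR : (1:ℝ) ≤ H := by exact_mod_cast hH
  have hqR : (1:ℝ) ≤ q := by exact_mod_cast hq
  have hMR : (1:ℝ) ≤ M := by exact_mod_cast hM
  have hΔR : (1:ℝ) ≤ Δ := by exact_mod_cast hΔ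
  constructor
  · unfold khBound
    exact Nat.succ_le_of_lt (by positivity)
  obtain ⟨L, hL⟩ : ∃ L, L = H * (d + q) := ⟨_, rfl⟩
  have hLR : (L:ℝ) = H * (d + q) := by rw [hL]; push_cast; ring
  set X : ℝ := q * d * H with hX
  have hqd : (1:ℝ) ≤ q * d := one_le_mul_of_one_le_of_one_le hqR hdR
  have hX1 : 1 ≤ X := one_le_mul_of_one_le_of_one_le hqd hHR
  have hHX : (H:ℝ) ≤ X := by rw [hX]; exact le_mul_of_one_le_left (by positivity) hqd
  have hLX : (L:ℝ) ≤ 2 * X := by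
    have : (d:ℝ) + q ≤ 2 * (q * d) := by nlinarith
    rw [hLR, hX]
    calc (H:ℝ) * (d + q) ≤ H * (2 * (q * d)) := by gcongr
      _ = _ := by ring
  set S : ℝ := (Δ:ℝ) + M with hS
  have hS2 : 2 ≤ S := by linarith
  have hlogS : 0 ≤ Real.log S := Real.log_nonneg (by linarith)
  have hlog2 : Real.log 2 ≤ 1 := by linarith [Real.log_two_lt_d9]
  have hL0 : (0:ℝ) ≤ L := Nat.cast_nonneg _
  set W : ℝ := 2 * S + 4 + L * (H * (Δ + 2 * M + 1)) with hW
  have hWpos : 0 < W := by positivity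
  have hWle : W ≤ 10 * (X ^ 2 * S) := by
    have h1 : (H:ℝ) * (Δ + 2 * M + 1) ≤ X * (3 * S) := by gcongr; linarith
    have h2 : (L:ℝ) * (H * (Δ + 2 * M + 1)) ≤ (2 * X) * (X * (3 * S)) := by gcongr
    have h3 : S ≤ X ^ 2 * S := le_mul_of_one_le_left (by linarith) (one_le_pow₀ hX1)
    rw [hW]; nlinarith
  have hlogW : Real.log W ≤ 11 * X + Real.log S := by
    have h1 := Real.log_le_log hWpos hWle
    rw [Real.log_mul (by norm_num) (by positivity), Real.log_mul (by positivity) (by positivity), Real.log_pow] at h1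
    have h2 := Real.log_le_sub_one_of_pos (show (0:ℝ) < 10 by norm_num)
    have h3 := Real.log_le_sub_one_of_pos (show (0:ℝ) < X by linarith)
    push_cast at h1
    linarith
  have e : ((H * khBound (H * (d + q)) (H * (Δ + 2 * M + 1)) (2 * (Δ + M)) : ℕ) : ℝ) =
      H * (2 ^ L * (((L:ℝ) + 4) ^ (L + 2) * (2 ^ L * W) ^ (L + 2))) := by
    rw [← hL]; unfold khBound; push_cast; rw [hW, hS]
  rw [e, Real.log_mul (by positivity) (by positivity), Real.log_mul (by positivity) (by positivity),
    Real.log_mul (by positivity) (by positivity), Real.log_pow, Real.log_pow, Real.log_pow,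
    Real.log_mul (by positivity) (by positivity), Real.log_pow]
  push_cast
  have a1 : Real.log H ≤ X := by
    have := Real.log_le_sub_one_of_pos (show (0:ℝ) < H by linarith)
    linarith
  have a2 : Real.log ((L:ℝ) + 4) ≤ 6 * X := by
    have := Real.log_le_sub_one_of_pos (show (0:ℝ) < (L:ℝ) + 4 by linarith)
    linarith
  have a3 : (L:ℝ) * Real.log 2 ≤ 2 * X := by
    calc (L:ℝ) * Real.log 2 ≤ L * 1 := by gcongr
      _ ≤ _ := by linarith
  have a4 : (L:ℝ) + 2 ≤ 4 * X := by linarith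
  have a5 : ((L:ℝ) + 2) * Real.log ((L:ℝ) + 4) ≤ 4 * X * (6 * X) := by
    have : 0 ≤ Real.log ((L:ℝ) + 4) := Real.log_nonneg (by linarith)
    gcongr
  have a6 : ((L:ℝ) + 2) * ((L:ℝ) * Real.log 2 + Real.log W) ≤ 4 * X * (13 * X + Real.log S) := by
    calc ((L:ℝ) + 2) * ((L:ℝ) * Real.log 2 + Real.log W) ≤ ((L:ℝ) + 2) * (13 * X + Real.log S) := by
          refine mul_le_mul_of_nonneg_left (by linarith) (by linarith)
      _ ≤ _ := by gcongr
  have a7 : X ≤ X ^ 2 := by nlinarith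
  have e2 : (q : ℝ) ^ 2 * (d : ℝ) ^ 2 * (H : ℝ) ^ 2 = X ^ 2 := by rw [hX]; ring
  rw [e2]
  have a8 : 0 ≤ X * Real.log S := by positivity
  nlinarith

theorem fin_cost_le {d : ℕ} (H : ℕ) (θ : ℝ) (f : EuclideanSpace ℝ (Fin d) → ℝ)
    (x : EuclideanSpace ℝ (Fin d)) (η : ℝ) : gdCost H θ f x η ≤ H :=
  Nat.sInf_le (Or.inr rfl)

end

/-- Uniform convergence for tuning the gradient-descent step size over Pfaffian instances
(chain length at most `q`, Pfaffian degree at most `M`, degree at most `Δ`), with sample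
complexity `m = O((H²/ε²)(q²d²H² + qdH log(Δ+M) + log(1/δ)))`. -/
theorem gd_pfaffian_stepsize_uniform_convergence :
    ∃ C : ℝ, 0 < C ∧
      ∀ (d H q M Δ : ℕ), 1 ≤ d → 1 ≤ H → 1 ≤ q → 1 ≤ M → 1 ≤ Δ →
      ∀ θ : ℝ, 0 < θ →
      ∀ (Ω : Type) (_ : MeasurableSpace Ω)
        (inst : Ω → (EuclideanSpace ℝ (Fin d)) × (EuclideanSpace ℝ (Fin d) → ℝ)),
        (∀ z : Ω, IsPfaffian q M Δ (inst z).2) →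
      ∀ P : Set ℝ, P ⊆ Set.Ici (0 : ℝ) →
        (∀ η ∈ P, Measurable fun z : Ω => (gdCost H θ (inst z).2 (inst z).1 η : ℝ)) →
      ∀ (D : Measure Ω), IsProbabilityMeasure D →
      ∀ ε δ : ℝ, 0 < ε → 0 < δ → δ < 1 →
        (∀ (m : ℕ) (t : ℝ), MeasurableSet {s : Fin m → Ω | ∀ η ∈ P,
          |(∑ j : Fin m, (gdCost H θ (inst (s j)).2 (inst (s j)).1 η : ℝ)) / m
            - ∫ z, (gdCost H θ (inst z).2 (inst z).1 η : ℝ) ∂D| ≤ t}) →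
      ∀ m : ℕ,
        C * ((H : ℝ) ^ 2 / ε ^ 2 *
            ((q : ℝ) ^ 2 * (d : ℝ) ^ 2 * (H : ℝ) ^ 2
              + (q : ℝ) * d * H * Real.log (Δ + M) + Real.log (1 / δ))) ≤ m →
        ENNReal.ofReal (1 - δ) ≤
          (Measure.pi fun _ : Fin m => D)
            {s : Fin m → Ω | ∀ η ∈ P,
              |(∑ j : Fin m, (gdCost H θ (inst (s j)).2 (inst (s j)).1 η : ℝ)) / m
                - ∫ z, (gdCost H θ (inst z).2 (inst z).1 η : ℝ) ∂D| ≤ ε} := by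
  refine ⟨95 * 8192, by norm_num, ?_⟩
  intro d H q M Δ hd hH hq hM hΔ θ hθ Ω _ inst hinst P hP hPm D hD ε δ hε hδ hδ1 hmeas m hm
  have hdR : (1:ℝ) ≤ d := by exact_mod_cast hd
  have hHR : (1:ℝ) ≤ H := by exact_mod_cast hH
  have hqR : (1:ℝ) ≤ q := by exact_mod_cast hq
  have hMR : (1:ℝ) ≤ M := by exact_mod_cast hM
  have hΔR : (1:ℝ) ≤ Δ := by exact_mod_cast hΔ
  have hH0 : (0:ℝ) < H := by linarith
  set c : ℝ → Ω → ℝ := fun η z => (gdCost H θ (inst z).2 (inst z).1 η : ℝ) with hc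
  have hc0 : ∀ η z, 0 ≤ c η z := fun η z => Nat.cast_nonneg _
  have hcH : ∀ η z, c η z ≤ H := fun η z => Nat.cast_le.2 (fin_cost_le _ _ _ _ _)
  have hone : (Measure.pi fun _ : Fin m => D) Set.univ = 1 := measure_univ
  change ENNReal.ofReal (1 - δ) ≤ (Measure.pi fun _ : Fin m => D)
    {s : Fin m → Ω | ∀ η ∈ P, |(∑ j : Fin m, c η (s j)) / m - ∫ z, c η z ∂D| ≤ ε}
  have hGm : MeasurableSet {s : Fin m → Ω | ∀ η ∈ P, |(∑ j : Fin m, c η (s j)) / m - ∫ z, c η z ∂D| ≤ ε} := hmeas m ε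
  rcases le_or_gt (H:ℝ) ε with hεH | hεH
  · have : {s : Fin m → Ω | ∀ η ∈ P, |(∑ j : Fin m, c η (s j)) / m - ∫ z, c η z ∂D| ≤ ε} = Set.univ := by
      refine Set.eq_univ_of_forall fun s η hη => ?_
      have hI : Integrable (c η) D := emp_int (hPm η hη) (B := H) fun z => by
        rw [abs_of_nonneg (hc0 η z)]; exact hcH η z
      have i1 : 0 ≤ ∫ z, c η z ∂D := integral_nonneg (hc0 η)
      have i2 : ∫ z, c η z ∂D ≤ H := by
        calc ∫ z, c η z ∂D ≤ ∫ _, (H:ℝ) ∂D := integral_mono hI (integrable_const _) (hcH η)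
          _ = H := by simp
      have s1 : 0 ≤ (∑ j : Fin m, c η (s j)) / m := div_nonneg (Finset.sum_nonneg fun j _ => hc0 η _) (Nat.cast_nonneg _)
      have s2 : (∑ j : Fin m, c η (s j)) / m ≤ H := by
        refine div_le_of_le_mul₀ (Nat.cast_nonneg _) hH0.le ?_
        calc ∑ j : Fin m, c η (s j) ≤ ∑ _j : Fin m, (H:ℝ) := Finset.sum_le_sum fun j _ => hcH η _
          _ = H * m := by simp [mul_comm]
      rw [abs_le]; constructor <;> linarith
    rw [this, hone]
    exact ENNReal.ofReal_le_one.2 (by linarith)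
  obtain ⟨hN1, hlogN⟩ := fin_log hd hH hq hM hΔ
  set N := H * khBound (H * (d + q)) (H * (Δ + 2 * M + 1)) (2 * (Δ + M)) with hNdef
  set Y : ℝ := (q : ℝ) ^ 2 * (d : ℝ) ^ 2 * (H : ℝ) ^ 2 + (q : ℝ) * d * H * Real.log (Δ + M) with hY
  have hlogδ : 0 ≤ Real.log (1 / δ) := Real.log_nonneg (by rw [le_div_iff₀ hδ]; linarith)
  have hY1 : 1 ≤ Y := by
    have h1 : (1:ℝ) ≤ (q : ℝ) ^ 2 * (d : ℝ) ^ 2 * (H : ℝ) ^ 2 :=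
      one_le_mul_of_one_le_of_one_le (one_le_mul_of_one_le_of_one_le (one_le_pow₀ hqR) (one_le_pow₀ hdR)) (one_le_pow₀ hHR)
    have h2 : 0 ≤ Real.log ((Δ:ℝ) + M) := Real.log_nonneg (by linarith)
    have h3 : 0 ≤ (q : ℝ) * d * H * Real.log (Δ + M) := by positivity
    linarith
  obtain ⟨A, hA⟩ : ∃ A : ℝ, A = m * (ε / H / 2) ^ 2 / 2048 := ⟨_, rfl⟩
  have hAge : 95 * (Y + Real.log (1 / δ)) ≤ A := by
    have e : 95 * (Y + Real.log (1 / δ)) = (95 * 8192 * ((H : ℝ) ^ 2 / ε ^ 2 * (Y + Real.log (1 / δ)))) * (ε / H / 2) ^ 2 / 2048 := by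
      field_simp; ring
    rw [e, hA]
    gcongr
  have hA16 : 16 ≤ A := by linarith
  have hm0 : (0:ℝ) < m := by
    rcases Nat.eq_zero_or_pos m with h | h
    · rw [h] at hA; norm_num at hA; linarith
    · exact_mod_cast h
  set l : ℝ → Ω → ℝ := fun η z => c η z / H with hl
  have h01 : ∀ x z, 0 ≤ l x z ∧ l x z ≤ 1 := fun x z => ⟨div_nonneg (hc0 x z) hH0.le, (div_le_one hH0).2 (hcH x z)⟩
  have hchg : empChg N l := by
    intro z u hu r
    refine le_trans (Finset.card_le_card ?_) (gd_cost_changes H M Δ hH θ hθ (inst z).2 (hinst z) (inst z).1 u hu r)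
    intro i hi
    simp only [Finset.mem_filter] at hi ⊢
    refine ⟨hi.1, fun h => hi.2 ?_⟩
    simp only [hl, hc, h]
  have hS : ∀ (s : Fin m → Ω) η, empS D s (l η) = (m / H) * ((∑ j : Fin m, c η (s j)) / m - ∫ z, c η z ∂D) := by
    intro s η
    simp only [empS, hl, integral_div, Finset.sum_sub_distrib, Finset.sum_const, Finset.card_univ, Fintype.card_fin, nsmul_eq_mul,
      ← Finset.sum_div]
    field_simp
  have hset : {s : Fin m → Ω | ∃ x ∈ P, m * (ε / H) < |empS D s (l x)|} =
      {s : Fin m → Ω | ∀ η ∈ P, |(∑ j : Fin m, c η (s j)) / m - ∫ z, c η z ∂D| ≤ ε}ᶜ := by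
    ext s
    simp only [Set.mem_ofPred_eq, Set.mem_compl_iff, not_forall, not_le, exists_prop]
    refine exists_congr fun η => and_congr_right fun _ => ?_
    have hmH : (0:ℝ) < m / H := by positivity
    rw [hS, abs_mul, abs_of_pos hmH, show (m:ℝ) * (ε / H) = m / H * ε by ring]
    exact mul_lt_mul_iff_right₀ hmH
  have hmain := emp_general (D := D) hN1 hchg h01 P (fun x hx => (hPm x hx).div_const _) (ε := ε / H) (A := A)
    (by positivity) ((div_le_one hH0).2 hεH.le) m hA hA16 (by rw [hset]; exact hGm.compl)
  rw [hset] at hmain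
  have hfin : 10 * (N:ℝ) * Real.exp (-A) ≤ δ := by
    have hNpos : (0:ℝ) < N := by exact_mod_cast hN1
    have h10 := Real.log_le_sub_one_of_pos (show (0:ℝ) < 10 by norm_num)
    have h1 : Real.log (10 * (N:ℝ) * Real.exp (-A)) ≤ Real.log δ := by
      rw [Real.log_mul (by positivity) (by positivity), Real.log_mul (by positivity) (by positivity), Real.log_exp]
      have : Real.log (1 / δ) = - Real.log δ := by rw [one_div, Real.log_inv]
      linarith
    exact (Real.log_le_log_iff (by positivity) hδ).1 h1
  have hcompl := hmain.trans (ENNReal.ofReal_le_ofReal hfin)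
  rw [prob_compl_eq_one_sub hGm] at hcompl
  rw [ENNReal.ofReal_sub _ hδ.le, ENNReal.ofReal_one]
  exact tsub_le_iff_tsub_le.1 hcompl
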